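/- Let S = {a, a', b, b', c, c'} be a six-letter alphabet with complementation, let d ∈ {5, 6}, and let V, W ⊆ S^d be disjoint equivalent polybox codes without twin pairs with |V| ∈ {13,...,16} such that V is not flat. Then: (i) there are no i ∈ [d] and l ∈ S with {|V^{i,l}|, |V^{i,l'}|} = {1, M} for M ∈ {2, 3, 4}, and |V^{i,l}| ≤ 11 for every i ∈ [d] and l ∈ S; (ii) if |V^{i,l}| ≥ 2 and |V^{i,l'}| ≥ 2, or |V^{i,l}| = 1 and |V^{i,l'}| ≥ 5, for some i ∈ [d] and l ∈ S, then there is a word w ∈ W^{i,s} ∪ W^{i,s'} for some s ∉ {l, l'} such that w̆ ∩ ⋃E(V^{i,l} ∪ V^{i,l'}) ≠ ∅. -/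

import Mathlib

/-- The six-letter alphabet `S = {a, a', b, b', c, c'}` is modelled as `Fin 6` with
`a = 0, a' = 1, b = 2, b' = 3, c = 4, c' = 5`; the complementation swaps `0 ↔ 1`,
`2 ↔ 3`, `4 ↔ 5`. -/
def compl6 : Fin 6 → Fin 6 := ![1, 0, 3, 2, 5, 4]

/-- Two words `u, v ∈ S^d` are dichotomous if `v j = (u j)'` for some coordinate `j`. -/
def Dichotomous {S : Type*} (c : S → S) {d : ℕ} (u v : Fin d → S) : Prop :=
  ∃ j, v j = c (u j)

/-- Two words form a twin pair if they differ by complementation at exactly one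
coordinate and agree elsewhere. -/
def TwinPair {S : Type*} (c : S → S) {d : ℕ} (u v : Fin d → S) : Prop :=
  ∃ j, v j = c (u j) ∧ ∀ i, i ≠ j → u i = v i

/-- A polybox code: a set of pairwise dichotomous words. -/
def PolyboxCode {S : Type*} (c : S → S) {d : ℕ} (V : Finset (Fin d → S)) : Prop :=
  ∀ u ∈ V, ∀ v ∈ V, u ≠ v → Dichotomous c u v

/-- A code without twin pairs. -/
def TwinPairFree {S : Type*} (c : S → S) {d : ℕ} (V : Finset (Fin d → S)) : Prop :=
  ∀ u ∈ V, ∀ v ∈ V, ¬ TwinPair c u v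

/-- `ES`: the collection of all `B ⊆ S` containing exactly one letter from each
complementary pair `{s, s'}`. -/
def ESet {S : Type*} (c : S → S) : Set (Set S) :=
  {B | ∀ s : S, Xor' (s ∈ B) (c s ∈ B)}

/-- The equicomplementary realization `v̆ = Ev₁ × ⋯ × Ev_d` of a word `v`,
where `Es = {B ∈ ES : s ∈ B}`. -/
def WordBox {S : Type*} (c : S → S) {d : ℕ} (v : Fin d → S) : Set (Fin d → Set S) :=
  {x | ∀ i, x i ∈ ESet c ∧ v i ∈ x i}

/-- `⋃ E(V)`, the union of the equicomplementary realizations of the words of `V`. -/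
def CodeReal {S : Type*} (c : S → S) {d : ℕ} (V : Finset (Fin d → S)) :
    Set (Fin d → Set S) :=
  ⋃ v ∈ V, WordBox c v

/-- The word `w` is covered by the code `V`, i.e. `w̆ ⊆ ⋃ E(V)`. -/
def Covered {S : Type*} (c : S → S) {d : ℕ} (w : Fin d → S)
    (V : Finset (Fin d → S)) : Prop :=
  WordBox c w ⊆ CodeReal c V

/-- Codes `V` and `W` are equivalent: `⋃ E(V) = ⋃ E(W)`. -/
def EquivalentCodes {S : Type*} (c : S → S) {d : ℕ} (V W : Finset (Fin d → S)) : Prop :=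
  CodeReal c V = CodeReal c W

/-- A code is flat if all its words share the same fixed letter at some fixed
coordinate, i.e. `V = V^{i,l}` for some `i ∈ [d]` and `l ∈ S`. -/
def IsFlat {S : Type*} (c : S → S) {d : ℕ} (V : Finset (Fin d → S)) : Prop :=
  ∃ i : Fin d, ∃ l : S, ∀ v ∈ V, v i = l


set_option linter.all false
section PB
variable {ι : Type} [Fintype ι] [DecidableEq ι]
  {C V W X Y A : Finset (ι → Fin 6)} {a a1 a2 c w o e : ι → Fin 6} {k j m i : ι} {u s t r ξ κ l z : Fin 6}
local notation "co" => compl6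
local notation "upd" => Function.update
local notation "Wrd" => ι → Fin 6


def inn (s : Fin 6) (p : Fin 8) : Prop :=
  (Nat.testBit p.val (s.val/2) != (s.val % 2 == 1)) = true
instance instDecInn (s : Fin 6) (p : Fin 8) : Decidable (inn s p) := by unfold inn; infer_instance
theorem co_co : ∀ s, co (co s) = s := by decide
theorem co_ne : ∀ s, co s ≠ s := by decide
theorem ne_co : ∀ s, s ≠ co s := by decide
theorem co_inj : ∀ s t, co s = co t → s = t := by decide
theorem co_sw : ∀ s t, co s = t ↔ s = co t := by decide
theorem inn_co : ∀ s p, inn (co s) p ↔ ¬ inn s p := by decide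
theorem inn_ex : ∀ s, ∃ p, inn s p := by decide
theorem inn_ex2 : ∀ s t, s ≠ co t → ∃ p, inn s p ∧ inn t p := by decide
theorem inn_ex2n : ∀ s t, s ≠ t → ∃ p, inn s p ∧ ¬ inn t p := by decide
theorem inn_ex3 : ∀ s t v, t ≠ co s → v ≠ s → v ≠ t → ∃ p, inn s p ∧ inn t p ∧ ¬ inn v p := by
  decide +kernel
theorem letters : ∀ s t u : Fin 6, s ≠ t → s ≠ co t → u ≠ s → u ≠ co s → u ≠ t → u ≠ co t →
    ∀ v, v = s ∨ v = co s ∨ v = t ∨ v = co t ∨ v = u ∨ v = co u := by decide +kernel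
def In (v : Wrd) (x : ι → Fin 8) : Prop := ∀ j, inn (v j) (x j)
def D (u v : Wrd) : Prop := ∃ j, u j = co (v j)
instance instDecIn (v : Wrd) (x : ι → Fin 8) : Decidable (In v x) := by
  unfold In; infer_instance
instance instDecD (v w : Wrd) : Decidable (D v w) := by unfold D; infer_instance
def Tw (u v : Wrd) : Prop := ∃ j, v j = co (u j) ∧ ∀ i, i ≠ j → u i = v i
def Code (C : Finset Wrd) : Prop := ∀ u ∈ C, ∀ v ∈ C, u ≠ v → D u v
def TF (C : Finset Wrd) : Prop := ∀ u ∈ C, ∀ v ∈ C, ¬ Tw u v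
def Cov (C : Finset Wrd) (a : Wrd) : Prop := ∀ x, In a x → ∃ c ∈ C, In c x
def M (C : Finset Wrd) (a : Wrd) : Finset Wrd := C.filter (fun c => ¬ D c a)
def N (C : Finset Wrd) (a : Wrd) (k : ι) (s : Fin 6) : Finset Wrd :=
  C.filter (fun c => ¬ D c a ∧ c k = s)
theorem mem_M {a c} : c ∈ M C a ↔ c ∈ C ∧ ¬ D c a := by simp [M]
theorem mem_N {a c k s} : c ∈ N C a k s ↔ c ∈ C ∧ ¬ D c a ∧ c k = s := by
  simp [N]
theorem D_symm {u v : Wrd} : D u v ↔ D v u := by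
  unfold D; constructor <;> rintro ⟨j, h⟩ <;> exact ⟨j, by rw [h, co_co]⟩
theorem Tw_symm {u v : Wrd} : Tw u v ↔ Tw v u := by
  unfold Tw; constructor <;> rintro ⟨j, h, g⟩ <;>
    exact ⟨j, by rw [h, co_co], fun i hi => (g i hi).symm⟩
theorem In_ex (u : Wrd) : ∃ x, In u x := by
  choose f hf using fun j => inn_ex (u j)
  exact ⟨f, hf⟩
theorem notD_of_In {u v : Wrd} {x} (h : In u x) (g : In v x) : ¬ D u v := by
  rintro ⟨j, hj⟩
  have := h j
  rw [hj, inn_co] at this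
  exact this (g j)
theorem ex_of_notD {u v : Wrd} (h : ¬ D u v) : ∃ x, In u x ∧ In v x := by
  have : ∀ j, ∃ p, inn (u j) p ∧ inn (v j) p := fun j =>
    inn_ex2 _ _ (fun e => h ⟨j, e⟩)
  choose f hf using this
  exact ⟨f, fun j => (hf j).1, fun j => (hf j).2⟩
theorem D_irr (u : Wrd) : ¬ D u u := by
  rintro ⟨j, hj⟩; exact ne_co _ hj
theorem Tw_D {u v : Wrd} (h : Tw u v) : D u v := by
  obtain ⟨j, h, g⟩ := h
  exact ⟨j, by rw [h, co_co]⟩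
theorem sub_eq {u v : Wrd} (h : ∀ x, In u x → In v x) : u = v := by
  funext j
  by_contra hj
  obtain ⟨p, h1, h2⟩ := inn_ex2n _ _ hj
  obtain ⟨x, hx⟩ := In_ex u
  refine h2 ?_
  have := h (upd x j p) (fun i => by
    by_cases e : i = j
    · subst e; simpa using h1
    · simpa [e] using hx i) j
  simpa using this
theorem code_eq (hC : Code C) {u v x} (hu : u ∈ C) (hv : v ∈ C)
    (h : In u x) (g : In v x) : u = v := by
  by_contra e
  exact notD_of_In h g (hC u hu v hv e)
theorem In_upd {v : Wrd} {k s x} : In (upd v k s) x ↔ inn s (x k) ∧ ∀ j, j ≠ k → inn (v j) (x j) := by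
  constructor
  · intro h
    exact ⟨by simpa using h k, fun j hj => by simpa [hj] using h j⟩
  · rintro ⟨h, g⟩ j
    by_cases e : j = k
    · subst e; simpa using h
    · simpa [e] using g j e
theorem In_updx {v : Wrd} {k p x} : In v (upd x k p) ↔ inn (v k) p ∧ ∀ j, j ≠ k → inn (v j) (x j) := by
  constructor
  · intro h
    exact ⟨by simpa using h k, fun j hj => by simpa [hj] using h j⟩
  · rintro ⟨h, g⟩ j
    by_cases e : j = k
    · subst e; simpa using h
    · simpa [e] using g j e
theorem Code.mono (hC : Code C) (h : A ⊆ C) : Code A :=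
  fun u hu v hv => hC u (h hu) v (h hv)
theorem TF.mono (hC : TF C) (h : A ⊆ C) : TF A :=
  fun u hu v hv => hC u (h hu) v (h hv)
theorem Cov.mono {a} (hC : Cov A a) (h : A ⊆ C) : Cov C a :=
  fun x hx => by obtain ⟨c, hc, hh⟩ := hC x hx; exact ⟨c, h hc, hh⟩
theorem M_sub {a} : M C a ⊆ C := Finset.filter_subset _ _
theorem N_sub {a k s} : N C a k s ⊆ C := Finset.filter_subset _ _
theorem N_sub_M {a k s} : N C a k s ⊆ M C a := by
  intro c; simp [mem_N, mem_M]; tauto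
theorem Cov_M {a} (h : Cov C a) : Cov (M C a) a := by
  intro x hx
  obtain ⟨c, hc, hh⟩ := h x hx
  exact ⟨c, mem_M.2 ⟨hc, notD_of_In hh hx⟩, hh⟩
theorem Reg {x} (hC : Code C)
    (ha : Cov C a) (h1 : u ≠ a k) (h2 : u ≠ co (a k)) (hc : c ∈ C) (hck : c k = u) (hxa : In a x)
    (hxc : In (upd c k (a k)) x) :
    ∃ d ∈ N C a k (co u), In (upd d k (a k)) x := by
  obtain ⟨B, hB1, hB2⟩ := inn_ex2n (a k) u (Ne.symm h1)
  rw [In_upd] at hxc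
  have hy : In a (upd x k B) := In_updx.2 ⟨hB1, fun j _ => hxa j⟩
  obtain ⟨d, hd, hdy⟩ := ha _ hy
  have hdm := notD_of_In hdy hy
  rw [In_updx] at hdy
  have hdk : d k = co u := by
    by_contra e
    obtain ⟨B', h3, h4⟩ := inn_ex2 _ _ e
    have : d = c := code_eq hC hd hc (x := upd x k B') (In_updx.2 ⟨h3, hdy.2⟩)
      (In_updx.2 ⟨by rw [hck]; exact h4, hxc.2⟩)
    rw [this, hck] at hdy
    exact hB2 hdy.1
  exact ⟨d, mem_N.2 ⟨hd, hdm, hdk⟩, In_upd.2 ⟨hxa k, hdy.2⟩⟩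
theorem notD_upd (h : ¬ D c a) : ¬ D (upd c k (a k)) a := by
  rintro ⟨j, hj⟩
  by_cases e : j = k
  · subst e; simp at hj; exact ne_co _ hj
  · simp [e] at hj; exact h ⟨j, hj⟩
theorem PAT1 (hC : Code C)
    (ha : Cov C a) (h1 : u ≠ a k) (h : (N C a k u).Nonempty) : (N C a k (co u)).Nonempty := by
  obtain ⟨c, hc⟩ := h
  rw [mem_N] at hc
  have h2 : u ≠ co (a k) := fun e => hc.2.1 ⟨k, by rw [hc.2.2, e]⟩
  obtain ⟨x, hx1, hx2⟩ := ex_of_notD (notD_upd (k := k) hc.2.1)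
  obtain ⟨d, hd, _⟩ := Reg hC ha h1 h2 hc.1 hc.2.2 hx2 hx1
  exact ⟨d, hd⟩
/-- agreement part of PAT2 -/
theorem PAT2a {a c d : Wrd} (hC : Code C)
    (ha : Cov C a) (h1 : u ≠ a k) (h : N C a k u = {c}) (hd : d ∈ N C a k (co u))
    (hj : j ≠ k) (hca : c j ≠ a j) : d j = c j := by
  have hc : c ∈ N C a k u := by simp [h]
  rw [mem_N] at hc hd
  have h2 : u ≠ co (a k) := fun e => hc.2.1 ⟨k, by rw [hc.2.2, e]⟩
  by_contra e
  obtain ⟨x, hx1, hx2⟩ := ex_of_notD (notD_upd (k := k) hd.2.1)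
  have hda : a j ≠ co (d j) := fun e' => hd.2.1 ⟨j, by rw [e', co_co]⟩
  obtain ⟨p, hp1, hp2, hp3⟩ := inn_ex3 (d j) (a j) (c j) hda (Ne.symm e) hca
  have hxa : In a (upd x j p) := In_updx.2 ⟨hp2, fun i _ => hx2 i⟩
  have hxd : In (upd d k (a k)) (upd x j p) := In_updx.2 ⟨by simpa [hj] using hp1, fun i _ => hx1 i⟩
  obtain ⟨d', hd', hx'⟩ := Reg hC ha (u := co u) (by
    intro e; apply h2; rw [← e, co_co]) (by intro e; exact h1 (co_inj _ _ e)) hd.1 hd.2.2 hxa hxd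
  rw [co_co, h, Finset.mem_singleton] at hd'
  rw [hd'] at hx'
  have := hx' j
  simp [hj] at this
  exact hp3 this
theorem PAT2b (hC : Code C)
    (ha : Cov C a) (h1 : u ≠ a k) (h : N C a k u = {c}) :
    Cov (N C a k (co u)) (upd c k (co u)) := by
  have hc : c ∈ N C a k u := by simp [h]
  rw [mem_N] at hc
  have h2 : u ≠ co (a k) := fun e => hc.2.1 ⟨k, by rw [hc.2.2, e]⟩
  intro x hx
  rw [In_upd] at hx
  have key : ∀ j, ∃ q, inn (a j) q ∧ (j ≠ k → inn (c j) q) ∧ (c j = a j → j ≠ k → q = x j) := by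
    intro j
    by_cases hjk : j = k
    · obtain ⟨q, hq⟩ := inn_ex (a j); exact ⟨q, hq, by simp [hjk], by simp [hjk]⟩
    · by_cases e : c j = a j
      · exact ⟨x j, e ▸ hx.2 j hjk, fun _ => hx.2 j hjk, fun _ _ => rfl⟩
      · obtain ⟨q, hq⟩ := inn_ex2 (a j) (c j) (fun e' => hc.2.1 ⟨j, by rw [e', co_co]⟩)
        exact ⟨q, hq.1, fun _ => hq.2, fun e' => absurd e' e⟩
  choose y hy1 hy2 hy3 using key
  obtain ⟨d, hd, hdy⟩ := Reg hC ha h1 h2 hc.1 hc.2.2 (x := y) hy1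
    (In_upd.2 ⟨hy1 k, fun j hj => hy2 j hj⟩)
  refine ⟨d, hd, fun j => ?_⟩
  by_cases hjk : j = k
  · subst hjk; rw [(mem_N.1 hd).2.2]; exact hx.1
  · by_cases e : c j = a j
    · rw [← hy3 j e hjk]; simpa [hjk] using hdy j
    · rw [PAT2a hC ha h1 h hd hjk e]; exact hx.2 j hjk
/-- if every word meeting `a` has letter `u` or `co u` at `k`, then `N u` covers -/
theorem PAT3
    (ha : Cov C a) (h2 : u ≠ co (a k))
    (h : ∀ c ∈ M C a, c k = u ∨ c k = co u) :
    Cov (N C a k u) (upd a k u) := by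
  intro x hx
  rw [In_upd] at hx
  obtain ⟨p, hp1, hp2⟩ := inn_ex2 (a k) u (by rw [ne_eq, ← co_sw]; exact fun e => h2 e.symm)
  have hxa : In a (upd x k p) := In_updx.2 ⟨hp1, hx.2⟩
  obtain ⟨c, hc, hcx⟩ := ha _ hxa
  have hcm := notD_of_In hcx hxa
  rw [In_updx] at hcx
  have hck : c k = u := by
    rcases h c (mem_M.2 ⟨hc, hcm⟩) with e | e
    · exact e
    · have := hcx.1; rw [e, inn_co] at this; exact absurd hp2 this
  exact ⟨c, mem_N.2 ⟨hc, hcm, hck⟩, fun j => by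
    by_cases e : j = k
    · subst e; rw [hck]; exact hx.1
    · exact hcx.2 j e⟩
attribute [irreducible] N M
theorem univ6 (z u t : Fin 6) (h1 : u ≠ z) (h2 : u ≠ co z) (h3 : t ≠ z) (h4 : t ≠ co z) (h5 : t ≠ u)
    (h6 : t ≠ co u) :
   (Finset.univ : Finset (Fin 6)) = {z, co z, u, co u, t, co t} := by
  ext v
  have := letters z u t (Ne.symm h1) (fun e => h2 (by rw [e, co_co])) h3 h4 h5 h6 v
  simpa using this
theorem sum6 (z u t : Fin 6) (h1 : u ≠ z) (h2 : u ≠ co z) (h3 : t ≠ z) (h4 : t ≠ co z) (h5 : t ≠ u)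
    (h6 : t ≠ co u) (f : Fin 6 → ℕ) :
    ∑ s, f s = f z + f (co z) + f u + f (co u) + f t + f (co t) := by
  rw [univ6 z u t h1 h2 h3 h4 h5 h6, Finset.sum_insert, Finset.sum_insert, Finset.sum_insert,
    Finset.sum_insert, Finset.sum_insert, Finset.sum_singleton]
  · ring
  all_goals simp only [Finset.mem_insert, Finset.mem_singleton]; grind [co_co, ne_co]
theorem N_co : N C a k (co (a k)) = ∅ := by
  ext c; simp [mem_N]; intro _ h h2; exact h ⟨k, h2⟩
theorem third' : ∀ z u : Fin 6, u ≠ z → u ≠ co z → ∃ t, t ≠ z ∧ t ≠ co z ∧ t ≠ u ∧ t ≠ co u := by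
  decide
theorem cardM (C : Finset Wrd) (a : Wrd) (k : ι)
    (h1 : u ≠ a k) (h2 : u ≠ co (a k)) (h3 : t ≠ a k) (h4 : t ≠ co (a k)) (h5 : t ≠ u) (h6 : t ≠ co u) :
    (M C a).card = (N C a k (a k)).card + (N C a k u).card + (N C a k (co u)).card +
      (N C a k t).card + (N C a k (co t)).card := by
  have : (M C a).card = ∑ s, (N C a k s).card := by
    rw [Finset.card_eq_sum_card_fiberwise (f := fun c => c k) (t := Finset.univ) (by simp)]
    refine Finset.sum_congr rfl fun s _ => ?_
    congr 1
    ext c; simp [mem_N, mem_M]; tauto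
  rw [this, sum6 (a k) u t h1 h2 h3 h4 h5 h6, N_co]
  simp
theorem twin_upd (h : c k = u) : Tw c (upd c k (co u)) :=
  ⟨k, by simp [h], fun i hi => by simp [hi]⟩
theorem Cov_single {c b : Wrd} (h : Cov {c} b) : b = c := by
  apply sub_eq; intro x hx; simpa using h x hx
theorem notD_updk {s} (h : ¬ D c a) (hs : c k = s) : ¬ D c (upd a k s) := by
  rintro ⟨j, hj⟩
  by_cases e : j = k
  · subst e; simp [hs] at hj; exact ne_co _ hj
  · simp [e] at hj; exact h ⟨j, hj⟩
theorem ex_diff (ha : Cov C a) (h : a ∉ C) :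
    ∃ c ∈ M C a, ∃ k, c k ≠ a k ∧ c k ≠ co (a k) := by
  obtain ⟨x, hx⟩ := In_ex a
  obtain ⟨c, hc, hcx⟩ := ha x hx
  have hm := notD_of_In hcx hx
  have : c ≠ a := fun e => h (e ▸ hc)
  obtain ⟨k, hk⟩ := Function.ne_iff.1 this
  exact ⟨c, mem_M.2 ⟨hc, hm⟩, k, hk, fun e => hm ⟨k, e⟩⟩
theorem mem_all_meet (hC : Code C) (h : a ∈ C) : M C a = {a} := by
  ext c
  rw [mem_M, Finset.mem_singleton]
  constructor
  · rintro ⟨h1, h2⟩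
    by_contra e; exact h2 (hC _ h1 _ h e)
  · rintro rfl; exact ⟨h, D_irr _⟩
theorem L1 : ∀ (n : ℕ) (C : Finset Wrd) (a : Wrd), C.card = n → Code C → TF C → Cov C a → a ∉ C →
    5 ≤ (M C a).card := by
  intro n
  induction n using Nat.strong_induction_on with
  | _ n ih =>
  intro C a hn hC hT ha hna
  obtain ⟨c, hc, k, hk1, hk2⟩ := ex_diff ha hna
  rw [mem_M] at hc
  set u := c k with hu
  obtain ⟨t, ht⟩ := third' (a k) u hk1 hk2
  have hcard := cardM C a k hk1 hk2 ht.1 ht.2.1 ht.2.2.1 ht.2.2.2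
  have hu1 : (N C a k u).Nonempty := ⟨c, mem_N.2 ⟨hc.1, hc.2, rfl⟩⟩
  have hu2 : (N C a k (co u)).Nonempty := PAT1 hC ha hk1 hu1
  have hk1' : co u ≠ a k := fun e => hk2 ((co_sw _ _).1 e)
  have hk2' : co u ≠ co (a k) := fun e => hk1 (co_inj _ _ e)
  have key : ∀ v, v ≠ a k → (N C a k v).card = 1 → 5 ≤ (N C a k (co v)).card := by
    intro v hv h1
    obtain ⟨e, he⟩ := Finset.card_eq_one.1 h1
    have heN : e ∈ N C a k v := by simp [he]
    rw [mem_N] at heN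
    have h2 := PAT2b hC ha hv he
    have hlt : (N C a k (co v)).card < n := by
      rw [← hn]
      refine Finset.card_lt_card (Finset.ssubset_iff_subset_ne.2 ⟨N_sub, fun h => ?_⟩)
      have : e ∈ N C a k (co v) := by rw [h]; exact heN.1
      rw [mem_N] at this
      exact ne_co v (heN.2.2.symm.trans this.2.2)
    refine (ih _ hlt _ _ rfl (hC.mono N_sub) (hT.mono N_sub) h2 ?_).trans (Finset.card_le_card M_sub)
    intro hmem
    exact hT _ heN.1 _ (N_sub hmem) (twin_upd heN.2.2)
  by_contra hlt
  have a1 := key u hk1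
  have a2 := key (co u) hk1'
  rw [co_co] at a2
  have := hu1.card_pos
  have := hu2.card_pos
  have hN : (N C a k u).card = 2 := by omega
  have h3 : ∀ d ∈ M C a, d k = u ∨ d k = co u := by
    intro d hd
    by_contra hcon
    push Not at hcon
    have hdN : d ∈ N C a k (d k) := mem_N.2 ⟨(mem_M.1 hd).1, (mem_M.1 hd).2, rfl⟩
    have hz : (N C a k (a k)).card = 0 := by omega
    have ht1 : (N C a k t).card = 0 := by omega
    have ht2 : (N C a k (co t)).card = 0 := by omega
    rw [Finset.card_eq_zero] at hz ht1 ht2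
    have hzz : N C a k (co (a k)) = ∅ := N_co
    have := letters (a k) u t (Ne.symm hk1) (fun e => hk2 (by rw [e, co_co])) ht.1 ht.2.1 ht.2.2.1 ht.2.2.2 (d k)
    rcases this with h | h | h | h | h | h
    · rw [h, hz] at hdN; simp at hdN
    · rw [h, hzz] at hdN; simp at hdN
    · exact hcon.1 h
    · exact hcon.2 h
    · rw [h, ht1] at hdN; simp at hdN
    · rw [h, ht2] at hdN; simp at hdN
  have hcov := PAT3 ha hk2 h3
  have hmem : upd a k u ∈ N C a k u := by
    by_contra hnm
    have hlt : (N C a k u).card < n := by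
      rw [← hn]
      refine Finset.card_lt_card (Finset.ssubset_iff_subset_ne.2 ⟨N_sub, fun h => ?_⟩)
      obtain ⟨e, he⟩ := hu2
      have : e ∈ N C a k u := by rw [h]; exact (mem_N.1 he).1
      rw [mem_N] at this he
      exact ne_co u (this.2.2.symm.trans he.2.2)
    have := (ih _ hlt _ _ rfl (hC.mono N_sub) (hT.mono N_sub) hcov hnm).trans (Finset.card_le_card M_sub)
    omega
  have h4 := mem_all_meet (hC.mono (N_sub (a := a) (k := k) (s := u))) hmem
  have h5 : M (N C a k u) (upd a k u) = N C a k u := by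
    ext d; rw [mem_M]
    refine ⟨fun h => h.1, fun h => ⟨h, ?_⟩⟩
    rw [mem_N] at h
    exact notD_updk h.2.1 h.2.2
  rw [h5] at h4
  rw [h4] at hN
  simp at hN
theorem L1M (hC : Code C) (hT : TF C) (ha : Cov C a)
    (h : a ∉ C) : 5 ≤ (M C a).card := L1 _ C a rfl hC hT ha h
theorem L1C (hC : Code C) (hT : TF C) (ha : Cov C a)
    (h : a ∉ C) : 5 ≤ C.card := (L1M hC hT ha h).trans (Finset.card_le_card M_sub)
theorem LR1 (hC : Code C) (hT : TF C) (ha : Cov C a)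
    (h1 : u ≠ a k) (h : (N C a k u).card = 1) : 5 ≤ (N C a k (co u)).card := by
  obtain ⟨e, he⟩ := Finset.card_eq_one.1 h
  have heN : e ∈ N C a k u := by simp [he]
  rw [mem_N] at heN
  refine L1C (hC.mono N_sub) (hT.mono N_sub) (PAT2b hC ha h1 he) ?_
  intro hmem
  exact hT _ heN.1 _ (N_sub hmem) (twin_upd heN.2.2)
theorem co_conj (h1 : u ≠ z) (h2 : u ≠ co z) : co u ≠ z ∧ co u ≠ co z :=
  ⟨fun e => h2 ((co_sw _ _).1 e), fun e => h1 (co_inj _ _ e)⟩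
theorem LR (hC : Code C) (hT : TF C) (ha : Cov C a)
    (h1 : u ≠ a k) (h2 : u ≠ co (a k)) :
    ((N C a k u).card = 0 ∧ (N C a k (co u)).card = 0) ∨
    (2 ≤ (N C a k u).card ∧ 2 ≤ (N C a k (co u)).card) ∨
    ((N C a k u).card = 1 ∧ 5 ≤ (N C a k (co u)).card) ∨
    (5 ≤ (N C a k u).card ∧ (N C a k (co u)).card = 1) := by
  have a1 := LR1 hC hT ha h1
  have a2 := LR1 hC hT ha (co_conj h1 h2).1
  have a3 := PAT1 hC ha h1
  have a4 := PAT1 hC ha (co_conj h1 h2).1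
  rw [co_co] at a2 a4
  rw [← Finset.card_pos, ← Finset.card_pos] at a3 a4
  omega
/-- push of words to the letter of `a` -/
def Pr (C : Finset Wrd) (a : Wrd) (k : ι) (u : Fin 6) : Finset Wrd :=
  N C a k (a k) ∪ (N C a k u).image (fun c => upd c k (a k))
theorem mem_Pr :
    w ∈ Pr C a k u ↔ w ∈ N C a k (a k) ∨ (w k = a k ∧ upd w k u ∈ N C a k u) := by
  unfold Pr
  rw [Finset.mem_union, Finset.mem_image]
  constructor
  · rintro (h | ⟨c, hc, rfl⟩)
    · exact Or.inl h
    · refine Or.inr ⟨by simp, ?_⟩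
      have : c k = u := (mem_N.1 hc).2.2
      have e : upd (upd c k (a k)) k u = c := by rw [Function.update_idem, ← this, Function.update_eq_self]
      rw [e]; exact hc
  · rintro (h | ⟨h, h2⟩)
    · exact Or.inl h
    · refine Or.inr ⟨_, h2, ?_⟩
      rw [Function.update_idem, ← h, Function.update_eq_self]
theorem Pr_k (h : w ∈ Pr C a k u) : w k = a k := by
  rw [mem_Pr, mem_N] at h
  rcases h with h | h
  · exact h.2.2
  · exact h.1
theorem Pr_meet (h : w ∈ Pr C a k u) : ¬ D w a := by
  have hk := Pr_k h
  rw [mem_Pr, mem_N, mem_N] at h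
  rcases h with h | h
  · exact h.2.1
  · rintro ⟨j, hj⟩
    by_cases e : j = k
    · subst e; exact ne_co _ (hk.symm.trans hj)
    · exact h.2.2.1 ⟨j, by simpa [e] using hj⟩
theorem Pr_code (hC : Code C)
   (h2 : u ≠ co (a k)) : Code (Pr C a k u) := by
  intro v hv w hw hne
  have hvk := Pr_k hv
  have hwk := Pr_k hw
  rw [mem_Pr, mem_N, mem_N] at hv hw
  have aux : ∀ (j : ι) (v' w' : Wrd), j ≠ k → (∀ i, i ≠ k → v' i = v i) → (∀ i, i ≠ k → w' i = w i) →
    v' j = co (w' j) → D v w := fun j v' w' hj e1 e2 h => ⟨j, by rw [← e1 j hj, ← e2 j hj, h]⟩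
  have main : ∀ v' w' : Wrd, v' ∈ C → w' ∈ C → (∀ i, i ≠ k → v' i = v i) → (∀ i, i ≠ k → w' i = w i) →
     v' k ≠ co (w' k) → D v w := by
    intro v' w' h1 h2 e1 e2 hk
    have : v' ≠ w' := by
      intro e
      apply hne
      funext i
      by_cases hi : i = k
      · subst hi; rw [hvk, hwk]
      · rw [← e1 i hi, ← e2 i hi, e]
    obtain ⟨j, hj⟩ := hC _ h1 _ h2 this
    have hjk : j ≠ k := by rintro rfl; exact hk hj
    exact aux j v' w' hjk e1 e2 hj
  rcases hv with hv | hv <;> rcases hw with hw | hw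
  · exact main v w hv.1 hw.1 (fun _ _ => rfl) (fun _ _ => rfl) (by rw [hvk, hwk]; exact ne_co _)
  · exact main v _ hv.1 hw.2.1 (fun _ _ => rfl) (fun i hi => by simp [hi])
      (by simp [hvk]; intro e; exact h2 (by rw [e, co_co]))
  · exact main _ w hv.2.1 hw.1 (fun i hi => by simp [hi]) (fun _ _ => rfl)
      (by simp [hwk]; exact h2)
  · exact main _ _ hv.2.1 hw.2.1 (fun i hi => by simp [hi]) (fun i hi => by simp [hi])
      (by simp; exact ne_co _)
theorem Pr_card (hC : Code C)
   (h1 : u ≠ a k) (h2 : u ≠ co (a k)) : (Pr C a k u).card = (N C a k (a k)).card + (N C a k u).card := by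
  unfold Pr
  rw [Finset.card_union_of_disjoint, Finset.card_image_of_injOn]
  · intro c hc d hd h
    simp only [Finset.mem_coe, mem_N] at hc hd
    funext i
    by_cases hi : i = k
    · subst hi; rw [hc.2.2, hd.2.2]
    · have := congrFun h i; simpa [hi] using this
  · rw [Finset.disjoint_left]
    intro e he h
    rw [Finset.mem_image] at h
    obtain ⟨c, hc, rfl⟩ := h
    rw [mem_N] at hc he
    have hne : c ≠ upd c k (a k) := fun e => by
      have := congrFun e k; simp [hc.2.2] at this; exact h1 this
    obtain ⟨j, hj⟩ := hC _ hc.1 _ he.1 hne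
    by_cases e : j = k
    · subst e; simp [hc.2.2] at hj; exact h2 hj
    · simp [e] at hj; exact ne_co _ hj
theorem Pr_cov
   (ha : Cov C a) (h2 : u ≠ co (a k)) (h : ∀ c ∈ M C a, c k = a k ∨ c k = u ∨ c k = co u) :
    Cov (Pr C a k u) a := by
  intro x hx
  obtain ⟨p, hp1, hp2⟩ := inn_ex2 (a k) u (by rw [ne_eq, ← co_sw]; exact fun e => h2 e.symm)
  have hxa : In a (upd x k p) := In_updx.2 ⟨hp1, fun i _ => hx i⟩
  obtain ⟨c, hc, hcx⟩ := ha _ hxa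
  have hcm := notD_of_In hcx hxa
  rw [In_updx] at hcx
  rcases h c (mem_M.2 ⟨hc, hcm⟩) with e | e | e
  · refine ⟨c, mem_Pr.2 (Or.inl (mem_N.2 ⟨hc, hcm, e⟩)), fun j => ?_⟩
    by_cases hj : j = k
    · subst hj; rw [e]; exact hx j
    · exact hcx.2 j hj
  · refine ⟨upd c k (a k), ?_, In_upd.2 ⟨hx k, hcx.2⟩⟩
    unfold Pr
    rw [Finset.mem_union, Finset.mem_image]
    exact Or.inr ⟨c, mem_N.2 ⟨hc, hcm, e⟩, rfl⟩
  · have := hcx.1; rw [e, inn_co] at this; exact absurd hp2 this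
theorem notmem_of_meet (hC : Code C) (hm : ∀ c ∈ C, ¬ D c a)
    (h : 2 ≤ C.card) : a ∉ C := by
  intro ha
  have := mem_all_meet hC ha
  have h2 : M C a = C := by ext c; rw [mem_M]; exact ⟨fun h => h.1, fun h => ⟨h, hm c h⟩⟩
  rw [h2] at this; rw [this] at h; simp at h
theorem M_eq (hm : ∀ c ∈ C, ¬ D c a) : M C a = C := by
  ext c; rw [mem_M]; exact ⟨fun h => h.1, fun h => ⟨h, hm c h⟩⟩
theorem F2 (hC : Code C) (ha : Cov C a) (hm : ∀ c ∈ C, ¬ D c a)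
    (h : C.card = 2) : ∃ j x, x ≠ a j ∧ x ≠ co (a j) ∧ C = {upd a j x, upd a j (co x)} := by
  have hna := notmem_of_meet hC hm (by omega)
  obtain ⟨c, hc, j, h1, h2⟩ := ex_diff ha hna
  have hc' := (mem_M.1 hc)
  obtain ⟨d, hd⟩ := PAT1 hC ha h1 ⟨c, mem_N.2 ⟨hc'.1, hc'.2, rfl⟩⟩
  have hd' := mem_N.1 hd
  have hne : c ≠ d := by rintro rfl; exact ne_co _ hd'.2.2
  have hCe : C = {c, d} := by
    symm
    apply Finset.eq_of_subset_of_card_le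
    · intro e; simp; rintro (rfl | rfl); exacts [hc'.1, hd'.1]
    · rw [h, Finset.card_pair hne]
  have hN1 : N C a j (c j) = {c} := by
    ext e; rw [mem_N, Finset.mem_singleton]
    constructor
    · rintro ⟨he, _, h3⟩
      rw [hCe] at he; simp at he
      rcases he with rfl | rfl
      · rfl
      · exact absurd (h3.symm.trans hd'.2.2) (ne_co _)
    · rintro rfl; exact ⟨hc'.1, hc'.2, rfl⟩
  have hN2 : N C a j (co (c j)) = {d} := by
    ext e; rw [mem_N, Finset.mem_singleton]
    constructor
    · rintro ⟨he, _, h3⟩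
      rw [hCe] at he; simp at he
      rcases he with rfl | rfl
      · exact absurd h3 (ne_co _)
      · rfl
    · rintro rfl; exact hd'
  have key : ∀ i, i ≠ j → c i = a i ∧ d i = a i := by
    intro i hi
    by_contra hcon
    have : c i = d i ∧ c i ≠ a i := by
      by_cases h3 : c i = a i
      · have h4 : d i ≠ a i := fun e => hcon ⟨h3, e⟩
        have := PAT2a hC ha (u := co (c j)) (co_conj h1 h2).1 hN2 (d := c) (by rw [co_co, hN1]; simp) hi h4
        exact ⟨this, this ▸ h4⟩
      · exact ⟨(PAT2a hC ha h1 hN1 hd hi h3).symm, h3⟩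
    obtain ⟨e, he⟩ := PAT1 hC ha this.2 ⟨c, mem_N.2 ⟨hc'.1, hc'.2, rfl⟩⟩
    rw [mem_N, hCe] at he
    have h5 := he.1
    simp at h5
    rcases h5 with rfl | rfl
    · exact ne_co _ he.2.2
    · exact ne_co _ (this.1.trans he.2.2)
  refine ⟨j, c j, h1, h2, ?_⟩
  rw [hCe]
  congr 1
  · funext i; by_cases hi : i = j
    · subst hi; simp
    · simp [hi, key i hi]
  · congr 1
    funext i; by_cases hi : i = j
    · subst hi; simp [hd'.2.2]
    · simp [hi, key i hi]
theorem N_meet :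
   ∀ c ∈ N C a k u, ¬ D c (upd a k u) := by
  intro c hc; rw [mem_N] at hc; exact notD_updk hc.2.1 hc.2.2
theorem F3 (hC : Code C) (ha : Cov C a) (hm : ∀ c ∈ C, ¬ D c a)
    (h : C.card = 3) : ∃ j j2 x y, j ≠ j2 ∧ x ≠ a j ∧ x ≠ co (a j) ∧ y ≠ a j2 ∧ y ≠ co (a j2) ∧
    C = {upd a j x, upd (upd a j (co x)) j2 y, upd (upd a j (co x)) j2 (co y)} := by
  have hna := notmem_of_meet hC hm (by omega)
  obtain ⟨c, hc, j, h1, h2⟩ := ex_diff ha hna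
  have hc' := (mem_M.1 hc)
  set u := c j with hu
  obtain ⟨t, ht⟩ := third' (a j) u h1 h2
  have hcard := cardM C a j h1 h2 ht.1 ht.2.1 ht.2.2.1 ht.2.2.2
  rw [M_eq hm, h] at hcard
  have hu1 : (N C a j u).Nonempty := ⟨c, mem_N.2 ⟨hc'.1, hc'.2, rfl⟩⟩
  have hu2 : (N C a j (co u)).Nonempty := PAT1 hC ha h1 hu1
  have ht1 := PAT1 hC ha ht.1
  have ht2 := PAT1 hC ha (co_conj ht.1 ht.2.1).1
  rw [co_co] at ht2
  have p1 := hu1.card_pos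
  have p2 := hu2.card_pos
  rw [← Finset.card_pos, ← Finset.card_pos] at ht1 ht2
  have ht0 : (N C a j t).card = 0 ∧ (N C a j (co t)).card = 0 := by omega
  obtain ⟨q1, q2⟩ := ht0
  have hpat : ∀ d ∈ M C a, d j = a j ∨ d j = u ∨ d j = co u := by
    intro d hd
    have hdN : d ∈ N C a j (d j) := mem_N.2 ⟨(mem_M.1 hd).1, (mem_M.1 hd).2, rfl⟩
    rw [Finset.card_eq_zero] at q1 q2
    have hzz : N C a j (co (a j)) = ∅ := N_co
    have := letters (a j) u t (Ne.symm h1) (fun e => h2 (by rw [e, co_co])) ht.1 ht.2.1 ht.2.2.1 ht.2.2.2 (d j)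
    rcases this with h | h | h | h | h | h
    · exact Or.inl h
    · rw [h, hzz] at hdN; simp at hdN
    · exact Or.inr (Or.inl h)
    · exact Or.inr (Or.inr h)
    · rw [h, q1] at hdN; simp at hdN
    · rw [h, q2] at hdN; simp at hdN
  have hh : ((N C a j (a j)).card = 1 ∧ (N C a j u).card = 1 ∧ (N C a j (co u)).card = 1) ∨
     ((N C a j (a j)).card = 0 ∧ ((N C a j u).card = 1 ∧ (N C a j (co u)).card = 2 ∨
       (N C a j u).card = 2 ∧ (N C a j (co u)).card = 1)) := by omega
  rcases hh with ⟨k1, k2, k3⟩ | ⟨k1, k2⟩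
  · obtain ⟨e, he⟩ := Finset.card_eq_one.1 k1
    have aux : ∀ v, v ≠ a j → v ≠ co (a j) → (∀ c ∈ M C a, c j = a j ∨ c j = v ∨ c j = co v) → (N C a j v).card = 1 →
        ∃ m x, m ≠ j ∧ x ≠ a m ∧ x ≠ co (a m) ∧ e = upd a m x ∧ upd (upd a m (co x)) j v ∈ C := by
      intro v g1 g2 g3 g4
      have hcd : (Pr C a j v).card = 2 := by rw [Pr_card hC g1 g2, k1, g4]
      obtain ⟨m, x, hx1, hx2, hP⟩ := F2 (Pr_code hC g2) (Pr_cov ha g2 g3) (fun _ => Pr_meet) hcd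
      have hmj : m ≠ j := by
        rintro rfl
        have := Pr_k (C := C) (a := a) (k := m) (u := v) (w := upd a m x) (by rw [hP]; simp)
        simp at this; exact hx1 this
      have heP : e ∈ Pr C a j v := mem_Pr.2 (Or.inl (by rw [he]; simp))
      have oth : ∀ w ∈ Pr C a j v, w ≠ e → upd w j v ∈ C := by
        intro w hw hne
        rcases mem_Pr.1 hw with h | h
        · rw [he] at h; simp at h; exact absurd h hne
        · exact (mem_N.1 h.2).1
      have hxx : upd a m x ≠ upd a m (co x) := fun e => by
        have := congrFun e m; simp at this; exact ne_co _ this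
      rw [hP] at heP; simp at heP
      rcases heP with heP | heP
      · refine ⟨m, x, hmj, hx1, hx2, heP, oth _ (by rw [hP]; simp) (by rw [heP]; exact hxx.symm)⟩
      · refine ⟨m, co x, hmj, (co_conj hx1 hx2).1, (co_conj hx1 hx2).2, heP, ?_⟩
        rw [co_co]; exact oth _ (by rw [hP]; simp) (by rw [heP]; exact hxx)
    obtain ⟨m, x, b1, b2, b3, b4, b5⟩ := aux u h1 h2 hpat k2
    obtain ⟨m', x', b1', b2', b3', b4', b5'⟩ := aux (co u) (co_conj h1 h2).1 (co_conj h1 h2).2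
      (by intro c hc; rw [co_co]; have := hpat c hc; tauto) k3
    have hmm : m' = m := by
      by_contra hne
      have := congrFun (b4.symm.trans b4') m'
      simp [hne] at this; exact b2' this.symm
    subst hmm
    have hxx : x = x' := by have := congrFun (b4.symm.trans b4') m'; simpa using this
    subst hxx
    refine ⟨m', j, x, u, b1, b2, b3, h1, h2, ?_⟩
    symm
    apply Finset.eq_of_subset_of_card_le
    · have heC : e ∈ C := by
        have : e ∈ N C a j (a j) := by simp [he]
        exact (mem_N.1 this).1
      intro w; simp only [Finset.mem_insert, Finset.mem_singleton]
      rintro (rfl | rfl | rfl)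
      · rw [← b4]; exact heC
      · exact b5
      · exact b5'
    · rw [h]
      apply le_of_eq
      symm
      rw [Finset.card_eq_three]
      refine ⟨_, _, _, ?_, ?_, ?_, rfl⟩
      · intro e; have := congrFun e m'; simp [b1] at this; exact ne_co _ this
      · intro e; have := congrFun e m'; simp [b1] at this; exact ne_co _ this
      · intro e; have := congrFun e j; simp at this; exact ne_co _ this
  · have hpat2 : ∀ d ∈ M C a, d j = u ∨ d j = co u := by
      intro d hd
      rcases hpat d hd with e | e
      · have : d ∈ N C a j (a j) := mem_N.2 ⟨(mem_M.1 hd).1, (mem_M.1 hd).2, e⟩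
        rw [Finset.card_eq_zero] at k1; rw [k1] at this; simp at this
      · exact e
    have aux : ∀ v, v ≠ a j → v ≠ co (a j) → (∀ c ∈ M C a, c j = v ∨ c j = co v) → (N C a j v).card = 1 →
       (N C a j (co v)).card = 2 → ∃ j j2 x y, j ≠ j2 ∧ x ≠ a j ∧ x ≠ co (a j) ∧ y ≠ a j2 ∧ y ≠ co (a j2) ∧
    C = {upd a j x, upd (upd a j (co x)) j2 y, upd (upd a j (co x)) j2 (co y)} := by
      intro v g1 g2 g3 g4 g5
      have c1 := PAT3 ha g2 g3
      have c2 := PAT3 (u := co v) ha (co_conj g1 g2).2 (by intro c hc; rw [co_co]; have := g3 c hc; tauto)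
      obtain ⟨f, hf⟩ := Finset.card_eq_one.1 g4
      rw [hf] at c1
      have hfe := Cov_single c1
      obtain ⟨m, y, hy1, hy2, hP⟩ := F2 (hC.mono N_sub) c2 N_meet g5
      have hmj : m ≠ j := by
        rintro rfl
        have : upd (upd a m (co v)) m y ∈ N C a m (co v) := by rw [hP]; simp
        have := (mem_N.1 this).2.2
        simp at this hy1; exact hy1 this
      simp [hmj] at hy1 hy2
      refine ⟨j, m, v, y, hmj.symm, g1, g2, hy1, hy2, ?_⟩
      rw [← hP, hfe, ← Finset.singleton_union, ← hf]
      ext w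
      rw [Finset.mem_union, mem_N, mem_N]
      constructor
      · intro hw
        rcases g3 w (mem_M.2 ⟨hw, hm w hw⟩) with e | e
        · exact Or.inl ⟨hw, hm w hw, e⟩
        · exact Or.inr ⟨hw, hm w hw, e⟩
      · rintro (h | h) <;> exact h.1
    rcases k2 with ⟨k2, k3⟩ | ⟨k2, k3⟩
    · exact aux u h1 h2 hpat2 k2 k3
    · exact aux (co u) (co_conj h1 h2).1 (co_conj h1 h2).2
        (by intro c hc; rw [co_co]; have := hpat2 c hc; tauto) k3 (by rw [co_co]; exact k2)
def T (a : Wrd) (k j m : ι) (s t r : Fin 6) : Wrd := upd (upd (upd a k s) j t) m r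
theorem T_m : T a k j m s t r m = r := by simp [T]
theorem T_j (h : j ≠ m) : T a k j m s t r j = t := by simp [T, h]
theorem T_k (h : k ≠ j) (h2 : k ≠ m) : T a k j m s t r k = s := by simp [T, h, h2]
theorem T_o (h : i ≠ k) (h1 : i ≠ j) (h2 : i ≠ m) : T a k j m s t r i = a i := by simp [T, h, h1, h2]
theorem PAT3L (hC : Code C)
    (ha : Cov C a) (h2 : u ≠ co (a k)) (h : ∀ c ∈ M C a, c k = u ∨ c k = co u)
    (hT : TF (N C a k u)) (h5 : (N C a k u).card < 5) : ∀ c ∈ N C a k u, c = upd a k u := by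
  have hcov := PAT3 ha h2 h
  have hmem : upd a k u ∈ N C a k u := by
    by_contra hn
    have := L1C (hC.mono N_sub) hT hcov hn
    omega
  have := mem_all_meet (hC.mono N_sub) hmem
  rw [M_eq N_meet] at this
  intro c hc
  rw [this] at hc
  simpa using hc
theorem pat_of
   (h1 : u ≠ a j) (h2 : u ≠ co (a j)) (ht : t ≠ a j ∧ t ≠ co (a j) ∧ t ≠ u ∧ t ≠ co u)
   (q1 : (N C a j t).card = 0) (q2 : (N C a j (co t)).card = 0) :
   ∀ d ∈ M C a, d j = a j ∨ d j = u ∨ d j = co u := by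
  intro d hd
  have hdN : d ∈ N C a j (d j) := mem_N.2 ⟨(mem_M.1 hd).1, (mem_M.1 hd).2, rfl⟩
  rw [Finset.card_eq_zero] at q1 q2
  have hzz : N C a j (co (a j)) = ∅ := N_co
  have := letters (a j) u t (Ne.symm h1) (fun e => h2 (by rw [e, co_co])) ht.1 ht.2.1 ht.2.2.1 ht.2.2.2 (d j)
  rcases this with h | h | h | h | h | h
  · exact Or.inl h
  · rw [h, hzz] at hdN; simp at hdN
  · exact Or.inr (Or.inl h)
  · exact Or.inr (Or.inr h)
  · rw [h, q1] at hdN; simp at hdN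
  · rw [h, q2] at hdN; simp at hdN
theorem three_a {Q : Finset Wrd} {x y : Fin 6} (hC : Code Q) (ha : Cov Q a)
    (hm : ∀ c ∈ Q, ¬ D c a) (hcard : Q.card = 4) (hjm : j ≠ m) (x1 : x ≠ a j) (x2 : x ≠ co (a j))
    (y1 : y ≠ a m) (y2 : y ≠ co (a m)) (he : e ∈ Q) (hej : e j = co x) (hem : e m = co y)
    (heo : ∀ i, i ≠ j → i ≠ m → e i = a i) (hT : TF (Q.erase e)) (hN : N Q a j (co x) = {e}) : False := by
  have hD : ∀ f ∈ Q, f ≠ e → f j = x ∨ f m = y := by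
    intro f hf hne
    obtain ⟨i, hi⟩ := hC f hf e he hne
    by_cases h1 : i = j
    · subst h1; left; rw [hi, hej, co_co]
    · by_cases h2 : i = m
      · subst h2; right; rw [hi, hem, co_co]
      · rw [heo i h1 h2] at hi; exact absurd ⟨i, hi⟩ (hm f hf)
  have hNx : N Q a j x ⊆ Q.erase e := by
    intro f hf; rw [mem_N] at hf; rw [Finset.mem_erase]
    exact ⟨by rintro rfl; exact ne_co x (hf.2.2.symm.trans hej), hf.1⟩
  have hQe : (Q.erase e).card = 3 := by rw [Finset.card_erase_of_mem he, hcard]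
  have hcx1 := (co_conj x1 x2).1
  have cov := PAT2b hC ha hcx1 hN
  rw [co_co] at cov
  have hmem : upd e j x ∈ N Q a j x := by
    by_contra hn
    have := L1C (hC.mono N_sub) (hT.mono hNx) cov hn
    have := Finset.card_le_card hNx
    omega
  have hmeet : ∀ d ∈ N Q a j x, ¬ D d (upd e j x) := by
    intro d hd
    rintro ⟨i, hi⟩
    by_cases h1 : i = j
    · subst h1; rw [(mem_N.1 hd).2.2] at hi; simp at hi; exact ne_co _ hi
    · simp [h1] at hi
      by_cases h2 : i = m
      · subst h2
        have := PAT2a hC ha hcx1 hN (d := d) (by rw [co_co]; exact hd) h1 (by rw [hem]; exact (co_conj y1 y2).1)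
        rw [this] at hi; exact ne_co _ hi
      · rw [heo i h1 h2] at hi; exact (mem_N.1 hd).2.1 ⟨i, hi⟩
  have hsing := mem_all_meet (hC.mono N_sub) hmem
  rw [M_eq hmeet] at hsing
  -- remaining two
  set o := upd e j x with ho
  have hoQ : o ∈ Q.erase e := hNx hmem
  have h2 : ((Q.erase e).erase o).card = 2 := by rw [Finset.card_erase_of_mem hoQ, hQe]
  obtain ⟨f, g, hfg, hset⟩ := Finset.card_eq_two.1 h2
  have rest : ∀ f ∈ (Q.erase e).erase o, f m = y := by
    intro f hf
    rw [Finset.mem_erase, Finset.mem_erase] at hf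
    rcases hD f hf.2.2 hf.2.1 with h | h
    · have : f ∈ N Q a j x := mem_N.2 ⟨hf.2.2, hm f hf.2.2, h⟩
      rw [hsing] at this; simp at this; exact absurd this hf.1
    · exact h
  have hpat : ∀ c ∈ M Q a, c m = y ∨ c m = co y := by
    intro c hc
    have hcQ := (mem_M.1 hc).1
    by_cases h1 : c = e
    · right; rw [h1, hem]
    · by_cases h3 : c = o
      · right; rw [h3, ho]; simp [hjm.symm, hem]
      · left; exact rest c (by simp [h1, h3, hcQ])
  have hNy : N Q a m y ⊆ Q.erase e := by
    intro f hf; rw [mem_N] at hf; rw [Finset.mem_erase]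
    exact ⟨by rintro rfl; exact ne_co y (hf.2.2.symm.trans hem), hf.1⟩
  have L := PAT3L hC ha y2 hpat (hT.mono hNy) (by have := Finset.card_le_card hNy; omega)
  have inN : ∀ f ∈ (Q.erase e).erase o, f ∈ N Q a m y := by
    intro f hf
    have := rest f hf
    rw [Finset.mem_erase, Finset.mem_erase] at hf
    exact mem_N.2 ⟨hf.2.2, hm f hf.2.2, this⟩
  apply hfg
  rw [L f (inN f (by rw [hset]; simp)), L g (inN g (by rw [hset]; simp))]
theorem three_b {Q : Finset Wrd} {a e f1 f2 f3 : Wrd} {x : Fin 6} (hC : Code Q) (ha : Cov Q a)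
    (hm : ∀ c ∈ Q, ¬ D c a) (hQ : ∀ c ∈ Q, c = e ∨ c = f1 ∨ c = f2 ∨ c = f3) (hcard : Q.card = 4)
    (x1 : x ≠ a j) (x2 : x ≠ co (a j)) (hT : TF (Q.erase e)) (he : e ∈ Q)
    (h0 : e j = co x) (h1 : f1 j = x) (h2 : f2 j = co x) (h3 : f3 j = x) (q1 : f1 ∈ Q) (q3 : f3 ∈ Q)
    (h : f1 ≠ f3) : False := by
  have hNy : N Q a j x ⊆ Q.erase e := by
    intro f hf; rw [mem_N] at hf; rw [Finset.mem_erase]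
    exact ⟨by rintro rfl; exact ne_co x (hf.2.2.symm.trans h0), hf.1⟩
  have L := PAT3L hC ha x2 (by
    intro c hc
    rcases hQ c (mem_M.1 hc).1 with rfl | rfl | rfl | rfl <;> tauto) (hT.mono hNy) (by
      have := Finset.card_le_card hNy; rw [Finset.card_erase_of_mem he] at this; omega)
  apply h
  rw [L f1 (mem_N.2 ⟨q1, hm _ q1, h1⟩), L f3 (mem_N.2 ⟨q3, hm _ q3, h3⟩)]
theorem three_imp {Q : Finset Wrd} {x y : Fin 6} (hC : Code Q) (ha : Cov Q a)
    (hm : ∀ c ∈ Q, ¬ D c a) (hcard : Q.card = 4) (hjm : j ≠ m) (x1 : x ≠ a j) (x2 : x ≠ co (a j))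
    (y1 : y ≠ a m) (y2 : y ≠ co (a m)) (he : e ∈ Q) (hej : e j = co x) (hem : e m = co y)
    (heo : ∀ i, i ≠ j → i ≠ m → e i = a i) (hT : TF (Q.erase e)) : False := by
  have hD : ∀ f ∈ Q, f ≠ e → f j = x ∨ f m = y := by
    intro f hf hne
    obtain ⟨i, hi⟩ := hC f hf e he hne
    by_cases h1 : i = j
    · subst h1; left; rw [hi, hej, co_co]
    · by_cases h2 : i = m
      · subst h2; right; rw [hi, hem, co_co]
      · rw [heo i h1 h2] at hi; exact absurd ⟨i, hi⟩ (hm f hf)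
  have A1 := three_a hC ha hm hcard hjm x1 x2 y1 y2 he hej hem heo hT
  have A2 := three_a hC ha hm hcard hjm.symm y1 y2 x1 x2 he hem hej (fun i h1 h2 => heo i h2 h1) hT
  have ex : ∀ (j : ι) (x : Fin 6), e j = co x → (N Q a j (co x) = {e} → False) → ∃ f ∈ Q, f ≠ e ∧ f j = co x := by
    intro j x h1 h2
    by_contra hcon
    push Not at hcon
    apply h2
    ext f; rw [mem_N, Finset.mem_singleton]
    constructor
    · rintro ⟨q1, _, q2⟩; by_contra hne; exact hcon f q1 hne q2
    · rintro rfl; exact ⟨he, hm _ he, h1⟩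
  obtain ⟨f2, hf2, hf2e, hf2j⟩ := ex j x hej A1
  obtain ⟨f3, hf3, hf3e, hf3m⟩ := ex m y hem A2
  have hf2m : f2 m = y := by
    rcases hD f2 hf2 hf2e with h | h
    · rw [hf2j] at h; exact absurd h (co_ne x)
    · exact h
  have hf3j : f3 j = x := by
    rcases hD f3 hf3 hf3e with h | h
    · exact h
    · rw [hf3m] at h; exact absurd h (co_ne y)
  have h23 : f3 ≠ f2 := by rintro rfl; exact ne_co x (hf3j.symm.trans hf2j)
  have h3 : (((Q.erase e).erase f2).erase f3).card = 1 := by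
    rw [Finset.card_erase_of_mem, Finset.card_erase_of_mem, Finset.card_erase_of_mem he, hcard] <;>
      simp [*]
  obtain ⟨f1, hf1⟩ := Finset.card_eq_one.1 h3
  have hh : f1 ∈ ((Q.erase e).erase f2).erase f3 := by rw [hf1]; simp
  simp only [Finset.mem_erase] at hh
  have hQ : ∀ c ∈ Q, c = e ∨ c = f1 ∨ c = f2 ∨ c = f3 := by
    intro c hc
    by_contra hcon
    push Not at hcon
    have : c ∈ ((Q.erase e).erase f2).erase f3 := by simp [hcon, hc]
    rw [hf1] at this; simp at this; exact hcon.2.1 this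
  rcases hD f1 hh.2.2.2 hh.2.2.1 with h | h
  · exact three_b (f1 := f1) (f2 := f2) (f3 := f3) hC ha hm hQ hcard x1 x2 hT he hej h hf2j hf3j hh.2.2.2 hf3 hh.1
  · exact three_b (f1 := f1) (f2 := f3) (f3 := f2) hC ha hm (fun c hc => by have := hQ c hc; tauto)
      hcard y1 y2 hT he hem h hf3m hf2m hh.2.2.2 hf2 hh.2.1
theorem LLhalf (hC : Code C) (hT : TF C)
   (ha : Cov C a) (h1 : u ≠ a k) (h2 : u ≠ co (a k))
   (hpat : ∀ c ∈ M C a, c k = a k ∨ c k = u ∨ c k = co u) (he : N C a k (a k) = {e}) (hu : (N C a k u).card = 2) :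
   ∃ j m x y, k ≠ j ∧ k ≠ m ∧ j ≠ m ∧ x ≠ a j ∧ x ≠ co (a j) ∧ y ≠ a m ∧ y ≠ co (a m) ∧
     e = T a k j m (a k) (co x) (co y) ∧ N C a k u = {T a k j m u x (a m), T a k j m u (co x) y} := by
  have hcd : (Pr C a k u).card = 3 := by rw [Pr_card hC h1 h2, hu, he]; simp
  obtain ⟨j, m, x, y, hjm, hx1, hx2, hy1, hy2, hP⟩ := F3 (Pr_code hC h2) (Pr_cov ha h2 hpat) (fun _ => Pr_meet) hcd
  have hkj : k ≠ j := by
    rintro rfl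
    have := Pr_k (C := C) (a := a) (k := k) (u := u) (w := upd a k x) (by rw [hP]; simp)
    simp at this; exact hx1 this
  have hkm : k ≠ m := by
    rintro rfl
    have := Pr_k (C := C) (a := a) (k := k) (u := u) (w := upd (upd a j (co x)) k y) (by rw [hP]; simp)
    simp at this; exact hy1 this
  have heP : e ∈ Pr C a k u := mem_Pr.2 (Or.inl (by rw [he]; simp))
  have oth : ∀ w ∈ Pr C a k u, w ≠ e → upd w k u ∈ N C a k u := by
    intro w hw hne
    rcases mem_Pr.1 hw with h | h
    · rw [he] at h; simp at h; exact absurd h hne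
    · exact h.2
  have d12 : ∀ y, upd a j x ≠ upd (upd a j (co x)) m y := fun y e => by
    have := congrFun e j; simp [hjm] at this; exact ne_co _ this
  have d23 : upd (upd a j (co x)) m y ≠ upd (upd a j (co x)) m (co y) := fun e => by
    have := congrFun e m; simp at this; exact ne_co _ this
  have fin : ∀ y, y ≠ a m → y ≠ co (a m) → e = upd (upd a j (co x)) m (co y) →
      upd (upd a j x) k u ∈ N C a k u → upd (upd (upd a j (co x)) m y) k u ∈ N C a k u →
   ∃ j m x y, k ≠ j ∧ k ≠ m ∧ j ≠ m ∧ x ≠ a j ∧ x ≠ co (a j) ∧ y ≠ a m ∧ y ≠ co (a m) ∧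
     e = T a k j m (a k) (co x) (co y) ∧ N C a k u = {T a k j m u x (a m), T a k j m u (co x) y} := by
    intro y g1 g2 g3 g4 g5
    refine ⟨j, m, x, y, hkj, hkm, hjm, hx1, hx2, g1, g2, ?_, ?_⟩
    · rw [g3, T, Function.update_eq_self]
    · have e1 : T a k j m u x (a m) = upd (upd a j x) k u := by
        funext i; simp only [T, Function.update_apply]; grind
      have e2 : T a k j m u (co x) y = upd (upd (upd a j (co x)) m y) k u := by
        funext i; simp only [T, Function.update_apply]; grind
      rw [e1, e2]
      symm
      apply Finset.eq_of_subset_of_card_le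
      · intro w; simp only [Finset.mem_insert, Finset.mem_singleton]; rintro (rfl | rfl)
        exacts [g4, g5]
      · rw [hu, Finset.card_pair]
        intro e; have := congrFun e j; simp [hkj.symm, hjm] at this; exact ne_co _ this
  have heP' := heP
  rw [hP] at heP'
  simp only [Finset.mem_insert, Finset.mem_singleton] at heP'
  rcases heP' with h | h | h
  · exfalso
    have t1 := oth (upd (upd a j (co x)) m y) (by rw [hP]; simp) (by rw [h]; exact (d12 _).symm)
    have t2 := oth (upd (upd a j (co x)) m (co y)) (by rw [hP]; simp) (by rw [h]; exact (d12 _).symm)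
    exact hT _ (mem_N.1 t1).1 _ (mem_N.1 t2).1 ⟨m, by simp [hkm.symm], fun i hi => by
      simp only [Function.update_apply, hi, if_false]⟩
  · refine fin (co y) (co_conj hy1 hy2).1 (co_conj hy1 hy2).2 (by rw [co_co]; exact h) ?_ ?_
    · exact oth _ (by rw [hP]; simp) (by rw [h]; exact d12 _)
    · exact oth _ (by rw [hP]; simp) (by rw [h]; exact d23.symm)
  · refine fin y hy1 hy2 h ?_ ?_
    · exact oth _ (by rw [hP]; simp) (by rw [h]; exact d12 _)
    · exact oth _ (by rw [hP]; simp) (by rw [h]; exact d23)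
/-- the explicit 5-cover -/
structure S5F (C : Finset Wrd) (a : Wrd) (k j m : ι) (u x y : Fin 6) : Prop where
  kj : k ≠ j
  km : k ≠ m
  jm : j ≠ m
  u1 : u ≠ a k
  u2 : u ≠ co (a k)
  x1 : x ≠ a j
  x2 : x ≠ co (a j)
  y1 : y ≠ a m
  y2 : y ≠ co (a m)
  n0 : N C a k (a k) = {T a k j m (a k) (co x) (co y)}
  n1 : N C a k u = {T a k j m u x (a m), T a k j m u (co x) y}
  n2 : N C a k (co u) = {T a k j m (co u) (a j) y, T a k j m (co u) x (co y)}
  pat : ∀ c ∈ M C a, c k = a k ∨ c k = u ∨ c k = co u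
theorem LLm (hC : Code C) (hT : TF C)
   (ha : Cov C a) (h1 : u ≠ a k) (h2 : u ≠ co (a k))
   (hpat : ∀ c ∈ M C a, c k = a k ∨ c k = u ∨ c k = co u) (he : N C a k (a k) = {e}) (hu : (N C a k u).card = 2)
   (hu' : (N C a k (co u)).card = 2 ∨ (N C a k (co u)).card = 3) :
   ∃ j m x y, S5F C a k j m u x y := by
  obtain ⟨j, m, x, y, kj, km, jm, x1, x2, y1, y2, hee, hN⟩ := LLhalf hC hT ha h1 h2 hpat he hu
  have hc1 := co_conj h1 h2
  have hpat' : ∀ c ∈ M C a, c k = a k ∨ c k = co u ∨ c k = co (co u) := by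
    intro c hc; rw [co_co]; have := hpat c hc; tauto
  rcases hu' with hu' | hu'
  · obtain ⟨j', m', x', y', kj', km', jm', x1', x2', y1', y2', hee', hN'⟩ := LLhalf hC hT ha hc1.1 hc1.2 hpat' he hu'
    have E := hee.symm.trans hee'
    have c1 : j = j' ∨ j = m' := by
      by_contra hcon; push Not at hcon
      have := congrFun E j
      rw [T_j jm, T_o kj.symm hcon.1 hcon.2] at this
      exact (co_conj x1 x2).1 this
    have c2 : m = j' ∨ m = m' := by
      by_contra hcon; push Not at hcon
      have := congrFun E m
      rw [T_m, T_o km.symm hcon.1 hcon.2] at this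
      exact (co_conj y1 y2).1 this
    have cc : (j' = j ∧ m' = m) ∨ (j' = m ∧ m' = j) := by grind
    rcases cc with ⟨rfl, rfl⟩ | ⟨rfl, rfl⟩
    · exfalso
      have hx : x = x' := by have := congrFun E j'; rw [T_j jm, T_j jm] at this; exact co_inj _ _ this
      subst hx
      have m1 : T a k j' m' u x (a m') ∈ N C a k u := by rw [hN]; simp
      have m2 : T a k j' m' (co u) x (a m') ∈ N C a k (co u) := by rw [hN']; simp
      refine hT _ (mem_N.1 m1).1 _ (mem_N.1 m2).1 ⟨k, by rw [T_k kj km, T_k kj km], fun i hi => ?_⟩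
      simp [T, Function.update_apply, hi]
    · have hx : x = y' := by have := congrFun E m'; rw [T_j jm, T_m] at this; exact co_inj _ _ this
      have hy : y = x' := by have := congrFun E j'; rw [T_m, T_j jm.symm] at this; exact co_inj _ _ this
      subst hx; subst hy
      refine ⟨m', j', x, y, kj, km, jm, h1, h2, x1, x2, y1, y2, by rw [he, hee], hN, ?_, hpat⟩
      rw [hN']
      congr 1
      · funext i; simp only [T, Function.update_apply]; grind
      · congr 1; funext i; simp only [T, Function.update_apply]; grind
  · exfalso
    have hcd : (Pr C a k (co u)).card = 4 := by rw [Pr_card hC hc1.1 hc1.2, hu', he]; simp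
    have heP : e ∈ Pr C a k (co u) := mem_Pr.2 (Or.inl (by rw [he]; simp))
    refine three_imp (Pr_code hC hc1.2) (Pr_cov ha hc1.2 hpat') (fun _ => Pr_meet) hcd jm x1 x2 y1 y2 heP
      (by rw [hee, T_j jm]) (by rw [hee, T_m]) (fun i hi hi2 => ?_) ?_
    · rw [hee]; by_cases hk : i = k
      · subst hk; rw [T_k kj km]
      · exact T_o hk hi hi2
    · have oth : ∀ w ∈ (Pr C a k (co u)).erase e, w k = a k ∧ upd w k (co u) ∈ N C a k (co u) := by
        intro w hw
        rw [Finset.mem_erase] at hw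
        rcases mem_Pr.1 hw.2 with h | h
        · rw [he] at h; simp at h; exact absurd h hw.1
        · exact h
      intro v hv w hw ⟨i, hi, hi2⟩
      have hik : i ≠ k := by
        rintro rfl; rw [(oth v hv).1, (oth w hw).1] at hi; exact ne_co _ hi
      refine hT _ (mem_N.1 (oth v hv).2).1 _ (mem_N.1 (oth w hw).2).1 ⟨i, by simpa [hik] using hi, fun i' hi' => ?_⟩
      by_cases h : i' = k
      · simp [h]
      · simpa [h] using hi2 i' hi'
theorem S5pat (hC : Code C) (hT : TF C)
   (ha : Cov C a) (h1 : u ≠ a k) (h2 : u ≠ co (a k)) (hne : (N C a k u).Nonempty) (h5 : (M C a).card = 5) :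
   (N C a k (a k)).card = 1 ∧ (N C a k u).card = 2 ∧ (N C a k (co u)).card = 2 ∧
   (∀ c ∈ M C a, c k = a k ∨ c k = u ∨ c k = co u) := by
  obtain ⟨t, ht⟩ := third' (a k) u h1 h2
  have hcard := cardM C a k h1 h2 ht.1 ht.2.1 ht.2.2.1 ht.2.2.2
  have l1 := LR hC hT ha h1 h2
  have l2 := LR hC hT ha ht.1 ht.2.1
  have := hne.card_pos
  have q1 : (N C a k t).card = 0 := by omega
  have q2 : (N C a k (co t)).card = 0 := by omega
  have hp := pat_of h1 h2 ht q1 q2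
  have l3 : (N C a k (a k)).card ≠ 0 := by
    intro h0
    have hp2 : ∀ c ∈ M C a, c k = u ∨ c k = co u := by
      intro d hd
      rcases hp d hd with e | e
      · have : d ∈ N C a k (a k) := mem_N.2 ⟨(mem_M.1 hd).1, (mem_M.1 hd).2, e⟩
        rw [Finset.card_eq_zero] at h0; rw [h0] at this; simp at this
      · exact e
    have L := PAT3L hC ha h2 hp2 (hT.mono N_sub) (by omega)
    have : (N C a k u).card ≤ 1 := Finset.card_le_one.2 (fun c hc d hd => by rw [L c hc, L d hd])
    omega
  exact ⟨by omega, by omega, by omega, hp⟩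
theorem S5 (hC : Code C) (hT : TF C)
   (ha : Cov C a) (h1 : u ≠ a k) (h2 : u ≠ co (a k)) (hne : (N C a k u).Nonempty) (h5 : (M C a).card = 5) :
   ∃ j m x y, S5F C a k j m u x y := by
  obtain ⟨g1, g2, g3, g4⟩ := S5pat hC hT ha h1 h2 hne h5
  obtain ⟨e, he⟩ := Finset.card_eq_one.1 g1
  exact LLm hC hT ha h1 h2 g4 he g2 (Or.inl g3)
/-- letter weight -/
def gw (s t : Fin 6) : ℕ := (Finset.univ.filter (fun p : Fin 8 => inn s p ∧ inn t p)).card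
theorem gw_le : ∀ s t, gw s t ≤ 4 := by decide
theorem gw_ne : ∀ s t, s ≠ t → gw s t ≤ 2 := by decide
theorem gw_eq : ∀ s, (Finset.univ.filter (fun p : Fin 8 => inn s p)).card = 4 := by decide
theorem card_In (a : Wrd) : (Finset.univ.filter (fun x : ι → Fin 8 => In a x)).card = 4 ^ Fintype.card ι := by
  have : (Finset.univ.filter (fun x : ι → Fin 8 => In a x)) =
     Fintype.piFinset (fun j => Finset.univ.filter (fun p : Fin 8 => inn (a j) p)) := by
    ext x; simp only [Finset.mem_filter, Finset.mem_univ, true_and, Fintype.mem_piFinset]; rfl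
  rw [this, Fintype.card_piFinset]
  simp [gw_eq]
theorem card_In2 (a c : Wrd) : (Finset.univ.filter (fun x : ι → Fin 8 => In c x ∧ In a x)).card =
    ∏ j, gw (c j) (a j) := by
  have : (Finset.univ.filter (fun x : ι → Fin 8 => In c x ∧ In a x)) =
     Fintype.piFinset (fun j => Finset.univ.filter (fun p : Fin 8 => inn (c j) p ∧ inn (a j) p)) := by
    ext x; simp only [Finset.mem_filter, Finset.mem_univ, true_and, Fintype.mem_piFinset]
    exact ⟨fun h j => ⟨h.1 j, h.2 j⟩, fun h => ⟨fun j => (h j).1, fun j => (h j).2⟩⟩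
  rw [this, Fintype.card_piFinset]
  rfl
theorem weight_le (h : 3 ≤ (Finset.univ.filter (fun j => c j ≠ a j)).card) :
   8 * ∏ j, gw (c j) (a j) ≤ 4 ^ Fintype.card ι := by
  set S := Finset.univ.filter (fun j => c j ≠ a j) with hS
  have h1 : ∏ j, (2 * gw (c j) (a j) ^ 1) = 2 ^ Fintype.card ι * ∏ j, gw (c j) (a j) := by
    rw [Finset.prod_mul_distrib]; simp
  have h2 : ∏ j, gw (c j) (a j) ≤ ∏ j, (if j ∈ S then 2 else 4) := by
    apply Finset.prod_le_prod'
    intro j _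
    split_ifs with hj
    · exact gw_ne _ _ (by simpa [hS] using hj)
    · exact gw_le _ _
  have h3 : (∏ j : ι, (if j ∈ S then 2 else 4)) * 2 ^ S.card = 4 ^ Fintype.card ι := by
    have : ∏ j : ι, (if j ∈ S then 2 else 1) = 2 ^ S.card := by
      rw [Finset.prod_ite_mem]; simp
    rw [← this, ← Finset.prod_mul_distrib]
    rw [Finset.prod_congr rfl (g := fun _ => 4) (by intro j _; split_ifs <;> rfl)]
    simp
  have h4 : 2 ^ 3 ≤ 2 ^ S.card := Nat.pow_le_pow_right (by norm_num) h
  calc 8 * ∏ j, gw (c j) (a j) ≤ 2 ^ S.card * ∏ j : ι, (if j ∈ S then 2 else 4) := Nat.mul_le_mul (by simpa using h4) h2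
    _ = _ := by rw [mul_comm, h3]
theorem KR (ha : Cov C a) :
    4 ^ Fintype.card ι ≤ ∑ c ∈ M C a, ∏ j, gw (c j) (a j) := by
  rw [← card_In a]
  have : (Finset.univ.filter (fun x : ι → Fin 8 => In a x)) ⊆
     (M C a).biUnion (fun c => Finset.univ.filter (fun x : ι → Fin 8 => In c x ∧ In a x)) := by
    intro x hx
    simp at hx
    obtain ⟨c, hc, hcx⟩ := Cov_M ha x hx
    simp; exact ⟨c, hc, hcx, hx⟩
  refine (Finset.card_le_card this).trans (Finset.card_biUnion_le.trans (le_of_eq ?_))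
  exact Finset.sum_congr rfl fun c _ => card_In2 a c
set_option maxHeartbeats 2000000 in
theorem S6 (hC : Code C) (hT : TF C)
   (ha : Cov C a) (h6 : (M C a).card = 6) : ∃ k u, u ≠ a k ∧ u ≠ co (a k) ∧ N C a k u = {upd a k u} ∧
    (N C a k (co u)).card = 5 ∧ Cov (N C a k (co u)) (upd a k (co u)) ∧ (∀ c ∈ M C a, c k = u ∨ c k = co u) := by
  by_contra hcon
  have pat : ∀ k u, u ≠ a k → (N C a k u).card ≤ 2 := by
    intro k u h1
    by_contra hgt
    have h2 : u ≠ co (a k) := by rintro rfl; rw [N_co] at hgt; simp at hgt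
    obtain ⟨t, ht⟩ := third' (a k) u h1 h2
    have hcard := cardM C a k h1 h2 ht.1 ht.2.1 ht.2.2.1 ht.2.2.2
    have l1 := LR hC hT ha h1 h2
    have l2 := LR hC hT ha ht.1 ht.2.1
    have q1 : (N C a k t).card = 0 := by omega
    have q2 : (N C a k (co t)).card = 0 := by omega
    have hp := pat_of h1 h2 ht q1 q2
    have hp2 : (N C a k (a k)).card = 0 → ∀ c ∈ M C a, c k = u ∨ c k = co u := by
      intro h0 d hd
      rcases hp d hd with e | e
      · have : d ∈ N C a k (a k) := mem_N.2 ⟨(mem_M.1 hd).1, (mem_M.1 hd).2, e⟩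
        rw [Finset.card_eq_zero] at h0; rw [h0] at this; simp at this
      · exact e
    have hu1 := co_conj h1 h2
    have key : ∀ v, v ≠ a k → v ≠ co (a k) → (∀ c ∈ M C a, c k = v ∨ c k = co v) → (N C a k v).card = 1 →
        (N C a k (co v)).card = 5 → False := by
      intro v g1 g2 g3 g4 g5
      obtain ⟨e, he⟩ := Finset.card_eq_one.1 g4
      have c1 := PAT3 ha g2 g3
      have c2 := PAT3 (u := co v) ha (co_conj g1 g2).2 (by intro c hc; rw [co_co]; have := g3 c hc; tauto)
      have c1' := c1
      rw [he] at c1'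
      have := Cov_single c1'
      exact hcon ⟨k, v, g1, g2, by rw [he, this], g5, c2, g3⟩
    have l3 : (N C a k (a k)).card = 0 → False := by
      intro h0
      have hh := hp2 h0
      have cs : ((N C a k u).card = 5 ∧ (N C a k (co u)).card = 1) ∨ ((N C a k u).card < 5 ∧ 2 ≤ (N C a k u).card) := by omega
      rcases cs with cs | cs
      · exact key (co u) hu1.1 hu1.2 (by intro c hc; rw [co_co]; have := hh c hc; tauto) cs.2 (by rw [co_co]; exact cs.1)
      · have L := PAT3L hC ha h2 hh (hT.mono N_sub) cs.1
        have : (N C a k u).card ≤ 1 := Finset.card_le_one.2 (fun c hc d hd => by rw [L c hc, L d hd])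
        omega
    have g1 : (N C a k (a k)).card = 1 := by by_contra; apply l3; omega
    obtain ⟨e, he⟩ := Finset.card_eq_one.1 g1
    have g2 : (N C a k u).card = 3 := by omega
    obtain ⟨j, m, x, y, hS⟩ := LLm hC hT ha hu1.1 hu1.2 (by intro c hc; rw [co_co]; have := hp c hc; tauto) he
      (by omega) (Or.inr (by rw [co_co]; exact g2))
    have := hS.n2
    rw [co_co] at this
    rw [this] at g2
    have := Finset.card_le_two (a := T a k j m u (a j) y) (b := T a k j m u x (co y))
    omega
  have ex : ∃ c ∈ M C a, (Finset.univ.filter (fun j => c j ≠ a j)).card ≤ 2 := by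
    by_contra hno
    push Not at hno
    have h1 := KR ha
    have h2 : ∑ c ∈ M C a, 8 * ∏ j, gw (c j) (a j) ≤ ∑ c ∈ M C a, 4 ^ Fintype.card ι :=
      Finset.sum_le_sum fun c hc => weight_le (hno c hc)
    rw [← Finset.mul_sum, Finset.sum_const, h6, smul_eq_mul] at h2
    have : 0 < 4 ^ Fintype.card ι := by positivity
    omega
  obtain ⟨c, hc, hcard⟩ := ex
  have hsub : (M C a).erase c ⊆ (Finset.univ.filter (fun j => c j ≠ a j)).biUnion (fun j => N C a j (co (c j))) := by
    intro d hd
    rw [Finset.mem_erase] at hd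
    obtain ⟨j, hj⟩ := hC d (mem_M.1 hd.2).1 c (mem_M.1 hc).1 hd.1
    rw [Finset.mem_biUnion]
    refine ⟨j, ?_, mem_N.2 ⟨(mem_M.1 hd.2).1, (mem_M.1 hd.2).2, hj⟩⟩
    simp
    intro e; exact (mem_M.1 hd.2).2 ⟨j, by rw [← e, hj]⟩
  have h1 := Finset.card_le_card hsub
  rw [Finset.card_erase_of_mem hc, h6] at h1
  have h2 := Finset.card_biUnion_le_card_mul (Finset.univ.filter (fun j => c j ≠ a j)) (fun j => N C a j (co (c j))) 2
    (by
      intro j hj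
      apply pat
      intro e
      exact (mem_M.1 hc).2 ⟨j, by rw [← e, co_co]⟩)
  omega
def K (C : Finset Wrd) (k : ι) (s : Fin 6) : Finset Wrd := C.filter (fun c => c k = s)
theorem mem_K {c k s} : c ∈ K C k s ↔ c ∈ C ∧ c k = s := by simp [K]
theorem K_sub {k s} : K C k s ⊆ C := Finset.filter_subset _ _
attribute [irreducible] K
theorem N_sub_K {a k s} : N C a k s ⊆ K C k s := by
  intro c hc; rw [mem_N] at hc; exact mem_K.2 ⟨hc.1, hc.2.2⟩
theorem N_le_K {a k s} : (N C a k s).card ≤ (K C k s).card :=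
  Finset.card_le_card N_sub_K
theorem cardK (C : Finset Wrd) (k : ι)
    (h1 : u ≠ z) (h2 : u ≠ co z) (h3 : t ≠ z) (h4 : t ≠ co z) (h5 : t ≠ u) (h6 : t ≠ co u) :
    C.card = (K C k z).card + (K C k (co z)).card + (K C k u).card + (K C k (co u)).card +
      (K C k t).card + (K C k (co t)).card := by
  have : C.card = ∑ s, (K C k s).card := by
    rw [Finset.card_eq_sum_card_fiberwise (f := fun c => c k) (t := Finset.univ) (by simp)]
    refine Finset.sum_congr rfl fun s _ => ?_
    congr 1
    ext c; simp [mem_K]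
  rw [this, sum6 z u t h1 h2 h3 h4 h5 h6]
theorem M5 (hC : Code C) (hT : TF C) (h5 : C.card ≤ 5)
    (c1 : Cov C a1) (c2 : Cov C a2) (n1 : a1 ∉ C) (n2 : a2 ∉ C) (hD : D a1 a2) : False := by
  obtain ⟨k, hk⟩ := hD
  have m1 := L1M hC hT c1 n1
  have m2 := L1M hC hT c2 n2
  have e1 : M C a1 = C := Finset.eq_of_subset_of_card_le M_sub (by omega)
  have e2 : M C a2 = C := Finset.eq_of_subset_of_card_le M_sub (by omega)
  have hz : ∀ c ∈ C, c k ≠ a1 k ∧ c k ≠ co (a1 k) := by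
    intro c hc
    constructor
    · intro e; have : c ∈ M C a2 := by rw [e2]; exact hc
      exact (mem_M.1 this).2 ⟨k, by rw [e, hk]⟩
    · intro e; have : c ∈ M C a1 := by rw [e1]; exact hc
      exact (mem_M.1 this).2 ⟨k, e⟩
  have hne : C.Nonempty := Finset.card_pos.1 (by rw [← e1]; omega)
  obtain ⟨c, hc⟩ := hne
  have hc1 : c ∈ M C a1 := by rw [e1]; exact hc
  obtain ⟨g, _⟩ := S5pat hC hT c1 (hz c hc).1 (hz c hc).2 ⟨c, mem_N.2 ⟨hc, (mem_M.1 hc1).2, rfl⟩⟩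
    (le_antisymm ((Finset.card_le_card M_sub).trans h5) m1)
  obtain ⟨e, he⟩ := Finset.card_eq_one.1 g
  have : e ∈ N C a1 k (a1 k) := by simp [he]
  exact (hz e (mem_N.1 this).1).1 (mem_N.1 this).2.2
structure TwinO (C : Finset Wrd) (k : ι) (u : Fin 6) (a1 a2 : Wrd) : Prop where
  tw : a2 = upd a1 k (co (a1 k))
  u1 : u ≠ a1 k
  u2 : u ≠ co (a1 k)
  h : upd a1 k u ∈ C
  five : 5 ≤ (K C k (co u)).card
  cov : Cov (K C k (co u)) (upd a1 k (co u))
structure XO (C : Finset Wrd) (k : ι) (a1 a2 : Wrd) (j : ι) (u ξ : Fin 6) : Prop where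
  jk : j ≠ k
  u1 : u ≠ a1 k
  u2 : u ≠ co (a1 k)
  x1 : ξ ≠ a1 j
  x2 : ξ ≠ co (a1 j)
  a2e : a2 = upd (upd a1 j ξ) k (co (a1 k))
  seven : C.card = 7
  e : upd a1 j (co ξ) ∈ C
  c : upd (upd a1 j ξ) k u ∈ C
  five : (K C k (co u)).card = 5
  dj : ∀ d ∈ K C k (co u), d j = ξ
  cov : Cov (K C k (co u)) (upd (upd a1 j ξ) k (co u))
  all : ∀ w ∈ C, w = upd a1 j (co ξ) ∨ w = upd (upd a1 j ξ) k u ∨ w ∈ K C k (co u)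
def Out (C : Finset Wrd) (k : ι) (a1 a2 : Wrd) : Prop :=
  (∃ u, TwinO C k u a1 a2) ∨ (∃ j u ξ, XO C k a1 a2 j u ξ) ∨ (∃ j u ξ, XO C k a2 a1 j u ξ)
theorem TwinO.symm (h : TwinO C k u a1 a2) :
    TwinO C k u a2 a1 := by
  have h1 := h.tw
  have hk : a2 k = co (a1 k) := by rw [h1]; simp
  have hu : ∀ s, upd a2 k s = upd a1 k s := by intro s; rw [h1, Function.update_idem]
  have g := co_conj (z := a1 k) h.u1 h.u2
  refine ⟨?_, by rw [hk]; exact h.u2, by rw [hk, co_co]; exact h.u1, by rw [hu]; exact h.h, h.five, by rw [hu]; exact h.cov⟩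
  rw [hk, co_co, hu, Function.update_eq_self]
theorem Out.symm (h : Out C k a1 a2) : Out C k a2 a1 := by
  rcases h with ⟨u, h⟩ | h | h
  · exact Or.inl ⟨u, h.symm⟩
  · exact Or.inr (Or.inr h)
  · exact Or.inr (Or.inl h)
theorem K_empty {k s} (h : (K C k s).card = 0) : ∀ c ∈ C, c k ≠ s := by
  intro c hc e
  rw [Finset.card_eq_zero] at h
  have : c ∈ K C k s := mem_K.2 ⟨hc, e⟩
  rw [h] at this; simp at this
theorem N_empty {a k s} (h : (N C a k s).card = 0) : ∀ c ∈ M C a, c k ≠ s := by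
  intro c hc e
  rw [Finset.card_eq_zero] at h
  have : c ∈ N C a k s := mem_N.2 ⟨(mem_M.1 hc).1, (mem_M.1 hc).2, e⟩
  rw [h] at this; simp at this
theorem upd_eq_cancel (h : c = upd a k s) (t : Fin 6) :
    upd c k t = upd a k t := by rw [h, Function.update_idem]
theorem M7i1 (hC : Code C) (hT : TF C)
    (h7 : C.card ≤ 7)
    (c1 : Cov C a1) (c2 : Cov C a2) (n1 : a1 ∉ C) (n2 : a2 ∉ C) (hk : a2 k = co (a1 k))
    (u1 : u ≠ a1 k) (u2 : u ≠ co (a1 k)) (hc : N C a1 k u = {c}) (h5 : 5 ≤ (N C a1 k (co u)).card)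
    (hz' : (K C k (co (a1 k))).card = 0) : Out C k a1 a2 := by
  obtain ⟨t, ht⟩ := third' (a1 k) u u1 u2
  have cK := cardK C k u1 u2 ht.1 ht.2.1 ht.2.2.1 ht.2.2.2
  have le1 : (N C a1 k u).card ≤ _ := N_le_K
  have le2 : (N C a1 k (co u)).card ≤ _ := N_le_K
  have le3 : (N C a2 k u).card ≤ _ := N_le_K
  have le4 : (N C a2 k (co u)).card ≤ _ := N_le_K
  have le5 : (N C a2 k t).card ≤ _ := N_le_K
  have le6 : (N C a2 k (co t)).card ≤ _ := N_le_K
  have le7 : (N C a1 k t).card ≤ _ := N_le_K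
  have le8 : (N C a1 k (co t)).card ≤ _ := N_le_K
  have hc1 : (N C a1 k u).card = 1 := by rw [hc]; simp
  have uu1 : u ≠ a2 k := by rw [hk]; exact u2
  have uu2 : u ≠ co (a2 k) := by rw [hk, co_co]; exact u1
  have tt : t ≠ a2 k ∧ t ≠ co (a2 k) ∧ t ≠ u ∧ t ≠ co u := by
    rw [hk, co_co]; exact ⟨ht.2.1, ht.1, ht.2.2⟩
  have lt1 := LR hC hT c1 ht.1 ht.2.1
  have lt2 := LR hC hT c2 tt.1 tt.2.1
  have e1 : (N C a1 k t).card = 0 ∧ (N C a1 k (co t)).card = 0 := by omega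
  have e2 : (N C a2 k t).card = 0 ∧ (N C a2 k (co t)).card = 0 := by omega
  have p1 := pat_of u1 u2 ht e1.1 e1.2
  have p2 := pat_of uu1 uu2 tt e2.1 e2.2
  have p2' : ∀ c ∈ M C a2, c k = u ∨ c k = co u := by
    intro d hd
    rcases p2 d hd with e | e
    · exact absurd (e.trans hk) (K_empty hz' d (mem_M.1 hd).1)
    · exact e
  have L2 := PAT3L hC c2 uu2 p2' (hT.mono N_sub) (by omega)
  have hne : (N C a2 k u).Nonempty := by
    obtain ⟨w, hw, m, _⟩ := ex_diff c2 n2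
    rcases p2' w hw with e | e
    · exact ⟨w, mem_N.2 ⟨(mem_M.1 hw).1, (mem_M.1 hw).2, e⟩⟩
    · have := PAT1 (u := co u) hC c2 (co_conj uu1 uu2).1 ⟨w, mem_N.2 ⟨(mem_M.1 hw).1, (mem_M.1 hw).2, e⟩⟩
      rwa [co_co] at this
  obtain ⟨d, hd⟩ := hne
  have hde := L2 d hd
  have hcN : c ∈ N C a1 k u := by simp [hc]
  have hcC := (mem_N.1 hcN).1
  have hck := (mem_N.1 hcN).2.2
  have hdC := (mem_N.1 hd).1
  have hdk := (mem_N.1 hd).2.2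
  have cov1 := PAT2b hC c1 u1 hc
  have covK : Cov (K C k (co u)) (upd c k (co u)) := cov1.mono N_sub_K
  have noz : (N C a1 k (a1 k)).card = 0 → c = upd a1 k u := by
    intro h0
    have p1' : ∀ c ∈ M C a1, c k = u ∨ c k = co u := by
      intro d hd
      rcases p1 d hd with e | e
      · exact absurd e (N_empty h0 d hd)
      · exact e
    have cc := PAT3 c1 u2 p1'
    rw [hc] at cc
    exact (Cov_single cc).symm
  by_cases hcd : c = d
  · by_cases h0 : (N C a1 k (a1 k)).card = 0
    · left
      have e1 := noz h0
      refine ⟨u, ⟨?_, u1, u2, e1 ▸ hcC, by omega, by rw [← upd_eq_cancel e1]; exact covK⟩⟩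
      rw [← hk, ← Function.update_idem (a := k) (v := u) (f := a1), ← e1, hcd, hde, Function.update_idem,
        Function.update_eq_self]
    · right; left
      have lez : (N C a1 k (a1 k)).card ≤ _ := N_le_K
      have kz : (K C k (a1 k)).card = 1 := by omega
      have nz : (N C a1 k (a1 k)).card = 1 := by omega
      have hcdP : (Pr C a1 k u).card = 2 := by rw [Pr_card hC u1 u2, nz, hc1]
      obtain ⟨j, x, x1, x2, hP⟩ := F2 (Pr_code hC u2) (Pr_cov c1 u2 p1) (fun _ => Pr_meet) hcdP
      have hjk : j ≠ k := by
        rintro rfl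
        have := Pr_k (C := C) (a := a1) (k := j) (u := u) (w := upd a1 j x) (by rw [hP]; simp)
        simp at this; exact x1 this
      obtain ⟨e, he⟩ := Finset.card_eq_one.1 nz
      have heN : e ∈ N C a1 k (a1 k) := by simp [he]
      have heP : e ∈ Pr C a1 k u := mem_Pr.2 (Or.inl heN)
      have hcP : upd c k (a1 k) ∈ Pr C a1 k u := by
        unfold Pr; rw [Finset.mem_union, Finset.mem_image]; exact Or.inr ⟨c, hcN, rfl⟩
      have hne : e ≠ upd c k (a1 k) := by
        rintro rfl
        have h3 := (mem_N.1 heN).1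
        by_cases hcc : c = upd c k (a1 k)
        · have := congrFun hcc k; simp [hck] at this; exact u1 this
        · obtain ⟨i, hi⟩ := hC _ hcC _ h3 hcc
          by_cases hik : i = k
          · subst hik; simp [hck] at hi; exact u2 hi
          · simp [hik] at hi; exact ne_co _ hi
      have main : ∃ ξ, ξ ≠ a1 j ∧ ξ ≠ co (a1 j) ∧ e = upd a1 j (co ξ) ∧ upd c k (a1 k) = upd a1 j ξ := by
        rw [hP] at heP hcP
        simp only [Finset.mem_insert, Finset.mem_singleton] at heP hcP
        rcases heP with e1 | e1 <;> rcases hcP with e2 | e2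
        · exact absurd (e1.trans e2.symm) hne
        · exact ⟨co x, (co_conj x1 x2).1, (co_conj x1 x2).2, by rw [co_co]; exact e1, e2⟩
        · exact ⟨x, x1, x2, e1, e2⟩
        · exact absurd (e1.trans e2.symm) hne
      obtain ⟨ξ, g1, g2, g3, g4⟩ := main
      have hcu : ∀ s, upd c k s = upd (upd a1 j ξ) k s := by
        intro s; rw [← g4, Function.update_idem]
      have hce : c = upd (upd a1 j ξ) k u := by rw [← hcu u, ← hck, Function.update_eq_self]
      have hNK : N C a1 k (co u) = K C k (co u) := Finset.eq_of_subset_of_card_le N_sub_K (by omega)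
      refine ⟨j, u, ξ, hjk, u1, u2, g1, g2, ?_, by omega, g3 ▸ (mem_N.1 heN).1, hce ▸ hcC, by omega, ?_, ?_, ?_⟩
      · rw [← hcu, hcd, hde, Function.update_idem, ← hk, Function.update_eq_self]
      · intro d hd
        have := PAT2a hC c1 u1 hc (d := d) (by rw [hNK]; exact hd) hjk (by rw [hce]; simp [hjk]; exact g1)
        rw [this, hce]; simp [hjk]
      · rw [← hcu]; exact covK
      · intro w hw
        have kzz : (K C k (a1 k)) = {e} := by
          symm; apply Finset.eq_of_subset_of_card_le
          · intro y hy; simp at hy; subst hy; exact N_sub_K heN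
          · rw [kz]; simp
        have kuu : (K C k u) = {c} := by
          symm; apply Finset.eq_of_subset_of_card_le
          · intro y hy; simp at hy; subst hy; exact N_sub_K hcN
          · rw [Finset.card_singleton]; omega
        have hl := letters (a1 k) u t (Ne.symm u1) (fun e => u2 (by rw [e, co_co])) ht.1 ht.2.1 ht.2.2.1 ht.2.2.2 (w k)
        rcases hl with h | h | h | h | h | h
        · left; have : w ∈ K C k (a1 k) := mem_K.2 ⟨hw, h⟩
          rw [kzz] at this; simp at this; rw [this, g3]
        · exact absurd h (K_empty hz' w hw)
        · right; left; have : w ∈ K C k u := mem_K.2 ⟨hw, h⟩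
          rw [kuu] at this; simp at this; rw [this, ← hce]
        · right; right; exact mem_K.2 ⟨hw, h⟩
        · exact absurd h (K_empty (by omega) w hw)
        · exact absurd h (K_empty (by omega) w hw)
  · exfalso
    have k2 : 2 ≤ (K C k u).card := by
      have : ({c, d} : Finset Wrd) ⊆ K C k u := by
        intro w; simp only [Finset.mem_insert, Finset.mem_singleton]; rintro (rfl | rfl)
        · exact N_sub_K hcN
        · exact N_sub_K hd
      have := Finset.card_le_card this
      rwa [Finset.card_pair hcd] at this
    have lez : (N C a1 k (a1 k)).card ≤ _ := N_le_K
    have hce := noz (by omega)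
    have cov2 : Cov (K C k (co u)) (upd a2 k (co u)) := (PAT3 (u := co u) c2 (co_conj uu1 uu2).2
      (by intro c hc; rw [co_co]; have := p2' c hc; tauto)).mono N_sub_K
    refine M5 (hC.mono K_sub) (hT.mono K_sub) (by omega) covK cov2 ?_ ?_ ?_
    · intro h; exact hT _ hcC _ (K_sub h) (twin_upd hck)
    · intro h; rw [← upd_eq_cancel hde] at h; exact hT _ hdC _ (K_sub h) (twin_upd hdk)
    · obtain ⟨i, hi⟩ := hC _ hcC _ hdC hcd
      have : i ≠ k := by rintro rfl; rw [hck, hdk] at hi; exact ne_co _ hi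
      rw [← upd_eq_cancel hde]
      exact ⟨i, by simpa [this] using hi⟩
theorem M7i (hC : Code C) (hT : TF C)
    (h7 : C.card ≤ 7)
    (c1 : Cov C a1) (c2 : Cov C a2) (n1 : a1 ∉ C) (n2 : a2 ∉ C) (hk : a2 k = co (a1 k))
    (u1 : u ≠ a1 k) (u2 : u ≠ co (a1 k)) (hc : (N C a1 k u).card = 1) (h5 : 5 ≤ (N C a1 k (co u)).card) :
    Out C k a1 a2 := by
  obtain ⟨c, hcc⟩ := Finset.card_eq_one.1 hc
  by_cases hz : (K C k (co (a1 k))).card = 0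
  · exact M7i1 hC hT h7 c1 c2 n1 n2 hk u1 u2 hcc h5 hz
  obtain ⟨t, ht⟩ := third' (a1 k) u u1 u2
  have cK := cardK C k u1 u2 ht.1 ht.2.1 ht.2.2.1 ht.2.2.2
  have le1 : (N C a1 k u).card ≤ _ := N_le_K
  have le2 : (N C a1 k (co u)).card ≤ _ := N_le_K
  have le3 : (N C a2 k u).card ≤ _ := N_le_K
  have le4 : (N C a2 k (co u)).card ≤ _ := N_le_K
  have le5 : (N C a2 k t).card ≤ _ := N_le_K
  have le6 : (N C a2 k (co t)).card ≤ _ := N_le_K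
  have le7 : (N C a2 k (a2 k)).card ≤ _ := N_le_K
  have uu1 : u ≠ a2 k := by rw [hk]; exact u2
  have uu2 : u ≠ co (a2 k) := by rw [hk, co_co]; exact u1
  have tt : t ≠ a2 k ∧ t ≠ co (a2 k) ∧ t ≠ u ∧ t ≠ co u := by
    rw [hk, co_co]; exact ⟨ht.2.1, ht.1, ht.2.2⟩
  have cM := cardM C a2 k uu1 uu2 tt.1 tt.2.1 tt.2.2.1 tt.2.2.2
  have l2 := LR hC hT c2 uu1 uu2
  have m2 := L1M hC hT c2 n2
  rw [hk] at le7 cM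
  have q : (N C a2 k u).card = 1 := by omega
  have q' : 5 ≤ (N C a2 k (co u)).card := by omega
  obtain ⟨d, hd⟩ := Finset.card_eq_one.1 q
  refine (M7i1 hC hT h7 c2 c1 n2 n1 (by rw [hk, co_co]) uu1 uu2 hd q' ?_).symm
  rw [hk, co_co]; omega
theorem S5cmp {a b : Wrd} {k j m j2 m2 : ι} {u x y p q : Fin 6}
    (h : S5F C a k j m u x y) (g : S5F C b k j2 m2 u p q) (e : N C a k u = N C b k u) :
    j2 = j ∧ m2 = m ∧ (∀ i, i ≠ k → i ≠ j → i ≠ m → a i = b i) ∧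
    ((p = x ∧ q = y ∧ a m = b m) ∨ (p = co x ∧ q = a m ∧ b m = y)) := by
  have hn1 := h.n1
  have gn1 := g.n1
  have f1 : T a k j m u x (a m) ∈ N C b k u := by rw [← e, hn1]; simp
  have f2 : T a k j m u (co x) y ∈ N C b k u := by rw [← e, hn1]; simp
  have g1 : T b k j2 m2 u p (b m2) ∈ N C a k u := by rw [e, gn1]; simp
  have g2 : T b k j2 m2 u (co p) q ∈ N C a k u := by rw [e, gn1]; simp
  rw [gn1] at f1 f2
  simp only [Finset.mem_insert, Finset.mem_singleton] at f1 f2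
  have hkj := h.kj; have hkm := h.km; have hjm := h.jm; have gkj := g.kj; have gkm := g.km; have gjm := g.jm
  have key : ∀ {s1 s2 t1 t2 : Fin 6}, T a k j m u x (a m) = T b k j2 m2 u s1 t1 → T a k j m u (co x) y = T b k j2 m2 u s2 t2 →
      s2 = co s1 → t1 ≠ t2 → t1 ≠ co t2 → j2 = j ∧ m2 = m ∧ (∀ i, i ≠ k → i ≠ j → i ≠ m → a i = b i) ∧ s1 = x ∧ t1 = a m ∧ t2 = y := by
    intro s1 s2 t1 t2 e1 e2 es et et'
    have hj : j2 = j := by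
      by_contra hne
      have d1 := congrFun e1 j2
      have d2 := congrFun e2 j2
      rw [T_j gjm] at d1 d2
      by_cases hm : j2 = m
      · subst hm; rw [T_m] at d1 d2
        rw [es, ← d1] at d2; exact h.y1 (by
          exfalso; exact h.y2 d2)
      · rw [T_o (Ne.symm gkj) hne hm] at d1 d2
        rw [es, ← d1] at d2; exact ne_co _ d2
    subst hj
    have hm : m2 = m := by
      by_contra hne
      have d1 := congrFun e1 m2
      have d2 := congrFun e2 m2
      rw [T_m] at d1 d2
      rw [T_o (Ne.symm gkm) (Ne.symm gjm) hne] at d1 d2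
      exact et (by rw [← d1, ← d2])
    subst hm
    refine ⟨rfl, rfl, ?_, ?_, ?_, ?_⟩
    · intro i i1 i2 i3
      have d1 := congrFun e1 i
      rwa [T_o i1 i2 i3, T_o i1 i2 i3] at d1
    · have d1 := congrFun e1 j2
      rw [T_j hjm, T_j hjm] at d1; exact d1.symm
    · have d1 := congrFun e1 m2
      rw [T_m, T_m] at d1; exact d1.symm
    · have d1 := congrFun e2 m2
      rw [T_m, T_m] at d1; exact d1.symm
  rcases f1 with e1 | e1 <;> rcases f2 with e2 | e2
  · exfalso
    have := congrFun (e1.trans e2.symm) j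
    rw [T_j hjm, T_j hjm] at this; exact ne_co _ this
  · obtain ⟨r1, r2, r3, r4, r5, r6⟩ := key e1 e2 rfl (Ne.symm g.y1) (fun h => g.y2 (by rw [h, co_co]))
    exact ⟨r1, r2, r3, Or.inl ⟨r4, r6, by rw [← r5, r2]⟩⟩
  · obtain ⟨r1, r2, r3, r4, r5, r6⟩ := key e1 e2 (by rw [co_co]) (g.y1) (g.y2)
    exact ⟨r1, r2, r3, Or.inr ⟨by rw [← r4, co_co], r5, by rw [← r6, r2]⟩⟩
  · exfalso
    have := congrFun (e1.trans e2.symm) j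
    rw [T_j hjm, T_j hjm] at this; exact ne_co _ this
theorem four_le {c1 c2 c3 c4 : Wrd} (h1 : c1 ∈ A) (h2 : c2 ∈ A) (h3 : c3 ∈ A) (h4 : c4 ∈ A)
   (h : c1 m ≠ c2 m) (h' : c1 m ≠ c3 m) (h'' : c1 m ≠ c4 m) (g : c2 m ≠ c3 m) (g' : c2 m ≠ c4 m) (g'' : c3 m ≠ c4 m) : 4 ≤ A.card := by
  have : ({c1, c2, c3, c4} : Finset Wrd).card = 4 := by
    rw [Finset.card_insert_of_notMem, Finset.card_insert_of_notMem, Finset.card_pair]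
    · rintro rfl; exact g'' rfl
    · simp only [Finset.mem_insert, Finset.mem_singleton]
      rintro (rfl | rfl); exact g rfl; exact g' rfl
    · simp only [Finset.mem_insert, Finset.mem_singleton]
      rintro (rfl | rfl | rfl); exact h rfl; exact h' rfl; exact h'' rfl
  rw [← this]
  apply Finset.card_le_card
  intro c; simp only [Finset.mem_insert, Finset.mem_singleton]
  rintro (rfl | rfl | rfl | rfl) <;> assumption
theorem S5swap {a b : Wrd} {u x y p q : Fin 6}
    (h : S5F C a k j m u x y) (g : S5F C b k j m u p q) (e1 : q = a m) (h3 : (K C k (co u)).card ≤ 3) : False := by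
  have hn := h.n2
  have gn := g.n2
  have w1 : T a k j m (co u) (a j) y ∈ K C k (co u) := N_sub_K (by rw [hn]; simp)
  have w2 : T a k j m (co u) x (co y) ∈ K C k (co u) := N_sub_K (by rw [hn]; simp)
  have w3 : T b k j m (co u) (b j) q ∈ K C k (co u) := N_sub_K (by rw [gn]; simp)
  have w4 : T b k j m (co u) p (co q) ∈ K C k (co u) := N_sub_K (by rw [gn]; simp)
  have y1 := h.y1; have y2 := h.y2
  have z := co_conj y1 y2
  have := four_le (m := m) w1 w2 w3 w4 (by simp only [T_m]; exact ne_co _) (by simp only [T_m]; rwa [e1]) (by simp only [T_m]; rwa [e1])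
    (by simp only [T_m]; rw [e1]; exact z.1) (by simp only [T_m]; rw [e1]; exact z.2) (by simp only [T_m]; exact ne_co _)
  omega
theorem M7ii (hC : Code C) (hT : TF C)
    (h7 : C.card ≤ 7)
    (c1 : Cov C a1) (c2 : Cov C a2) (n1 : a1 ∉ C) (n2 : a2 ∉ C) (hk : a2 k = co (a1 k))
    (u1 : u ≠ a1 k) (u2 : u ≠ co (a1 k)) (k1 : (K C k (a1 k)).card = 1) (k2 : (K C k (co (a1 k))).card = 1)
    (k3 : (K C k u).card = 2) (k4 : 2 ≤ (K C k (co u)).card) : False := by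
  obtain ⟨t, ht⟩ := third' (a1 k) u u1 u2
  have cK := cardK C k u1 u2 ht.1 ht.2.1 ht.2.2.1 ht.2.2.2
  have gen : ∀ a, Cov C a → a ∉ C → u ≠ a k → u ≠ co (a k) → (t ≠ a k ∧ t ≠ co (a k) ∧ t ≠ u ∧ t ≠ co u) →
      (K C k (a k)).card = 1 → N C a k u = K C k u ∧ ∃ j m x y, S5F C a k j m u x y := by
    intro a ca na v1 v2 vt ka
    have le1 : (N C a k u).card ≤ _ := N_le_K
    have le2 : (N C a k (co u)).card ≤ _ := N_le_K
    have le3 : (N C a k t).card ≤ _ := N_le_K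
    have le4 : (N C a k (co t)).card ≤ _ := N_le_K
    have le5 : (N C a k (a k)).card ≤ _ := N_le_K
    have cM := cardM C a k v1 v2 vt.1 vt.2.1 vt.2.2.1 vt.2.2.2
    have l1 := LR hC hT ca v1 v2
    have l2 := LR hC hT ca vt.1 vt.2.1
    have m2 := L1M hC hT ca na
    have q : (N C a k u).card = 2 := by omega
    have q2 : (N C a k t).card = 0 ∧ (N C a k (co t)).card = 0 := by omega
    have pp := pat_of v1 v2 vt q2.1 q2.2
    have q3 : (N C a k (a k)).card = 1 := by
      by_contra h0
      have h0 : (N C a k (a k)).card = 0 := by omega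
      have p1' : ∀ c ∈ M C a, c k = u ∨ c k = co u := by
        intro d hd
        rcases pp d hd with e | e
        · exact absurd e (N_empty h0 d hd)
        · exact e
      have := PAT3L hC ca v2 p1' (hT.mono N_sub) (by omega)
      have : (N C a k u).card ≤ 1 := by
        apply Finset.card_le_one.2
        intro c hc d hd; rw [this c hc, this d hd]
      omega
    obtain ⟨e, he⟩ := Finset.card_eq_one.1 q3
    refine ⟨Finset.eq_of_subset_of_card_le N_sub_K (by omega), LLm hC hT ca v1 v2 pp he q (by omega)⟩
  obtain ⟨e1, j, m, x, y, h⟩ := gen a1 c1 n1 u1 u2 ht k1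
  obtain ⟨e2, j2, m2, p, q, g⟩ := gen a2 c2 n2 (by rw [hk]; exact u2) (by rw [hk, co_co]; exact u1) (by
    rw [hk, co_co]; exact ⟨ht.2.1, ht.1, ht.2.2⟩) (by rw [hk]; exact k2)
  obtain ⟨r1, r2, r3, r4⟩ := S5cmp h g (e1.trans e2.symm)
  subst r1 r2
  rcases r4 with ⟨rfl, rfl, r4⟩ | ⟨r5, r6, r7⟩
  · have hn := h.n0
    have gn := g.n0
    have hh : T a1 k j2 m2 (a1 k) (co p) (co q) ∈ C := N_sub (by rw [hn]; simp)
    have gg : T a2 k j2 m2 (a2 k) (co p) (co q) ∈ C := N_sub (by rw [gn]; simp)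
    refine hT _ hh _ gg ⟨k, ?_, ?_⟩
    · rw [T_k h.kj h.km, T_k h.kj h.km, hk]
    · intro i hi
      by_cases i1 : i = m2
      · subst i1; rw [T_m, T_m]
      by_cases i2 : i = j2
      · subst i2; rw [T_j h.jm, T_j h.jm]
      rw [T_o hi i2 i1, T_o hi i2 i1, r3 i hi i2 i1]
  · exact S5swap h g r6 (by omega)
theorem K_erase {h : Wrd} (hs : h k ≠ s) : K (C.erase h) k s = K C k s := by
  ext c; simp only [mem_K, Finset.mem_erase]
  constructor
  · rintro ⟨⟨_, h1⟩, h2⟩; exact ⟨h1, h2⟩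
  · rintro ⟨h1, h2⟩; refine ⟨⟨?_, h1⟩, h2⟩; rintro rfl; exact hs h2
theorem K_erase2 {h : Wrd} (hh : h ∈ C) : (K (C.erase h) k (h k)).card + 1 = (K C k (h k)).card := by
  have : K (C.erase h) k (h k) = (K C k (h k)).erase h := by
    ext c; simp only [mem_K, Finset.mem_erase]; tauto
  rw [this]
  exact Finset.card_erase_add_one (mem_K.2 ⟨hh, rfl⟩)
theorem M7z (hC : Code C) (hT : TF C)
    (h7 : C.card ≤ 7)
    (c1 : Cov C a1) (c2 : Cov C a2) (n1 : a1 ∉ C) (n2 : a2 ∉ C) (hk : a2 k = co (a1 k))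
    (u1 : u ≠ a1 k) (u2 : u ≠ co (a1 k)) (k1 : (K C k (a1 k)).card = 2) (k2 : (K C k (co (a1 k))).card = 1)
    (k3 : (K C k u).card = 2) (k4 : (K C k (co u)).card = 2) (hz : 1 ≤ (N C a1 k (a1 k)).card)
    (hu : (N C a1 k u).card = 2) (hu' : (N C a1 k (co u)).card = 2) : False := by
  obtain ⟨t, ht⟩ := third' (a1 k) u u1 u2
  have cK := cardK C k u1 u2 ht.1 ht.2.1 ht.2.2.1 ht.2.2.2
  have le3 : (N C a1 k t).card ≤ _ := N_le_K
  have le4 : (N C a1 k (co t)).card ≤ _ := N_le_K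
  have le5 : (N C a1 k (a1 k)).card ≤ _ := N_le_K
  have cM := cardM C a1 k u1 u2 ht.1 ht.2.1 ht.2.2.1 ht.2.2.2
  have er : ∀ h o : Wrd, h ∈ C → h k = a1 k → o k = a1 k → Cov (C.erase h) o → o ∉ C → False := by
    intro h o hh hhk ho cvo no
    have e1 : K (C.erase h) k (co (a1 k)) = _ := K_erase (by rw [hhk]; exact ne_co _)
    have e2 : K (C.erase h) k u = _ := K_erase (by rw [hhk]; exact Ne.symm u1)
    have e3 : K (C.erase h) k (co u) = _ := K_erase (by rw [hhk]; exact Ne.symm (co_conj u1 u2).1)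
    have e4 := K_erase2 (k := k) hh
    have hs : C.erase h ⊆ C := Finset.erase_subset _ _
    refine M7ii (hC.mono hs) (hT.mono hs) ((Finset.card_le_card hs).trans h7) cvo ?_ (fun x => no (hs x)) (fun x => n2 (hs x))
      (by rw [hk, ho]) (u := u) (by rw [ho]; exact u1) (by rw [ho]; exact u2) ?_ (by rw [ho, e1]; exact k2) (by rw [e2]; exact k3)
      (by rw [e3]; omega)
    · refine (Cov_M c2).mono ?_
      intro w hw
      rw [mem_M] at hw
      refine Finset.mem_erase.2 ⟨?_, hw.1⟩
      rintro rfl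
      exact hw.2 ⟨k, by rw [hhk, hk, co_co]⟩
    · rw [ho, ← hhk]; rw [hhk] at e4 ⊢; omega
  by_cases h2 : (N C a1 k (a1 k)).card = 2
  · obtain ⟨k0, v, v1, v2, g1, g2, g3, g4⟩ := S6 hC hT c1 (by omega)
    have hkk : k ≠ k0 := by
      rintro rfl
      obtain ⟨e, he⟩ := Finset.card_pos.1 (show 0 < (N C a1 k (a1 k)).card by omega)
      have q := (mem_N.1 he).2.2
      rcases g4 e (N_sub_M he) with r | r
      · exact v1 (r.symm.trans q)
      · exact v2 ((co_sw _ _).1 (r.symm.trans q))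
    have hh : upd a1 k0 v ∈ C := N_sub (by rw [g1]; simp)
    refine er (upd a1 k0 v) (upd a1 k0 (co v)) hh (by simp [hkk]) (by simp [hkk]) (g3.mono ?_) ?_
    · intro w hw
      refine Finset.mem_erase.2 ⟨?_, N_sub hw⟩
      rintro rfl
      have := (mem_N.1 hw).2.2
      simp at this; exact ne_co _ this
    · intro ho
      have := twin_upd (c := upd a1 k0 v) (k := k0) (u := v) (by simp)
      rw [Function.update_idem] at this
      exact hT _ hh _ ho this
  · have hlt : (N C a1 k (a1 k)).card < (K C k (a1 k)).card := by omega
    obtain ⟨f, hf, hfn⟩ := Finset.exists_mem_notMem_of_card_lt_card hlt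
    rw [mem_K] at hf
    refine er f a1 hf.1 hf.2 rfl ?_ n1
    refine (Cov_M c1).mono ?_
    intro w hw
    refine Finset.mem_erase.2 ⟨?_, M_sub hw⟩
    rintro rfl
    exact hfn (mem_N.2 ⟨hf.1, (mem_M.1 hw).2, hf.2⟩)
theorem Nz_pos (hC : Code C) (hT : TF C)
    (ca : Cov C a) (u1 : u ≠ a k) (u2 : u ≠ co (a k)) (ht : t ≠ a k ∧ t ≠ co (a k) ∧ t ≠ u ∧ t ≠ co u)
    (t1 : (N C a k t).card = 0) (t2 : (N C a k (co t)).card = 0)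
    (x1 : 2 ≤ (N C a k u).card) (x2 : 2 ≤ (N C a k (co u)).card) (h : (N C a k u).card + (N C a k (co u)).card ≤ 9) :
    1 ≤ (N C a k (a k)).card := by
  by_contra h0
  have h0 : (N C a k (a k)).card = 0 := by omega
  have p1' : ∀ c ∈ M C a, c k = u ∨ c k = co u := by
    intro d hd
    rcases pat_of u1 u2 ht t1 t2 d hd with e | e
    · exact absurd e (N_empty h0 d hd)
    · exact e
  have f1 : ¬ (N C a k u).card < 5 := by
    intro h5
    have := PAT3L hC ca u2 p1' (hT.mono N_sub) h5
    have : (N C a k u).card ≤ 1 := by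
      apply Finset.card_le_one.2
      intro c hc d hd; rw [this c hc, this d hd]
    omega
  have f2 : ¬ (N C a k (co u)).card < 5 := by
    intro h5
    have := PAT3L hC ca (co_conj u1 u2).2 (by intro c hc; rw [co_co]; have := p1' c hc; tauto) (hT.mono N_sub) h5
    have : (N C a k (co u)).card ≤ 1 := by
      apply Finset.card_le_one.2
      intro c hc d hd; rw [this c hc, this d hd]
    omega
  omega
set_option maxHeartbeats 2000000 in
theorem M7u (hC : Code C) (hT : TF C)
    (h7 : C.card ≤ 7)
    (c1 : Cov C a1) (c2 : Cov C a2) (n1 : a1 ∉ C) (n2 : a2 ∉ C) (hk : a2 k = co (a1 k))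
    (u1 : u ≠ a1 k) (u2 : u ≠ co (a1 k)) (ht : t ≠ a1 k ∧ t ≠ co (a1 k) ∧ t ≠ u ∧ t ≠ co u)
    (hu1 : 1 ≤ (N C a1 k u).card) (hu2 : 1 ≤ (N C a2 k u).card) : Out C k a1 a2 := by
  have cK := cardK C k u1 u2 ht.1 ht.2.1 ht.2.2.1 ht.2.2.2
  have uu1 : u ≠ a2 k := by rw [hk]; exact u2
  have uu2 : u ≠ co (a2 k) := by rw [hk, co_co]; exact u1
  have tt : t ≠ a2 k ∧ t ≠ co (a2 k) ∧ t ≠ u ∧ t ≠ co u := by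
    rw [hk, co_co]; exact ⟨ht.2.1, ht.1, ht.2.2⟩
  have le1 : (N C a1 k u).card ≤ _ := N_le_K
  have le2 : (N C a1 k (co u)).card ≤ _ := N_le_K
  have le3 : (N C a1 k t).card ≤ _ := N_le_K
  have le4 : (N C a1 k (co t)).card ≤ _ := N_le_K
  have le5 : (N C a1 k (a1 k)).card ≤ _ := N_le_K
  have me1 : (N C a2 k u).card ≤ _ := N_le_K
  have me2 : (N C a2 k (co u)).card ≤ _ := N_le_K
  have me3 : (N C a2 k t).card ≤ _ := N_le_K
  have me4 : (N C a2 k (co t)).card ≤ _ := N_le_K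
  have me5 : (N C a2 k (a2 k)).card ≤ _ := N_le_K
  have hl1 := LR hC hT c1 u1 u2
  have hl2 := LR hC hT c2 uu1 uu2
  have t1 := LR hC hT c1 ht.1 ht.2.1
  have t2 := LR hC hT c2 tt.1 tt.2.1
  have cu1 := co_conj u1 u2
  have cu2 := co_conj uu1 uu2
  have hk' : a1 k = co (a2 k) := by rw [hk, co_co]
  by_cases q1 : (N C a1 k u).card = 1
  · exact M7i hC hT h7 c1 c2 n1 n2 hk u1 u2 q1 (by omega)
  by_cases q2 : (N C a1 k (co u)).card = 1
  · exact M7i hC hT h7 c1 c2 n1 n2 hk cu1.1 cu1.2 q2 (by rw [co_co]; omega)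
  by_cases q3 : (N C a2 k u).card = 1
  · exact (M7i hC hT h7 c2 c1 n2 n1 hk' uu1 uu2 q3 (by omega)).symm
  by_cases q4 : (N C a2 k (co u)).card = 1
  · exact (M7i hC hT h7 c2 c1 n2 n1 hk' cu2.1 cu2.2 q4 (by rw [co_co]; omega)).symm
  exfalso
  have z1 := Nz_pos hC hT c1 u1 u2 ht (by omega) (by omega) (by omega) (by omega) (by omega)
  have z2 := Nz_pos hC hT c2 uu1 uu2 tt (by omega) (by omega) (by omega) (by omega) (by omega)
  have me5' := me5
  have z2' := z2
  rw [hk] at me5' z2'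
  by_cases r1 : (K C k (a1 k)).card = 1 ∧ (K C k (co (a1 k))).card = 1
  · by_cases r2 : (K C k u).card = 2
    · exact M7ii hC hT h7 c1 c2 n1 n2 hk u1 u2 r1.1 r1.2 r2 (by omega)
    · exact M7ii hC hT h7 c1 c2 n1 n2 hk cu1.1 cu1.2 r1.1 r1.2 (by omega) (by rw [co_co]; omega)
  · by_cases r2 : (K C k (a1 k)).card = 2
    · exact M7z hC hT h7 c1 c2 n1 n2 hk u1 u2 r2 (by omega) (by omega) (by omega) z1 (by omega) (by omega)
    · exact M7z hC hT h7 c2 c1 n2 n1 hk' uu1 uu2 (by rw [hk]; omega) (by rw [hk, co_co]; omega)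
        (by omega) (by omega) z2 (by omega) (by omega)
theorem ex_pair : ∀ z : Fin 6, ∃ u t, u ≠ z ∧ u ≠ co z ∧ t ≠ z ∧ t ≠ co z ∧ t ≠ u ∧ t ≠ co u := by decide
theorem M7 (hC : Code C) (hT : TF C)
    (h7 : C.card ≤ 7)
    (c1 : Cov C a1) (c2 : Cov C a2) (n1 : a1 ∉ C) (n2 : a2 ∉ C) (hk : a2 k = co (a1 k)) : Out C k a1 a2 := by
  obtain ⟨u, t, u1, u2, ht⟩ := ex_pair (a1 k)
  have cK := cardK C k u1 u2 ht.1 ht.2.1 ht.2.2.1 ht.2.2.2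
  have uu1 : u ≠ a2 k := by rw [hk]; exact u2
  have uu2 : u ≠ co (a2 k) := by rw [hk, co_co]; exact u1
  have tt : t ≠ a2 k ∧ t ≠ co (a2 k) ∧ t ≠ u ∧ t ≠ co u := by
    rw [hk, co_co]; exact ⟨ht.2.1, ht.1, ht.2.2⟩
  have le1 : (N C a1 k u).card ≤ _ := N_le_K
  have le2 : (N C a1 k (co u)).card ≤ _ := N_le_K
  have le3 : (N C a1 k t).card ≤ _ := N_le_K
  have le4 : (N C a1 k (co t)).card ≤ _ := N_le_K
  have le5 : (N C a1 k (a1 k)).card ≤ _ := N_le_K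
  have me1 : (N C a2 k u).card ≤ _ := N_le_K
  have me2 : (N C a2 k (co u)).card ≤ _ := N_le_K
  have me3 : (N C a2 k t).card ≤ _ := N_le_K
  have me4 : (N C a2 k (co t)).card ≤ _ := N_le_K
  have me5 : (N C a2 k (a2 k)).card ≤ _ := N_le_K
  have l1 := LR hC hT c1 u1 u2
  have l2 := LR hC hT c2 uu1 uu2
  have t1 := LR hC hT c1 ht.1 ht.2.1
  have t2 := LR hC hT c2 tt.1 tt.2.1
  have cM1 := cardM C a1 k u1 u2 ht.1 ht.2.1 ht.2.2.1 ht.2.2.2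
  have cM2 := cardM C a2 k uu1 uu2 tt.1 tt.2.1 tt.2.2.1 tt.2.2.2
  have m1 := L1M hC hT c1 n1
  have m2 := L1M hC hT c2 n2
  have me5' := me5
  rw [hk] at me5' cM2
  have hut : u ≠ t ∧ u ≠ co t := ⟨Ne.symm ht.2.2.1, fun e => ht.2.2.2 (by rw [e, co_co])⟩
  by_cases q : 1 ≤ (N C a1 k u).card ∧ 1 ≤ (N C a2 k u).card
  · exact M7u hC hT h7 c1 c2 n1 n2 hk u1 u2 ht q.1 q.2
  · by_cases q' : 1 ≤ (N C a1 k t).card ∧ 1 ≤ (N C a2 k t).card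
    · exact M7u hC hT h7 c1 c2 n1 n2 hk ht.1 ht.2.1 ⟨u1, u2, hut⟩ q'.1 q'.2
    · exfalso; omega
theorem M6 (hC : Code C) (hT : TF C)
    (h7 : C.card ≤ 6)
    (c1 : Cov C a1) (c2 : Cov C a2) (n1 : a1 ∉ C) (n2 : a2 ∉ C) (hk : a2 k = co (a1 k)) : ∃ u, TwinO C k u a1 a2 := by
  rcases M7 hC hT (by omega) c1 c2 n1 n2 hk with h | ⟨j, u, ξ, h⟩ | ⟨j, u, ξ, h⟩
  · exact h
  · have := h.seven; omega
  · have := h.seven; omega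
theorem Tw_of {a b : Wrd} (hD : D a b) (h : ∀ i, i ≠ j → a i = b i) : Tw a b := by
  obtain ⟨i, hi⟩ := hD
  have : i = j := by
    by_contra hne; rw [h i hne] at hi; exact ne_co _ hi
  subst this
  exact ⟨i, by rw [hi, co_co], h⟩
theorem Tw_updk {a b : Wrd} (h : b = upd a k (co (a k))) : Tw a b := by
  subst h; exact twin_upd rfl
theorem XO_kz (h : XO C k a1 a2 j u ξ)
   (hw : w ∈ C) : (w k = a1 k ∧ w = upd a1 j (co ξ)) ∨ (w k = u ∧ w = upd (upd a1 j ξ) k u) ∨ (w k = co u ∧ w ∈ K C k (co u)) := by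
  rcases h.all w hw with e | e | e
  · left; exact ⟨by rw [e]; simp [Ne.symm h.jk], e⟩
  · right; left; exact ⟨by rw [e]; simp, e⟩
  · right; right; exact ⟨(mem_K.1 e).2, e⟩
theorem M7aux {a1 a2 a3 : Wrd} (hC : Code C) (hT : TF C)
    (h7 : C.card ≤ 7) (h : XO C k a1 a2 j u ξ) (c1 : Cov C a1) (c2 : Cov C a2) (c3 : Cov C a3) (n1 : a1 ∉ C) (n2 : a2 ∉ C)
    (n3 : a3 ∉ C) (d1 : D a3 a1) (d2 : D a3 a2) (t1 : ¬ Tw a3 a1) (t2 : ¬ Tw a3 a2) : False := by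
  have hjk := h.jk; have u1 := h.u1; have u2 := h.u2
  have cu := co_conj u1 u2
  have a2k : a2 k = co (a1 k) := by rw [h.a2e]; simp
  have d2' := D_symm.1 d2
  have nz' : ∀ w ∈ C, w k ≠ co (a1 k) := by
    intro w hw e
    rcases XO_kz h hw with q | q | q
    · exact ne_co _ (q.1.symm.trans e)
    · exact u2 (q.1.symm.trans e)
    · exact cu.2 (q.1.symm.trans e)
  have onlyz : ∀ w ∈ C, w k = a1 k → w = upd a1 j (co ξ) := by
    intro w hw e
    rcases XO_kz h hw with q | q | q
    · exact q.2
    · exact absurd (q.1.symm.trans e) u1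
    · exact absurd (q.1.symm.trans e) cu.1
  by_cases hz : a3 k = a1 k
  · rcases M7 hC hT h7 c3 c2 n3 n2 (by rw [hz, a2k]) with ⟨v, g⟩ | ⟨j2, v, η, g⟩ | ⟨j2, v, η, g⟩
    · exact t2 (Tw_updk g.tw)
    · have e1 := onlyz _ g.e (by simp [Ne.symm g.jk]; exact hz)
      have e2 : ∀ i, i ≠ k → upd a3 j2 η i = upd a1 j ξ i := by
        intro i hi
        have := congrFun (h.a2e.symm.trans g.a2e) i
        simp only [Function.update_of_ne hi] at this
        exact this.symm
      have hj : j2 = j := by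
        by_contra hne
        have r1 := congrFun e1 j
        have r2 := e2 j hjk
        simp [Ne.symm hne] at r1 r2
        exact ne_co _ (r2.symm.trans r1)
      subst hj
      refine t1 (Tw_of (j := j2) d1 ?_)
      intro i hi
      have r1 := congrFun e1 i
      simpa [hi] using r1
    · exact nz' _ g.e (by simp [Ne.symm g.jk]; exact a2k)
  by_cases hz' : a3 k = co (a1 k)
  · rcases M7 hC hT h7 c1 c3 n1 n3 hz' with ⟨v, g⟩ | ⟨j2, v, η, g⟩ | ⟨j2, v, η, g⟩
    · exact t1 (Tw_symm.1 (Tw_updk g.tw))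
    · have e1 := onlyz _ g.e (by simp [Ne.symm g.jk])
      have hj : j2 = j := by
        by_contra hne
        have r1 := congrFun e1 j2
        simp [hne] at r1
        exact g.x2 ((co_sw _ _).1 r1)
      subst hj
      have r1 := congrFun e1 j2
      simp at r1
      have := co_inj _ _ r1
      subst this
      rw [g.a2e, h.a2e] at d2
      exact D_irr _ d2
    · exact nz' _ g.e (by simp [Ne.symm g.jk]; exact hz')
  have nz : N C a3 k (a1 k) = ∅ := by
    by_contra hne
    obtain ⟨w, hw⟩ := PAT1 hC c3 (u := a1 k) (Ne.symm hz) (Finset.nonempty_iff_ne_empty.2 hne)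
    exact nz' w (N_sub hw) (mem_N.1 hw).2.2
  have hM : ∀ w ∈ M C a3, w = upd (upd a1 j ξ) k u ∨ w ∈ K C k (co u) := by
    intro w hw
    rcases XO_kz h (M_sub hw) with q | q | q
    · exfalso
      have : w ∈ N C a3 k (a1 k) := mem_N.2 ⟨M_sub hw, (mem_M.1 hw).2, q.1⟩
      rw [nz] at this; simp at this
    · exact Or.inl q.2
    · exact Or.inr q.2
  have m3 := L1M hC hT c3 n3
  by_cases hu : a3 k = u
  · have : (M C a3).card ≤ 1 := by
      apply Finset.card_le_one.2
      have key : ∀ w ∈ M C a3, w = upd (upd a1 j ξ) k u := by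
        intro w hw
        rcases hM w hw with q | q
        · exact q
        · exact absurd ⟨k, by rw [(mem_K.1 q).2, hu]⟩ (mem_M.1 hw).2
      intro c hc d hd; rw [key c hc, key d hd]
    omega
  by_cases hu' : a3 k = co u
  · refine M5 (hC.mono K_sub) (hT.mono K_sub) h.five.le ?_ h.cov (fun x => n3 (K_sub x)) ?_ ?_ (a1 := a3)
    · refine (Cov_M c3).mono ?_
      intro w hw
      rcases hM w hw with q | q
      · exact absurd ⟨k, by rw [q, hu']; simp [co_co]⟩ (mem_M.1 hw).2
      · exact q
    · intro x
      have := twin_upd (c := upd (upd a1 j ξ) k u) (k := k) (u := u) (by simp)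
      rw [Function.update_idem] at this
      exact hT _ h.c _ (K_sub x) this
    · obtain ⟨i, hi⟩ := d2
      rw [h.a2e] at hi
      by_cases hik : i = k
      · subst hik; simp [hu', co_co] at hi; exact absurd hi (by intro e; exact cu.1 e)
      · exact ⟨i, by rw [hi]; simp [hik]⟩
  · have hpat : ∀ w ∈ M C a3, w k = u ∨ w k = co u := by
      intro w hw
      rcases hM w hw with q | q
      · left; rw [q]; simp
      · right; exact (mem_K.1 q).2
    have hNu : ∀ w ∈ N C a3 k u, w = upd (upd a1 j ξ) k u := by
      intro w hw
      rcases hM w (N_sub_M hw) with q | q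
      · exact q
      · exfalso; exact ne_co u ((mem_N.1 hw).2.2.symm.trans (mem_K.1 q).2)
    have hcard : (N C a3 k u).card ≤ 1 := by
      apply Finset.card_le_one.2
      intro c hc d hd; rw [hNu c hc, hNu d hd]
    have uu2 : u ≠ co (a3 k) := fun e => hu' (by rw [e, co_co])
    have hne : (N C a3 k u).Nonempty := by
      obtain ⟨w, hw⟩ := Finset.card_pos.1 (show 0 < (M C a3).card by omega)
      rcases hpat w hw with e | e
      · exact ⟨w, mem_N.2 ⟨(mem_M.1 hw).1, (mem_M.1 hw).2, e⟩⟩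
      · have := PAT1 (u := co u) hC c3 (Ne.symm hu') ⟨w, mem_N.2 ⟨(mem_M.1 hw).1, (mem_M.1 hw).2, e⟩⟩
        rwa [co_co] at this
    obtain ⟨w, hw⟩ := hne
    have e1 := PAT3L hC c3 uu2 hpat (hT.mono N_sub) (by omega) w hw
    have e2 := hNu w hw
    obtain ⟨i, hi⟩ := d2
    rw [h.a2e] at hi
    by_cases hik : i = k
    · subst hik; simp [co_co] at hi; exact hz hi
    · have := congrFun (e1.symm.trans e2) i
      simp only [Function.update_of_ne hik] at this hi
      rw [this] at hi; exact ne_co _ hi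
theorem M7two (hA : Code A) (hAT : TF A) (hC : Code C) (hT : TF C)
    (h7 : C.card ≤ 7) (hcov : ∀ a ∈ A, Cov C a) (hn : ∀ a ∈ A, a ∉ C) (h1 : a1 ∈ A) (h2 : a2 ∈ A) (hne : a1 ≠ a2) :
    ∃ k j u ξ, XO C k a1 a2 j u ξ ∨ XO C k a2 a1 j u ξ := by
  obtain ⟨k, hk⟩ := hA a2 h2 a1 h1 (Ne.symm hne)
  rcases M7 hC hT h7 (hcov _ h1) (hcov _ h2) (hn _ h1) (hn _ h2) hk with ⟨v, g⟩ | ⟨j2, v, η, g⟩ | ⟨j2, v, η, g⟩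
  · exact absurd (Tw_updk g.tw) (hAT _ h1 _ h2)
  · exact ⟨k, j2, v, η, Or.inl g⟩
  · exact ⟨k, j2, v, η, Or.inr g⟩
theorem M7three (hA : Code A) (hAT : TF A) (hC : Code C) (hT : TF C)
    (h7 : C.card ≤ 7) (hcov : ∀ a ∈ A, Cov C a) (hn : ∀ a ∈ A, a ∉ C) : A.card ≤ 2 := by
  by_contra hlt
  obtain ⟨a1, h1, a2, h2, a3, h3, h12, h13, h23⟩ := Finset.two_lt_card.1 (show 2 < A.card by omega)
  obtain ⟨k, j, u, ξ, g | g⟩ := M7two hA hAT hC hT h7 hcov hn h1 h2 h12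
  · exact M7aux hC hT h7 g (hcov _ h1) (hcov _ h2) (hcov _ h3) (hn _ h1) (hn _ h2) (hn _ h3) (hA _ h3 _ h1 (Ne.symm h13))
      (hA _ h3 _ h2 (Ne.symm h23)) (hAT _ h3 _ h1) (hAT _ h3 _ h2)
  · exact M7aux hC hT h7 g (hcov _ h2) (hcov _ h1) (hcov _ h3) (hn _ h2) (hn _ h1) (hn _ h3) (hA _ h3 _ h2 (Ne.symm h23))
      (hA _ h3 _ h1 (Ne.symm h13)) (hAT _ h3 _ h2) (hAT _ h3 _ h1)
/-- summary of the covering bounds -/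
theorem CovB (hA : Code A) (hAT : TF A) (hC : Code C) (hT : TF C)
    (hcov : ∀ a ∈ A, Cov C a) (hn : ∀ a ∈ A, a ∉ C) :
    (1 ≤ A.card → 5 ≤ C.card) ∧ (2 ≤ A.card → 7 ≤ C.card) ∧ (3 ≤ A.card → 8 ≤ C.card) := by
  refine ⟨?_, ?_, ?_⟩
  · intro h
    obtain ⟨a, ha⟩ := Finset.card_pos.1 h
    exact L1C hC hT (hcov a ha) (hn a ha)
  · intro h
    by_contra h6
    obtain ⟨a1, h1, a2, h2, h12⟩ := Finset.one_lt_card.1 (show 1 < A.card by omega)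
    obtain ⟨k, j, u, ξ, g | g⟩ := M7two hA hAT hC hT (by omega) hcov hn h1 h2 h12
    · have := g.seven; omega
    · have := g.seven; omega
  · intro h
    by_contra h6
    have := M7three hA hAT hC hT (by omega) hcov hn
    omega
theorem FL {E : Finset Wrd} (hC : Code E) (hT : TF E) (h5 : E.card = 5)
    (ho : Cov E o) (hn : o ∉ E) (hx : ∀ x, (∃ e ∈ E, In e x) → ¬ In o x → inn κ (x k)) : (∀ e ∈ E, e k = κ) ∧ o k = κ := by
  have hm := L1M hC hT ho hn
  have hle : (M E o).card ≤ _ := Finset.card_le_card M_sub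
  have hM5 : (M E o).card = 5 := by omega
  have hM : M E o = E := Finset.eq_of_subset_of_card_le M_sub (by omega)
  have all : ∀ e ∈ E, e k = κ := by
    intro e he
    by_contra hne
    have heM : e ∈ M E o := by rw [hM]; exact he
    by_cases hd : ∃ i, i ≠ k ∧ e i ≠ o i
    · obtain ⟨i, hik, hi⟩ := hd
      obtain ⟨p, p1, p2⟩ := inn_ex2n _ _ hi
      obtain ⟨q, q1, q2⟩ := inn_ex2n _ _ hne
      obtain ⟨x, hx1⟩ := In_ex e
      have hq := hx (upd (upd x i p) k q) ⟨e, he, ?_⟩ ?_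
      · rw [Function.update_self] at hq; exact q2 hq
      · intro j
        by_cases j1 : j = k
        · subst j1; simpa using q1
        by_cases j2 : j = i
        · subst j2; simpa [j1] using p1
        simpa [j1, j2] using hx1 j
      · intro h
        have := h i
        simp [hik] at this; exact p2 this
    · push Not at hd
      have e1 : e k ≠ o k := by
        intro e1
        have : e = o := by
          funext i; by_cases hi : i = k
          · rw [hi, e1]
          · exact hd i hi
        exact hn (this ▸ he)
      have e2 : e k ≠ co (o k) := by
        intro e2; exact (mem_M.1 heM).2 ⟨k, e2⟩
      obtain ⟨_, s2, _, _⟩ := S5pat hC hT ho e1 e2 ⟨e, mem_N.2 ⟨he, (mem_M.1 heM).2, rfl⟩⟩ hM5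
      obtain ⟨f, hf, hfe⟩ := Finset.exists_mem_ne (show 1 < (N E o k (e k)).card by omega) e
      have hf' := mem_N.1 hf
      obtain ⟨i, hi⟩ := hC f hf'.1 e he hfe
      by_cases hik : i = k
      · subst hik; rw [hf'.2.2] at hi; exact ne_co _ hi
      · rw [hd i hik] at hi; exact hf'.2.1 ⟨i, hi⟩
  refine ⟨all, ?_⟩
  by_contra hne
  obtain ⟨e, he⟩ := Finset.card_pos.1 (show 0 < E.card by omega)
  have heM : e ∈ M E o := by rw [hM]; exact he
  have e1 : e k ≠ o k := by rw [all e he]; exact Ne.symm hne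
  have e2 : e k ≠ co (o k) := by
    intro e2; exact (mem_M.1 heM).2 ⟨k, e2⟩
  obtain ⟨s1, _, _, _⟩ := S5pat hC hT ho e1 e2 ⟨e, mem_N.2 ⟨he, (mem_M.1 heM).2, rfl⟩⟩ hM5
  obtain ⟨f, hf⟩ := Finset.card_pos.1 (show 0 < (N E o k (o k)).card by omega)
  have hf' := mem_N.1 hf
  exact hne (by rw [← hf'.2.2]; exact all f hf'.1)
def Eqv (V W : Finset Wrd) : Prop := ∀ x, (∃ v ∈ V, In v x) ↔ (∃ w ∈ W, In w x)
theorem Eqv.symm (h : Eqv V W) : Eqv W V := fun x => (h x).symm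
theorem Eqv.cov (h : Eqv V W) {w} (hw : w ∈ W) : Cov V w := fun x hx => (h x).2 ⟨w, hw, hx⟩
def F (X : Finset Wrd) (x : ι → Fin 8) : ℕ := (X.filter (fun v => In v x)).card
theorem F_le (h : Code X) (x) : F X x ≤ 1 := by
  apply Finset.card_le_one.2
  intro a ha b hb
  rw [Finset.mem_filter] at ha hb
  exact code_eq h ha.1 hb.1 ha.2 hb.2
theorem F_pos {x} : 1 ≤ F X x ↔ ∃ v ∈ X, In v x := by
  unfold F; rw [Nat.one_le_iff_ne_zero, ← Nat.pos_iff_ne_zero, Finset.card_pos]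
  constructor
  · rintro ⟨v, hv⟩; rw [Finset.mem_filter] at hv; exact ⟨v, hv⟩
  · rintro ⟨v, hv⟩; exact ⟨v, by rw [Finset.mem_filter]; exact hv⟩
theorem F_empty {x : ι → Fin 8} : F ∅ x = 0 := by simp [F]
theorem F_sing {x} (h : In a x) : F {a} x = 1 := by
  unfold F; rw [Finset.filter_singleton]; simp [h]
theorem F_eqv (hV : Code V) (hW : Code W) (h : Eqv V W) (x) : F V x = F W x := by
  have h1 := F_le hV x; have h2 := F_le hW x
  have := h x
  rw [← F_pos, ← F_pos] at this
  omega
theorem eqv_F (h : ∀ x, F V x = F W x) : Eqv V W := by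
  intro x; rw [← F_pos, ← F_pos, h x]
theorem sum_F (X : Finset Wrd) : ∑ x, F X x = X.card * 4 ^ Fintype.card ι := by
  unfold F
  simp_rw [Finset.card_filter]
  rw [Finset.sum_comm]
  rw [Finset.sum_congr rfl (g := fun _ => 4 ^ Fintype.card ι)]
  · simp
  · intro v _
    rw [← card_In v, Finset.card_filter]
theorem card_F2 {A B A' B' : Finset Wrd} (h : ∀ x, F A x + F B x = F A' x + F B' x) :
    A.card + B.card = A'.card + B'.card := by
  have := Finset.sum_congr (rfl : (Finset.univ : Finset (ι → Fin 8)) = Finset.univ) (fun x _ => h x)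
  simp only [Finset.sum_add_distrib, sum_F] at this
  have p : 0 < 4 ^ Fintype.card ι := by positivity
  rw [← add_mul, ← add_mul] at this
  exact Nat.eq_of_mul_eq_mul_right p this
theorem card_F1 {A B : Finset Wrd} (h : ∀ x, F A x = F B x) : A.card = B.card := by
  have := card_F2 (A := A) (B := ∅) (A' := B) (B' := ∅) (by intro x; rw [h x])
  simpa using this
theorem card_F3 {A B E A' B' E' : Finset Wrd} (h : ∀ x, F A x + F B x + F E x = F A' x + F B' x + F E' x) :
    A.card + B.card + E.card = A'.card + B'.card + E'.card := by
  have := Finset.sum_congr (rfl : (Finset.univ : Finset (ι → Fin 8)) = Finset.univ) (fun x _ => h x)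
  simp only [Finset.sum_add_distrib, sum_F] at this
  have p : 0 < 4 ^ Fintype.card ι := by positivity
  simp only [← add_mul] at this
  exact Nat.eq_of_mul_eq_mul_right p this
/-- slice -/
def Sl (X : Finset Wrd) (k : ι) (l s : Fin 6) : Finset Wrd := (K X k s).image (fun v => upd v k l)
theorem mem_Sl {k l s w} : w ∈ Sl X k l s ↔ w k = l ∧ upd w k s ∈ X := by
  unfold Sl; rw [Finset.mem_image]
  constructor
  · rintro ⟨v, hv, rfl⟩
    rw [mem_K] at hv
    refine ⟨by simp, ?_⟩
    rw [Function.update_idem, ← hv.2, Function.update_eq_self]; exact hv.1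
  · rintro ⟨h1, h2⟩
    exact ⟨_, mem_K.2 ⟨h2, by simp⟩, by rw [Function.update_idem, ← h1, Function.update_eq_self]⟩
theorem Sl_mem {k l v} (h : v ∈ X) : upd v k l ∈ Sl X k l (v k) := by
  rw [mem_Sl]; simp [h]
theorem Sl_card (X : Finset Wrd) (k l s) : (Sl X k l s).card = (K X k s).card := by
  unfold Sl
  apply Finset.card_image_of_injOn
  intro v hv w hw h
  have hv := (mem_K.1 hv).2; have hw := (mem_K.1 hw).2
  funext i
  by_cases hi : i = k
  · rw [hi, hv, hw]
  · have := congrFun h i; simpa [hi] using this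
attribute [irreducible] Sl
theorem Sl_code {k l s} (h : Code X) : Code (Sl X k l s) := by
  intro v hv w hw hne
  rw [mem_Sl] at hv hw
  have : upd v k s ≠ upd w k s := by
    intro e; apply hne; funext i
    by_cases hi : i = k
    · rw [hi, hv.1, hw.1]
    · have := congrFun e i; simpa [hi] using this
  obtain ⟨j, hj⟩ := h _ hv.2 _ hw.2 this
  by_cases hjk : j = k
  · subst hjk; simp at hj; exact absurd hj (ne_co _)
  · exact ⟨j, by simpa [hjk] using hj⟩
theorem Sl_TF {k l s} (h : TF X) : TF (Sl X k l s) := by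
  rintro v hv w hw ⟨j, hj, hj'⟩
  rw [mem_Sl] at hv hw
  have hjk : j ≠ k := by rintro rfl; rw [hv.1, hw.1] at hj; exact ne_co _ hj
  refine h _ hv.2 _ hw.2 ⟨j, by simpa [hjk] using hj, ?_⟩
  intro i hi
  by_cases hik : i = k
  · subst hik; simp
  · simpa [hik] using hj' i hi
theorem Sl_disj {k l s} (h : Disjoint X Y) : Disjoint (Sl X k l s) (Sl Y k l s) := by
  rw [Finset.disjoint_left] at h ⊢
  intro v hv hw
  exact h (mem_Sl.1 hv).2 (mem_Sl.1 hw).2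
theorem Sl_disj_co {k l s} (h : TF X) : Disjoint (Sl X k l s) (Sl X k l (co s)) := by
  rw [Finset.disjoint_left]
  intro v hv hw
  have := twin_upd (c := upd v k s) (k := k) (u := s) (by simp)
  rw [Function.update_idem] at this
  exact h _ (mem_Sl.1 hv).2 _ (mem_Sl.1 hw).2 this
theorem F_Sl_upd {k l s x p} (hl : inn l (x k)) (hs : inn s p) :
    F (Sl X k l s) x = ((K X k s).filter (fun v => In v (upd x k p))).card := by
  unfold F
  symm
  apply Finset.card_bij (fun v _ => upd v k l)
  · intro v hv
    rw [Finset.mem_filter, mem_K, In_updx] at hv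
    rw [Finset.mem_filter, In_upd]
    refine ⟨by rw [← hv.1.2]; exact Sl_mem hv.1.1, hl, hv.2.2⟩
  · intro v hv w hw e
    rw [Finset.mem_filter, mem_K] at hv hw
    funext i
    by_cases hi : i = k
    · rw [hi, hv.1.2, hw.1.2]
    · have := congrFun e i; simpa [hi] using this
  · intro w hw
    rw [Finset.mem_filter, mem_Sl] at hw
    refine ⟨upd w k s, ?_, by rw [Function.update_idem, ← hw.1.1, Function.update_eq_self]⟩
    rw [Finset.mem_filter, mem_K, In_updx]
    refine ⟨⟨hw.1.2, by simp⟩, by simpa using hs, ?_⟩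
    intro j hj; simpa [hj] using hw.2 j
theorem F_Sl_zero {k l s x} (hl : ¬ inn l (x k)) : F (Sl X k l s) x = 0 := by
  unfold F; rw [Finset.card_eq_zero, Finset.filter_eq_empty_iff]
  intro v hv hi
  have := hi k
  rw [(mem_Sl.1 hv).1] at this; exact hl this
theorem inn_three : ∀ z u t : Fin 6, u ≠ z → u ≠ co z → t ≠ z → t ≠ co z → t ≠ u → t ≠ co u →
    ∃ p, inn z p ∧ inn u p ∧ inn t p := by decide +kernel
theorem Fsum (hV : Code V) (hW : Code W) (h : Eqv V W) (k : ι) (l : Fin 6)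
    (h1 : u ≠ z) (h2 : u ≠ co z) (h3 : t ≠ z) (h4 : t ≠ co z) (h5 : t ≠ u) (h6 : t ≠ co u) (x) :
    F (Sl V k l z) x + F (Sl V k l u) x + F (Sl V k l t) x = F (Sl W k l z) x + F (Sl W k l u) x + F (Sl W k l t) x := by
  by_cases hl : inn l (x k)
  swap
  · simp [F_Sl_zero hl]
  obtain ⟨p, p1, p2, p3⟩ := inn_three z u t h1 h2 h3 h4 h5 h6
  have gen : ∀ X : Finset Wrd, F (Sl X k l z) x + F (Sl X k l u) x + F (Sl X k l t) x = F X (upd x k p) := by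
    intro X
    rw [F_Sl_upd hl p1, F_Sl_upd hl p2, F_Sl_upd hl p3]
    have e := cardK (X.filter (fun v => In v (upd x k p))) k h1 h2 h3 h4 h5 h6
    have f : ∀ s, K (X.filter (fun v => In v (upd x k p))) k s = (K X k s).filter (fun v => In v (upd x k p)) := by
      intro s; ext v; simp only [mem_K, Finset.mem_filter]; tauto
    have g : ∀ s, inn s p → ((K X k (co s)).filter (fun v => In v (upd x k p))).card = 0 := by
      intro s hs
      rw [Finset.card_eq_zero, Finset.filter_eq_empty_iff]
      intro v hv hi
      rw [In_updx, (mem_K.1 hv).2] at hi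
      exact (inn_co _ _).1 hi.1 hs
    simp only [f] at e
    rw [g _ p1, g _ p2, g _ p3] at e
    unfold F; omega
  rw [gen, gen, F_eqv hV hW h]
theorem Fdiff (hV : Code V) (hW : Code W) (h : Eqv V W) (k : ι) (l z : Fin 6) (x) :
    F (Sl V k l z) x + F (Sl W k l (co z)) x = F (Sl V k l (co z)) x + F (Sl W k l z) x := by
  obtain ⟨u, t, h1, h2, h3, h4, h5, h6⟩ := ex_pair z
  have e1 := Fsum hV hW h k l h1 h2 h3 h4 h5 h6 x
  have e2 := Fsum hV hW h k l (z := co z) (u := u) (t := t) h2 (by rw [co_co]; exact h1) h4 (by rw [co_co]; exact h3) h5 h6 x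
  omega
theorem Ksum (hV : Code V) (hW : Code W) (h : Eqv V W) (k : ι)
    (h1 : u ≠ z) (h2 : u ≠ co z) (h3 : t ≠ z) (h4 : t ≠ co z) (h5 : t ≠ u) (h6 : t ≠ co u) :
    (K V k z).card + (K V k u).card + (K V k t).card = (K W k z).card + (K W k u).card + (K W k t).card := by
  have := card_F3 (Fsum hV hW h k z h1 h2 h3 h4 h5 h6)
  simpa only [Sl_card] using this
theorem Kdiff (hV : Code V) (hW : Code W) (h : Eqv V W) (k : ι) (z : Fin 6) :
    (K V k z).card + (K W k (co z)).card = (K V k (co z)).card + (K W k z).card := by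
  have := card_F2 (Fdiff hV hW h k z z)
  simpa only [Sl_card] using this
theorem Eq7 (hX : Code X) (hXT : TF X) (hY : Code Y) (hYT : TF Y) (hd : Disjoint X Y) (he : Eqv X Y)
    (h7 : X.card ≤ 7) : X.card = 0 ∧ Y.card = 0 := by
  have e := card_F1 (F_eqv hX hY he)
  have := CovB hY hYT hX hXT (fun a ha => he.cov ha) (fun a ha => Finset.disjoint_right.1 hd ha)
  omega
/-- if one pair is missing from V then the other code has equivalent slices -/
theorem pair0 (hV : Code V) (hW : Code W) (hWT : TF W) (h : Eqv V W)
    (h1 : (K V k s).card = 0) (h2 : (K V k (co s)).card = 0) (h7 : (K W k s).card ≤ 7) :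
    (K W k s).card = 0 ∧ (K W k (co s)).card = 0 := by
  have e : ∀ x, F (Sl W k s s) x = F (Sl W k s (co s)) x := by
    intro x
    have := Fdiff hV hW h k s s x
    have z1 : Sl V k s s = ∅ := by rw [← Finset.card_eq_zero, Sl_card]; exact h1
    have z2 : Sl V k s (co s) = ∅ := by rw [← Finset.card_eq_zero, Sl_card]; exact h2
    rw [z1, z2, F_empty] at this; omega
  have := Eq7 (Sl_code hW) (Sl_TF hWT) (Sl_code hW) (Sl_TF hWT) (Sl_disj_co hWT) (eqv_F e) (by rw [Sl_card]; exact h7)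
  simpa only [Sl_card] using this
theorem Cov_Sl {k l s v} (h : Cov (K X k s) (upd v k s)) : Cov (Sl X k l s) (upd v k l) := by
  intro x hx
  rw [In_upd] at hx
  obtain ⟨p, hp⟩ := inn_ex s
  obtain ⟨c, hc, hcx⟩ := h (upd x k p) (by rw [In_updx]; exact ⟨by simpa using hp, by intro j hj; simpa [hj] using hx.2 j hj⟩)
  rw [In_updx] at hcx
  refine ⟨upd c k l, by rw [← (mem_K.1 hc).2]; exact Sl_mem (K_sub hc), ?_⟩
  rw [In_upd]; exact ⟨hx.1, hcx.2⟩
theorem card_rest :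
    V.card = (K V k κ).card + (V.filter (fun v => v k ≠ κ)).card := by
  have : K V k κ = V.filter (fun v => v k = κ) := by ext v; simp [mem_K]
  rw [this]
  exact (Finset.card_filter_add_card_filter_not (s := V) (fun v => v k = κ)).symm
theorem card_NuNu' (hC : Code C) (hT : TF C)
    (ha : Cov C a) (h2 : u ≠ co (a k)) (h : ∀ c ∈ M C a, c k = u ∨ c k = co u) :
    (N C a k u).card ≤ 1 ∨ 5 ≤ (N C a k u).card := by
  by_cases h5 : (N C a k u).card < 5
  · left
    have := PAT3L hC ha h2 h (hT.mono N_sub) h5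
    apply Finset.card_le_one.2
    intro c hc d hd; rw [this c hc, this d hd]
  · right; omega
/-- the (1, at least 5) situation in R5 -/
theorem R5one (hV : Code V) (hVT : TF V) (hW : Code W) (hWT : TF W)
    (hd : Disjoint V W) (he : Eqv V W) {κ b c : Fin 6}
    (b1 : b ≠ κ) (b2 : b ≠ co κ)
    (h0 : ∀ v ∈ K V k (co κ), ∀ w ∈ M W v, w k = b ∨ w k = co b)
    (k1 : 1 ≤ (K V k (co κ)).card)
    (e1 : (K W k b).card = (K V k (co κ)).card) (e2 : (K W k (co b)).card = 5) (e3 : (K V k b).card = 0)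
    (e4 : (K V k (co b)).card + (K V k (co κ)).card = 5) (e5 : (K V k (co κ)).card ≤ 4) : False := by
  have cb := co_conj b1 b2
  have key : ∀ v ∈ K V k (co κ), upd v k b ∈ W ∧ Cov (K W k (co b)) (upd v k (co b)) := by
    intro v hv
    have hvV := (mem_K.1 hv).1
    have hvk := (mem_K.1 hv).2
    have cv : Cov W v := he.symm.cov hvV
    have nv : v ∉ W := Finset.disjoint_left.1 hd hvV
    have le1 : (N W v k b).card ≤ _ := N_le_K
    have le2 : (N W v k (co b)).card ≤ _ := N_le_K
    have q1 : b ≠ v k := by rw [hvk]; exact b2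
    have q2 : b ≠ co (v k) := by rw [hvk, co_co]; exact b1
    have hp := h0 v hv
    have m5 := L1M hW hWT cv nv
    obtain ⟨t, ht⟩ := third' (v k) b q1 q2
    have cM := cardM W v k q1 q2 ht.1 ht.2.1 ht.2.2.1 ht.2.2.2
    have l := LR hW hWT cv q1 q2
    have z := card_NuNu' hW hWT cv q2 hp
    have zz : ∀ s, s ≠ b → s ≠ co b → (N W v k s).card = 0 := by
      intro s s1 s2
      rw [Finset.card_eq_zero, Finset.eq_empty_iff_forall_notMem]
      intro w hw
      rcases hp w (N_sub_M hw) with e | e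
      · exact s1 ((mem_N.1 hw).2.2.symm.trans e)
      · exact s2 ((mem_N.1 hw).2.2.symm.trans e)
    have z1 := zz t ht.2.2.1 ht.2.2.2
    have z2 := zz (co t) (fun e => ht.2.2.2 ((co_sw _ _).1 e)) (fun e => ht.2.2.1 (co_inj _ _ e))
    have z3 := zz (v k) (Ne.symm q1) (fun e => q2 (by rw [e, co_co]))
    have hone : (N W v k b).card = 1 := by omega
    have hlt : (N W v k b).card < 5 := by omega
    obtain ⟨w, hw⟩ := Finset.card_eq_one.1 hone
    have hwN : w ∈ N W v k b := by rw [hw]; simp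
    have := PAT3L hW cv q2 hp (hWT.mono N_sub) hlt w hwN
    refine ⟨this ▸ N_sub hwN, ?_⟩
    refine (PAT3 cv (u := co b) (co_conj q1 q2).2 ?_).mono N_sub_K
    intro c hc; rw [co_co]; exact (hp c hc).symm
  have nin : ∀ v ∈ K V k (co κ), upd v k (co b) ∉ K W k (co b) := by
    intro v hv h
    have := twin_upd (c := upd v k b) (k := k) (u := b) (by simp)
    rw [Function.update_idem] at this
    exact hWT _ (key v hv).1 _ (K_sub h) this
  by_cases h2 : 2 ≤ (K V k (co κ)).card
  · obtain ⟨v1, h1, v2, h2, h12⟩ := Finset.one_lt_card.1 (show 1 < (K V k (co κ)).card by omega)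
    refine M5 (hW.mono K_sub) (hWT.mono K_sub) e2.le (key v1 h1).2 (key v2 h2).2 (nin v1 h1) (nin v2 h2) ?_
    obtain ⟨i, hi⟩ := hV v1 (K_sub h1) v2 (K_sub h2) h12
    have hik : i ≠ k := by
      rintro rfl; rw [(mem_K.1 h1).2, (mem_K.1 h2).2] at hi; exact ne_co _ hi
    exact ⟨i, by simpa [hik] using hi⟩
  · obtain ⟨v, hv⟩ := Finset.card_pos.1 k1
    obtain ⟨a, ha⟩ := Finset.card_pos.1 (show 0 < (K V k (co b)).card by omega)
    have e0 : Sl V k κ b = ∅ := by rw [← Finset.card_eq_zero, Sl_card]; exact e3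
    have hb : Sl W k κ b = {upd v k κ} := by
      symm; apply Finset.eq_of_subset_of_card_le
      · intro w hw; rw [Finset.mem_singleton] at hw; subst hw
        rw [mem_Sl]; simp [(key v hv).1]
      · rw [Sl_card]; simp; omega
    have Fd := Fdiff hV hW he k κ b
    rw [e0, hb] at Fd
    have a' : upd a k κ ∈ Sl V k κ (co b) := by rw [← (mem_K.1 ha).2]; exact Sl_mem (K_sub ha)
    refine M5 (C := Sl W k κ (co b)) (a1 := upd a k κ) (a2 := upd v k κ) (Sl_code hW) (Sl_TF hWT) (by rw [Sl_card]; exact e2.le) ?_ ?_ ?_ ?_ ?_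
    · intro x hx
      have := Fd x
      have p : 1 ≤ F (Sl V k κ (co b)) x := F_pos.2 ⟨_, a', hx⟩
      rw [F_empty] at this
      exact F_pos.1 (by omega)
    · exact Cov_Sl (key v hv).2
    · exact Finset.disjoint_left.1 (Sl_disj hd) a'
    · have : upd v k κ ∈ Sl W k κ b := by rw [hb]; simp
      exact Finset.disjoint_left.1 (Sl_disj_co hWT) this
    · by_contra hD
      obtain ⟨x, x1, x2⟩ := ex_of_notD hD
      have := Fd x
      have p : 1 ≤ F (Sl V k κ (co b)) x := F_pos.2 ⟨_, a', x1⟩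
      have p2 := F_le (Sl_code hW (k := k) (l := κ) (s := co b)) x
      rw [F_empty, F_sing x2] at this
      omega
theorem R5ar1 (ρ k vb vb' vc vc' wb wb' wc wc' : ℕ) (h1 : k + vb + vb' + vc + vc' = ρ) (h2 : wb + wb' + wc + wc' = ρ + k)
    (h3 : vb + wb' = vb' + wb) (h5 : ρ ≤ 5) (hk : 1 ≤ k) (hb : 5 ≤ wb') (hb1 : 1 ≤ wb)
    (pb : vb = 0 → vb' = 0 → wb ≤ 7 → wb = 0 ∧ wb' = 0) :
    wb = k ∧ wb' = 5 ∧ vb = 0 ∧ vb' + k = 5 ∧ k ≤ 4 ∧ wc = 0 ∧ wc' = 0 := by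
  have a1 : wb' = 5 := by clear pb; omega
  have a2 : vb = 0 := by clear pb; omega
  have a3 : wb = k := by clear pb; omega
  have a4 : k ≤ 4 := by
    by_contra h
    have := pb a2 (by clear pb; omega) (by clear pb; omega)
    clear pb; omega
  clear pb; omega
theorem R5ar2 (ρ k vb vb' vc vc' wb wb' wc wc' : ℕ) (h1 : k + vb + vb' + vc + vc' = ρ) (h2 : wb + wb' + wc + wc' = ρ + k)
    (h3 : vb + wb' = vb' + wb) (h4 : vc + wc' = vc' + wc) (h5 : ρ ≤ 5) (b1 : 2 ≤ wb) (b2 : 2 ≤ wb') (c1 : 2 ≤ wc) (c2 : 2 ≤ wc')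
    (pb : vb = 0 → vb' = 0 → wb ≤ 7 → wb = 0 ∧ wb' = 0) (pc : vc = 0 → vc' = 0 → wc ≤ 7 → wc = 0 ∧ wc' = 0) : False := by
  have a1 : vb ≠ 0 ∨ vb' ≠ 0 := by
    by_contra h
    push Not at h
    have := pb h.1 h.2 (by clear pb pc; omega)
    clear pb pc; omega
  have a2 : vc ≠ 0 ∨ vc' ≠ 0 := by
    by_contra h
    push Not at h
    have := pc h.1 h.2 (by clear pb pc; omega)
    clear pb pc; omega
  clear pb pc
  omega
theorem R5ar3 (ρ k vb vb' vc vc' wb wb' wc wc' nb nb' nc nc' : ℕ) (s1 : k + vb + vb' + vc + vc' = ρ) (s2 : wb + wb' + wc + wc' = ρ + k)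
    (db : vb + wb' = vb' + wb) (dc : vc + wc' = vc' + wc) (r5 : ρ ≤ 5) (k1 : 1 ≤ k)
    (pb : vb = 0 → vb' = 0 → wb ≤ 7 → wb = 0 ∧ wb' = 0) (pc : vc = 0 → vc' = 0 → wc ≤ 7 → wc = 0 ∧ wc' = 0)
    (le1 : nb ≤ wb) (le2 : nb' ≤ wb') (le3 : nc ≤ wc) (le4 : nc' ≤ wc')
    (lb : (nb = 0 ∧ nb' = 0) ∨ (2 ≤ nb ∧ 2 ≤ nb') ∨ (nb = 1 ∧ 5 ≤ nb') ∨ (5 ≤ nb ∧ nb' = 1))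
    (lc : (nc = 0 ∧ nc' = 0) ∨ (2 ≤ nc ∧ 2 ≤ nc') ∨ (nc = 1 ∧ 5 ≤ nc') ∨ (5 ≤ nc ∧ nc' = 1))
    (m5 : 5 ≤ nb + nb' + nc + nc')
    (only1 : nc = 0 → nc' = 0 → (nb ≤ 1 ∨ 5 ≤ nb) ∧ (nb' ≤ 1 ∨ 5 ≤ nb'))
    (only2 : nb = 0 → nb' = 0 → (nc ≤ 1 ∨ 5 ≤ nc) ∧ (nc' ≤ 1 ∨ 5 ≤ nc')) :
    (wb = k ∧ wb' = 5 ∧ vb = 0 ∧ vb' + k = 5 ∧ k ≤ 4 ∧ wc = 0 ∧ wc' = 0) ∨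
    (wb' = k ∧ wb = 5 ∧ vb' = 0 ∧ vb + k = 5 ∧ k ≤ 4 ∧ wc = 0 ∧ wc' = 0) ∨
    (wc = k ∧ wc' = 5 ∧ vc = 0 ∧ vc' + k = 5 ∧ k ≤ 4 ∧ wb = 0 ∧ wb' = 0) ∨
    (wc' = k ∧ wc = 5 ∧ vc' = 0 ∧ vc + k = 5 ∧ k ≤ 4 ∧ wb = 0 ∧ wb' = 0) := by
  have gb : 1 ≤ wb → 5 ≤ wb' → _ := fun x y => R5ar1 ρ k vb vb' vc vc' wb wb' wc wc' s1 s2 db r5 k1 y x pb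
  have gb' : 5 ≤ wb → 1 ≤ wb' → _ := fun x y => R5ar1 ρ k vb' vb vc vc' wb' wb wc wc' (by omega) (by omega) (by omega) r5 k1 x y
    (fun e1 e2 e3 => (pb e2 e1 (by omega)).symm)
  have gc : 1 ≤ wc → 5 ≤ wc' → _ := fun x y => R5ar1 ρ k vc vc' vb vb' wc wc' wb wb' (by omega) (by omega) dc r5 k1 y x pc
  have gc' : 5 ≤ wc → 1 ≤ wc' → _ := fun x y => R5ar1 ρ k vc' vc vb vb' wc' wc wb wb' (by omega) (by omega) (by omega) r5 k1 x y
    (fun e1 e2 e3 => (pc e2 e1 (by omega)).symm)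
  rcases lb with ⟨l1, l2⟩ | ⟨l1, l2⟩ | ⟨l1, l2⟩ | ⟨l1, l2⟩
  · rcases lc with ⟨l3, l4⟩ | ⟨l3, l4⟩ | ⟨l3, l4⟩ | ⟨l3, l4⟩
    · omega
    · have := only2 l1 l2
      exact Or.inr (Or.inr (Or.inl (gc (by omega) (by omega))))
    · exact Or.inr (Or.inr (Or.inl (gc (by omega) (by omega))))
    · exact Or.inr (Or.inr (Or.inr (gc' (by omega) (by omega))))
  · rcases lc with ⟨l3, l4⟩ | ⟨l3, l4⟩ | ⟨l3, l4⟩ | ⟨l3, l4⟩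
    · have := only1 l3 l4
      exact Or.inl (gb (by omega) (by omega))
    · exact (R5ar2 ρ k vb vb' vc vc' wb wb' wc wc' s1 s2 db dc r5 (by omega) (by omega) (by omega) (by omega) pb pc).elim
    · exact Or.inr (Or.inr (Or.inl (gc (by omega) (by omega))))
    · exact Or.inr (Or.inr (Or.inr (gc' (by omega) (by omega))))
  · exact Or.inl (gb (by omega) (by omega))
  · exact Or.inr (Or.inl (gb' (by omega) (by omega)))
theorem pr6a {A B E F G H : Prop} (h : A ∨ B ∨ E ∨ F ∨ G ∨ H) : A ∨ B ∨ G ∨ H ∨ E ∨ F := by tauto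
theorem pr6b {A B E F G H : Prop} (h : A ∨ B ∨ E ∨ F ∨ G ∨ H) (a : ¬ A) (b : ¬ B) (g : ¬ G) (h' : ¬ H) : E ∨ F := by tauto
theorem R56 (hV : Code V) (hVT : TF V) (hW : Code W) (hWT : TF W)
    (hd : Disjoint V W) (he : Eqv V W) (k : ι) (κ : Fin 6)
    (r1 : 1 ≤ (V.filter (fun v => v k ≠ κ)).card) (r5 : (V.filter (fun v => v k ≠ κ)).card ≤ 5) :
    (V.filter (fun v => v k ≠ κ)).card = 5 ∧ ∃ w ∈ W, w k = co κ ∧ M V w = V.filter (fun v => v k ≠ κ) := by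
  by_cases hw : ∃ w ∈ W, w k = co κ
  · obtain ⟨w, hw, hwk⟩ := hw
    have m := L1M hV hVT (he.cov hw) (Finset.disjoint_right.1 hd hw)
    have hs : M V w ⊆ V.filter (fun v => v k ≠ κ) := by
      intro v hv
      rw [Finset.mem_filter]
      refine ⟨M_sub hv, ?_⟩
      intro e
      exact (mem_M.1 hv).2 ⟨k, by rw [e, hwk, co_co]⟩
    have := Finset.card_le_card hs
    exact ⟨by omega, w, hw, hwk, Finset.eq_of_subset_of_card_le hs (by omega)⟩
  exfalso
  push Not at hw
  have cr := card_rest (V := V) (k := k) (κ := κ)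
  set ρ := (V.filter (fun v => v k ≠ κ)).card
  obtain ⟨b, c, b1, b2, c1, c2, c3, c4⟩ := ex_pair κ
  have cb := co_conj b1 b2
  have cc := co_conj c1 c2
  have cV := cardK V k b1 b2 c1 c2 c3 c4
  have cW := cardK W k b1 b2 c1 c2 c3 c4
  have d0 := Kdiff hV hW he k κ
  have db := Kdiff hV hW he k b
  have dc := Kdiff hV hW he k c
  have hVW := card_F1 (F_eqv hV hW he)
  have W0 : (K W k (co κ)).card = 0 := by
    rw [Finset.card_eq_zero, Finset.eq_empty_iff_forall_notMem]
    intro w h; exact hw w (K_sub h) (mem_K.1 h).2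
  have pb := pair0 hV hW hWT he (k := k) (s := b)
  have pc := pair0 hV hW hWT he (k := k) (s := c)
  have hlet : ∀ w : Wrd, w k = κ ∨ w k = co κ ∨ w k = b ∨ w k = co b ∨ w k = c ∨ w k = co c := by
    intro w
    exact letters κ b c (Ne.symm b1) (fun e => b2 (by rw [e, co_co])) c1 c2 c3 c4 (w k)
  by_cases hK : (K V k (co κ)).card = 0
  · have B := CovB (A := W.filter (fun w => w k ≠ κ)) (C := V.filter (fun v => v k ≠ κ)) (hW.mono (Finset.filter_subset _ _))
      (hWT.mono (Finset.filter_subset _ _)) (hV.mono (Finset.filter_subset _ _)) (hVT.mono (Finset.filter_subset _ _)) ?_ ?_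
    · have cr2 := card_rest (V := W) (k := k) (κ := κ)
      clear hw hlet
      omega
    · intro w hwW
      rw [Finset.mem_filter] at hwW
      refine (Cov_M (he.cov hwW.1)).mono ?_
      intro v hv
      rw [Finset.mem_filter]
      refine ⟨M_sub hv, ?_⟩
      intro e
      obtain ⟨v2, hv2⟩ := PAT1 hV (he.cov hwW.1) (u := κ) (Ne.symm hwW.2) ⟨v, mem_N.2 ⟨M_sub hv, (mem_M.1 hv).2, e⟩⟩
      exact K_empty hK v2 (N_sub hv2) (mem_N.1 hv2).2.2
    · intro w hwW h
      exact Finset.disjoint_right.1 hd (Finset.mem_filter.1 hwW).1 (Finset.mem_filter.1 h).1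
  have hv : ∀ v ∈ K V k (co κ),
      ((K W k b).card = (K V k (co κ)).card ∧ (K W k (co b)).card = 5 ∧ (K V k b).card = 0 ∧
         (K V k (co b)).card + (K V k (co κ)).card = 5 ∧ (K V k (co κ)).card ≤ 4 ∧ (K W k c).card = 0 ∧ (K W k (co c)).card = 0) ∨
      ((K W k (co b)).card = (K V k (co κ)).card ∧ (K W k b).card = 5 ∧ (K V k (co b)).card = 0 ∧
         (K V k b).card + (K V k (co κ)).card = 5 ∧ (K V k (co κ)).card ≤ 4 ∧ (K W k c).card = 0 ∧ (K W k (co c)).card = 0) ∨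
      ((K W k c).card = (K V k (co κ)).card ∧ (K W k (co c)).card = 5 ∧ (K V k c).card = 0 ∧
         (K V k (co c)).card + (K V k (co κ)).card = 5 ∧ (K V k (co κ)).card ≤ 4 ∧ (K W k b).card = 0 ∧ (K W k (co b)).card = 0) ∨
      ((K W k (co c)).card = (K V k (co κ)).card ∧ (K W k c).card = 5 ∧ (K V k (co c)).card = 0 ∧
         (K V k c).card + (K V k (co κ)).card = 5 ∧ (K V k (co κ)).card ≤ 4 ∧ (K W k b).card = 0 ∧ (K W k (co b)).card = 0) := by
    intro v hv
    have hvV := (mem_K.1 hv).1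
    have hvk := (mem_K.1 hv).2
    have cv : Cov W v := he.symm.cov hvV
    have nv : v ∉ W := Finset.disjoint_left.1 hd hvV
    have le1 : (N W v k b).card ≤ _ := N_le_K
    have le2 : (N W v k (co b)).card ≤ _ := N_le_K
    have le3 : (N W v k c).card ≤ _ := N_le_K
    have le4 : (N W v k (co c)).card ≤ _ := N_le_K
    have le5 : (N W v k (co κ)).card ≤ _ := N_le_K
    have q1 : b ≠ v k := by rw [hvk]; exact b2
    have q2 : b ≠ co (v k) := by rw [hvk, co_co]; exact b1
    have q3 : c ≠ v k := by rw [hvk]; exact c2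
    have q4 : c ≠ co (v k) := by rw [hvk, co_co]; exact c1
    have m5 := L1M hW hWT cv nv
    have cM := cardM W v k q1 q2 q3 q4 c3 c4
    rw [hvk] at cM
    have lb := LR hW hWT cv q1 q2
    have lc := LR hW hWT cv q3 q4
    have bad : ∀ w ∈ M W v, w k ≠ κ ∧ w k ≠ co κ := by
      intro w h
      exact ⟨fun e => (mem_M.1 h).2 ⟨k, by rw [e, hvk, co_co]⟩, hw w (M_sub h)⟩
    have only1 : (N W v k c).card = 0 → (N W v k (co c)).card = 0 → ((N W v k b).card ≤ 1 ∨ 5 ≤ (N W v k b).card) ∧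
        ((N W v k (co b)).card ≤ 1 ∨ 5 ≤ (N W v k (co b)).card) := by
      intro z1 z2
      have hp : ∀ w ∈ M W v, w k = b ∨ w k = co b := by
        intro w h
        exact pr6b (hlet w) (bad w h).1 (bad w h).2 (N_empty z1 w h) (N_empty z2 w h)
      exact ⟨card_NuNu' hW hWT cv q2 hp, card_NuNu' hW hWT cv (co_conj q1 q2).2 (by intro w h; rw [co_co]; exact (hp w h).symm)⟩
    have only2 : (N W v k b).card = 0 → (N W v k (co b)).card = 0 → ((N W v k c).card ≤ 1 ∨ 5 ≤ (N W v k c).card) ∧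
        ((N W v k (co c)).card ≤ 1 ∨ 5 ≤ (N W v k (co c)).card) := by
      intro z1 z2
      have hp : ∀ w ∈ M W v, w k = c ∨ w k = co c := by
        intro w h
        exact pr6b (pr6a (hlet w)) (bad w h).1 (bad w h).2 (N_empty z1 w h) (N_empty z2 w h)
      exact ⟨card_NuNu' hW hWT cv q4 hp, card_NuNu' hW hWT cv (co_conj q3 q4).2 (by intro w h; rw [co_co]; exact (hp w h).symm)⟩
    clear bad hlet hw q1 q2 q3 q4 b1 b2 c1 c2 c3 c4 cb cc cv nv hvk
    have s1 : (K V k (co κ)).card + (K V k b).card + (K V k (co b)).card + (K V k c).card + (K V k (co c)).card = ρ := by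
      clear lb lc only1 only2 pb pc; omega
    have s2 : (K W k b).card + (K W k (co b)).card + (K W k c).card + (K W k (co c)).card = ρ + (K V k (co κ)).card := by
      clear lb lc only1 only2 pb pc; omega
    have k1 : 1 ≤ (K V k (co κ)).card := Nat.one_le_iff_ne_zero.2 hK
    have nz : (N W v k (co κ)).card = 0 := by rw [W0] at le5; exact Nat.le_zero.1 le5
    have m6 : 5 ≤ (N W v k b).card + (N W v k (co b)).card + (N W v k c).card + (N W v k (co c)).card := by
      clear lb lc only1 only2 pb pc; omega
    exact R5ar3 ρ _ _ _ _ _ _ _ _ _ _ _ _ _ s1 s2 db dc r5 k1 pb pc le1 le2 le3 le4 lb lc m6 only1 only2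
  obtain ⟨v0, hv0⟩ := Finset.card_pos.1 (Nat.pos_of_ne_zero hK)
  have hp : ∀ s s' : Fin 6, (∀ w : Wrd, w k = κ ∨ w k = co κ ∨ w k = s ∨ w k = co s ∨ w k = s' ∨ w k = co s') →
      (K W k s').card = 0 → (K W k (co s')).card = 0 → ∀ v ∈ K V k (co κ), ∀ w ∈ M W v, w k = s ∨ w k = co s := by
    intro s s' hl z1 z2 v hv w h
    have : w k ≠ κ := fun e => (mem_M.1 h).2 ⟨k, by rw [e, (mem_K.1 hv).2, co_co]⟩
    exact pr6b (hl w) this (hw w (M_sub h)) (K_empty z1 w (M_sub h)) (K_empty z2 w (M_sub h))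
  have k1 : 1 ≤ (K V k (co κ)).card := Nat.one_le_iff_ne_zero.2 hK
  rcases hv v0 hv0 with ⟨g1, g2, g3, g4, g5, g6, g7⟩ | ⟨g1, g2, g3, g4, g5, g6, g7⟩ | ⟨g1, g2, g3, g4, g5, g6, g7⟩ | ⟨g1, g2, g3, g4, g5, g6, g7⟩
  · exact R5one hV hVT hW hWT hd he b1 b2 (hp b c hlet g6 g7) k1 g1 g2 g3 g4 g5 (c := c)
  · exact R5one hV hVT hW hWT hd he cb.1 cb.2 (by rw [co_co]; intro v hv w h; exact (hp b c hlet g6 g7 v hv w h).symm) k1 g1 (by rw [co_co]; exact g2) g3 (by rw [co_co]; exact g4) g5 (c := c)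
  · exact R5one hV hVT hW hWT hd he c1 c2 (hp c b (fun w => pr6a (hlet w)) g6 g7) k1 g1 g2 g3 g4 g5 (c := b)
  · exact R5one hV hVT hW hWT hd he cc.1 cc.2 (by rw [co_co]; intro v hv w h; exact (hp c b (fun w => pr6a (hlet w)) g6 g7 v hv w h).symm) k1 g1 (by rw [co_co]; exact g2) g3 (by rw [co_co]; exact g4) g5 (c := b)
theorem E8ar (x0 x0' xu xu' xt xt' n0 nu nu' nt nt' : ℕ) (c8 : x0 + x0' + xu + xu' + xt + xt' = 8)
    (b0 : x0 ≤ 3) (bu : xu ≤ 3) (bu' : xu' ≤ 3) (bt : xt ≤ 3) (bt' : xt' ≤ 3)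
    (l0 : n0 ≤ x0) (l1 : nu ≤ xu) (l2 : nu' ≤ xu') (l3 : nt ≤ xt) (l4 : nt' ≤ xt')
    (lb : (nu = 0 ∧ nu' = 0) ∨ (2 ≤ nu ∧ 2 ≤ nu') ∨ (nu = 1 ∧ 5 ≤ nu') ∨ (5 ≤ nu ∧ nu' = 1))
    (lc : (nt = 0 ∧ nt' = 0) ∨ (2 ≤ nt ∧ 2 ≤ nt') ∨ (nt = 1 ∧ 5 ≤ nt') ∨ (5 ≤ nt ∧ nt' = 1))
    (m5 : 5 ≤ n0 + nu + nu' + nt + nt') (h0 : ¬ (x0 = 0 ∧ x0' = 0)) :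
    (2 ≤ nu ∧ 2 ≤ nu' ∧ nt = 0 ∧ nt' = 0) ∨ (2 ≤ nt ∧ 2 ≤ nt' ∧ nu = 0 ∧ nu' = 0) := by
  rcases lb with ⟨l1, l2⟩ | ⟨l1, l2⟩ | ⟨l1, l2⟩ | ⟨l1, l2⟩ <;> rcases lc with ⟨l3, l4⟩ | ⟨l3, l4⟩ | ⟨l3, l4⟩ | ⟨l3, l4⟩ <;> omega
theorem E8a (hX : Code X) (hXT : TF X) (hY : Code Y) (hYT : TF Y)
    (hd : Disjoint X Y) (he : Eqv X Y) (h8 : X.card = 8) (h3 : ∀ s, (K X k s).card ≤ 3) (h3' : ∀ s, (K Y k s).card ≤ 3)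
    (hw : w ∈ Y) :
    ∃ u, u ≠ w k ∧ u ≠ co (w k) ∧ 2 ≤ (N X w k u).card ∧ 2 ≤ (N X w k (co u)).card ∧ 1 ≤ (N X w k (w k)).card ∧
      (∀ v ∈ M X w, v k = w k ∨ v k = u ∨ v k = co u) := by
  obtain ⟨u, t, u1, u2, t1, t2, t3, t4⟩ := ex_pair (w k)
  have cw := he.cov hw
  have nw := Finset.disjoint_right.1 hd hw
  have m5 := L1M hX hXT cw nw
  have cM := cardM X w k u1 u2 t1 t2 t3 t4
  have cX := cardK X k u1 u2 t1 t2 t3 t4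
  have key := E8ar _ _ _ _ _ _ _ _ _ _ _ (cX.symm.trans h8) (h3 _) (h3 _) (h3 _) (h3 _) (h3 _) N_le_K N_le_K N_le_K N_le_K N_le_K
    (LR hX hXT cw u1 u2) (LR hX hXT cw t1 t2) (cM ▸ m5) (by
      rintro ⟨z1, z2⟩
      have := (pair0 hX hY hYT he z1 z2 (by have := h3' (w k); omega)).1
      exact K_empty this w hw rfl)
  have hl : ∀ v ∈ M X w, v k = w k ∨ v k = u ∨ v k = co u ∨ v k = t ∨ v k = co t := by
    intro v hv
    have := letters (w k) u t (Ne.symm u1) (fun e => u2 (by rw [e, co_co])) t1 t2 t3 t4 (v k)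
    have n : v k ≠ co (w k) := fun e => (mem_M.1 hv).2 ⟨k, e⟩
    tauto
  have fin : ∀ u t, u ≠ w k → u ≠ co (w k) → 2 ≤ (N X w k u).card → 2 ≤ (N X w k (co u)).card → (N X w k t).card = 0 →
      (N X w k (co t)).card = 0 → (∀ v ∈ M X w, v k = w k ∨ v k = u ∨ v k = co u ∨ v k = t ∨ v k = co t) →
      1 ≤ (N X w k (w k)).card ∧ (∀ v ∈ M X w, v k = w k ∨ v k = u ∨ v k = co u) := by
    clear key hl cM cX u1 u2 t1 t2 t3 t4
    intro u t u1 u2 n1 n2 z1 z2 hl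
    have p : (∀ v ∈ M X w, v k = w k ∨ v k = u ∨ v k = co u) := by
      intro v hv
      have := hl v hv; have := N_empty z1 v hv; have := N_empty z2 v hv
      tauto
    refine ⟨?_, p⟩
    by_contra h
    have := card_NuNu' hX hXT cw u2 (by
      intro v hv
      have := p v hv; have := N_empty (show (N X w k (w k)).card = 0 by omega) v hv
      tauto)
    have := h3 u
    have : (N X w k u).card ≤ (K X k u).card := N_le_K
    omega
  rcases key with ⟨g1, g2, g3, g4⟩ | ⟨g1, g2, g3, g4⟩
  · obtain ⟨a, b⟩ := fin u t u1 u2 g1 g2 g3 g4 hl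
    exact ⟨u, u1, u2, g1, g2, a, b⟩
  · obtain ⟨a, b⟩ := fin t u t1 t2 g1 g2 g3 g4 (by intro v hv; have := hl v hv; tauto)
    exact ⟨t, t1, t2, g1, g2, a, b⟩
/-- class sizes in an 8-word code -/
theorem E8c (hX : Code X) (hXT : TF X) (hY : Code Y) (hYT : TF Y)
    (hd : Disjoint X Y) (he : Eqv X Y) (h8 : X.card = 8) (k : ι) (s : Fin 6) (h4 : 4 ≤ (K X k s).card) : (K X k s).card = 8 := by
  have c := card_rest (V := X) (k := k) (κ := s)
  by_contra h
  have := (R56 hX hXT hY hYT hd he k s (by omega) (by omega)).1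
  omega
theorem E8 (hX : Code X) (hXT : TF X) (hY : Code Y) (hYT : TF Y)
    (hd : Disjoint X Y) (he : Eqv X Y) (h8 : X.card ≤ 8) : X.card = 0 := by
  by_contra h0
  have h8 : X.card = 8 := by
    by_contra h
    exact h0 (Eq7 hX hXT hY hYT hd he (by omega)).1
  have h8' : Y.card = 8 := (card_F1 (F_eqv hX hY he)).symm.trans h8
  obtain ⟨p, hp, q, hq, hpq⟩ := Finset.one_lt_card.1 (show 1 < X.card by omega)
  obtain ⟨k, hk⟩ := hX p hp q hq hpq
  have h3 : ∀ s, (K X k s).card ≤ 3 := by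
    intro s
    by_contra h
    have h := E8c hX hXT hY hYT hd he h8 k s (by omega)
    have e := Finset.eq_of_subset_of_card_le (K_sub (C := X) (k := k) (s := s)) (by omega)
    have e1 := (mem_K.1 (e.symm ▸ hp)).2
    have e2 := (mem_K.1 (e.symm ▸ hq)).2
    rw [e1, e2] at hk; exact ne_co _ hk
  have h3' : ∀ s, (K Y k s).card ≤ 3 := by
    intro s
    by_contra h
    have h := E8c hY hYT hX hXT hd.symm he.symm h8' k s (by omega)
    have := Kdiff hX hY he k s
    have := h3 s
    obtain ⟨u, t, u1, u2, t1, t2, t3, t4⟩ := ex_pair s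
    have := cardK Y k u1 u2 t1 t2 t3 t4
    omega
  have A := fun w hw => E8a hX hXT hY hYT hd he h8 h3 h3' (w := w) hw
  have B := fun w hw => E8a hY hYT hX hXT hd.symm he.symm h8' h3' h3 (w := w) hw
  -- main step: classes are 2,2,2,2
  have st : ∀ {P Q : Finset Wrd} (hP : P.card = 8) (A : ∀ w ∈ Q, ∃ u, u ≠ w k ∧ u ≠ co (w k) ∧ 2 ≤ (N P w k u).card ∧ 2 ≤ (N P w k (co u)).card ∧ 1 ≤ (N P w k (w k)).card ∧
      (∀ v ∈ M P w, v k = w k ∨ v k = u ∨ v k = co u))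
      (B : ∀ w ∈ P, 1 ≤ (K Q k (w k)).card), ∀ w ∈ Q, ∃ u, u ≠ w k ∧ u ≠ co (w k) ∧ (K P k u).card = 2 ∧ (K P k (co u)).card = 2 ∧ (K P k (w k)).card = 2 ∧
        (K P k (co (w k))).card = 2 ∧ 2 ≤ (N P w k u).card ∧ 2 ≤ (N P w k (co u)).card ∧ 1 ≤ (N P w k (w k)).card ∧ (∀ v ∈ M P w, v k = w k ∨ v k = u ∨ v k = co u) := by
    clear A B
    intro P Q hP A B w hw
    obtain ⟨u, u1, u2, n1, n2, n3, hm⟩ := A w hw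
    obtain ⟨t, t1, t2, t3, t4⟩ := third' (w k) u u1 u2
    have cP := cardK P k u1 u2 t1 t2 t3 t4
    have e1 : (N P w k u).card ≤ (K P k u).card := N_le_K
    have e2 : (N P w k (co u)).card ≤ (K P k (co u)).card := N_le_K
    have e3 : (N P w k (w k)).card ≤ (K P k (w k)).card := N_le_K
    obtain ⟨v, hv⟩ := Finset.card_pos.1 (show 0 < (K P k u).card by omega)
    have hQ := B v (mem_K.1 hv).1
    rw [(mem_K.1 hv).2] at hQ
    obtain ⟨w2, hw2⟩ := Finset.card_pos.1 hQ
    obtain ⟨r, r1, r2, m1, m2, m3, -⟩ := A w2 (mem_K.1 hw2).1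
    rw [(mem_K.1 hw2).2] at r1 r2
    have f1 : (N P w2 k r).card ≤ (K P k r).card := N_le_K
    have f2 : (N P w2 k (co r)).card ≤ (K P k (co r)).card := N_le_K
    have z : 2 ≤ (K P k (w k)).card ∧ 2 ≤ (K P k (co (w k))).card := by
      rcases letters u (w k) t u1 u2 t3 t4 t1 t2 r with e | e | e | e | e | e
      · exact absurd e r1
      · exact absurd e r2
      · subst e; exact ⟨m1.trans f1, m2.trans f2⟩
      · subst e; rw [co_co] at f2 m2; exact ⟨m2.trans f2, m1.trans f1⟩
      · subst e; omega
      · subst e; rw [co_co] at f2 m2; omega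
    exact ⟨u, u1, u2, by omega, by omega, by omega, by omega, n1, n2, n3, hm⟩
  have A2 := st h8 A (by
    intro w hw
    obtain ⟨u, u1, u2, n1, n2, n3, hm⟩ := B w hw
    exact n3.trans N_le_K)
  have B2 := st h8' B (by
    intro w hw
    obtain ⟨u, u1, u2, n1, n2, n3, hm⟩ := A w hw
    exact n3.trans N_le_K)
  clear st A B
  obtain ⟨w, hw⟩ := Finset.card_pos.1 (show 0 < Y.card by omega)
  obtain ⟨u, u1, u2, k1, k2, k3, k4, n1, n2, n3, hm⟩ := A2 w hw
  obtain ⟨v, hv⟩ := Finset.card_pos.1 (show 0 < (K X k (w k)).card by omega)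
  obtain ⟨-, -, -, -, -, y3, -⟩ := B2 v (mem_K.1 hv).1
  rw [(mem_K.1 hv).2] at y3
  obtain ⟨w2, hw2, hne⟩ := Finset.exists_mem_ne (show 1 < (K Y k (w k)).card by omega) w
  have hwk := (mem_K.1 hw2).2
  have Nu : ∀ {w s}, 2 ≤ (N X w k s).card → (K X k s).card = 2 → N X w k s = K X k s := by
    intro w s h1 h2
    exact Finset.eq_of_subset_of_card_le N_sub_K (by omega)
  have S : ∀ w ∈ Y, ∀ u, u ≠ w k → u ≠ co (w k) → 2 ≤ (N X w k u).card → 2 ≤ (N X w k (co u)).card → 1 ≤ (N X w k (w k)).card →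
     (K X k u).card = 2 → (K X k (co u)).card = 2 → (K X k (w k)).card = 2 → (∀ v ∈ M X w, v k = w k ∨ v k = u ∨ v k = co u) → ∃ j m x y, S5F X w k j m u x y := by
    intro w hw u u1 u2 n1 n2 n3 k1 k2 k3 hm
    obtain ⟨t, t1, t2, t3, t4⟩ := third' (w k) u u1 u2
    have cM := cardM X w k u1 u2 t1 t2 t3 t4
    have e1 : (N X w k u).card ≤ (K X k u).card := N_le_K
    have e2 : (N X w k (co u)).card ≤ (K X k (co u)).card := N_le_K
    have e3 : (N X w k (w k)).card ≤ (K X k (w k)).card := N_le_K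
    have zz : ∀ s, s ≠ w k → s ≠ u → s ≠ co u → (N X w k s).card = 0 := by
      intro s s1 s2 s3
      rw [Finset.card_eq_zero, Finset.eq_empty_iff_forall_notMem]
      intro v hv
      have e := (mem_N.1 hv).2.2
      rcases hm v (N_sub_M hv) with h | h | h
      · exact s1 (e.symm.trans h)
      · exact s2 (e.symm.trans h)
      · exact s3 (e.symm.trans h)
    have z1 := zz t t1 t3 t4
    have ct := co_conj t1 t2
    have ct2 := co_conj t3 t4
    have z2 := zz (co t) ct.1 ct2.1 ct2.2
    have cw := he.cov hw
    by_cases h6 : (M X w).card = 6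
    · exfalso
      obtain ⟨k', u', q1, q2, q3, q4, q5, q6⟩ := S6 hX hXT cw h6
      have l : (N X w k' (co u')).card ≤ (K X k' (co u')).card := N_le_K
      have h := E8c hX hXT hY hYT hd he h8 k' (co u') (by omega)
      have e := Finset.eq_of_subset_of_card_le (K_sub (C := X) (k := k') (s := co u')) (by omega)
      have g : upd w k' u' ∈ X := N_sub (q3.symm ▸ Finset.mem_singleton_self _ : upd w k' u' ∈ N X w k' u')
      have := (mem_K.1 (e.symm ▸ g)).2
      simp at this
      exact ne_co _ this
    · exact S5 hX hXT cw u1 u2 (Finset.card_pos.1 (by omega)) (by omega)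
  obtain ⟨j, m, x, y, h⟩ := S w hw u u1 u2 n1 n2 n3 k1 k2 k3 hm
  obtain ⟨u', u1', u2', k1', k2', k3', k4', n1', n2', n3', hm'⟩ := A2 w2 (mem_K.1 hw2).1
  have huu : u' = u ∨ u' = co u := by
    rw [hwk] at u1' u2'
    obtain ⟨t, t1, t2, t3, t4⟩ := third' (w k) u u1 u2
    have cP := cardK X k u1 u2 t1 t2 t3 t4
    rcases letters u (w k) t u1 u2 t3 t4 t1 t2 u' with e | e | e | e | e | e
    · exact Or.inl e
    · exact Or.inr e
    · exact absurd e u1'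
    · exact absurd e u2'
    · subst e; omega
    · subst e; rw [co_co] at k2'; omega
  have mm : 2 ≤ (N X w2 k u).card ∧ 2 ≤ (N X w2 k (co u)).card := by
    rcases huu with rfl | rfl
    · exact ⟨n1', n2'⟩
    · rw [co_co] at n2'; exact ⟨n2', n1'⟩
  obtain ⟨j2, m2, x2, y2, g⟩ := S w2 (mem_K.1 hw2).1 u (by rw [hwk]; exact u1) (by rw [hwk]; exact u2) mm.1 mm.2 n3' k1 k2 k3'
    (by
      intro v hv
      rcases huu with rfl | rfl
      · exact hm' v hv
      · have := hm' v hv; rw [co_co] at this; tauto)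
  obtain ⟨rfl, rfl, ag, c⟩ := S5cmp h g ((Nu n1 k1).trans (Nu mm.1 k1).symm)
  rcases c with ⟨rfl, rfl, c3⟩ | ⟨c1, c2, c3⟩
  · apply hne
    have e2 : N X w k (co u) = N X w2 k (co u) := (Nu n2 k2).trans (Nu mm.2 k2).symm
    rw [h.n2, g.n2] at e2
    have : T w k j2 m2 (co u) (w j2) y2 ∈ ({T w2 k j2 m2 (co u) (w2 j2) y2, T w2 k j2 m2 (co u) x2 (co y2)} : Finset _) := by
      rw [← e2]; simp
    rw [Finset.mem_insert, Finset.mem_singleton] at this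
    have e : w j2 = w2 j2 := by
      rcases this with e | e
      · have := congrFun e j2; rwa [T_j h.jm, T_j h.jm] at this
      · have := congrFun e m2; rw [T_m, T_m] at this; exact absurd this (ne_co _)
    funext i
    by_cases i1 : i = k
    · rw [i1, hwk]
    by_cases i2 : i = j2
    · rw [i2, e]
    by_cases i3 : i = m2
    · rw [i3, c3]
    exact (ag i i1 i2 i3).symm
  · exact S5swap h g c2 (h3 _)
theorem class11 (hV : Code V) (hVT : TF V) (hW : Code W) (hWT : TF W)
    (hd : Disjoint V W) (he : Eqv V W) (h16 : V.card ≤ 16) (k : ι) (κ : Fin 6) (hf : ¬ ∀ v ∈ V, v k = κ) : (K V k κ).card ≤ 11 := by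
  have c := card_rest (V := V) (k := k) (κ := κ)
  push Not at hf
  obtain ⟨v, hv, h⟩ := hf
  have : 0 < (V.filter (fun v => v k ≠ κ)).card := Finset.card_pos.2 ⟨v, by simp [hv, h]⟩
  by_contra h
  have := (R56 hV hVT hW hWT hd he k κ (by omega) (by omega)).1
  omega
def UC (X : Finset Wrd) (x : ι → Fin 8) : Prop := ∃ c ∈ X, In c x
def Spl (C A : Finset Wrd) (P : (ι → Fin 8) → Prop) : Prop :=
  (∀ a ∈ A, Cov C a) ∧ ∀ x, P x ↔ (UC C x ∧ ¬ UC A x)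
theorem In_2 (hjk : j ≠ k) {x : ι → Fin 8} : In (upd (upd a j s) k t) x ↔
    inn t (x k) ∧ inn s (x j) ∧ ∀ i, i ≠ k → i ≠ j → inn (a i) (x i) := by
  rw [In_upd]
  constructor
  · rintro ⟨h1, h2⟩
    refine ⟨h1, by simpa using h2 j hjk, ?_⟩
    intro i hi hj; simpa [hj] using h2 i hi
  · rintro ⟨h1, h2, h3⟩
    refine ⟨h1, ?_⟩
    intro i hi
    by_cases e : i = j
    · subst e; simpa using h2
    · simpa [e] using h3 i hi e
theorem upd_self2 (a : Wrd) (k : ι) : upd a k (a k) = a := Function.update_eq_self k a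
/-- a five-cover minus its word contains no word -/
theorem NoP {E : Finset Wrd} {o g : Wrd} (hC : Code E) (hT : TF E) (h5 : E.card = 5) (ho : Cov E o) (hn : o ∉ E)
    (hg : ∀ x, In g x → UC E x ∧ ¬ In o x) : False := by
  have m := L1M hC hT ho hn
  have e : M E o = E := Finset.eq_of_subset_of_card_le M_sub (by omega)
  have hD : D g o := by
    by_contra h
    obtain ⟨x, h1, h2⟩ := ex_of_notD h
    exact (hg x h1).2 h2
  have gn : g ∉ E := by
    intro h
    rw [← e] at h
    exact (mem_M.1 h).2 hD
  exact M5 hC hT h5.le (fun x hx => (hg x hx).1) ho gn hn hD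
theorem XOon (hT : TF C) (h : XO C k a a2 j u ξ) :
    upd (upd a j ξ) k (co u) ∉ K C k (co u) := by
  intro g
  have := twin_upd (c := upd (upd a j ξ) k u) (k := k) (u := u) (by simp)
  rw [Function.update_idem] at this
  exact hT _ h.c _ (K_sub g) this
theorem XOP {P : (ι → Fin 8) → Prop}
    (h : XO C k a a2 j u ξ) (hA : ∀ w, w ∈ A ↔ (w = a ∨ w = a2)) (hs : Spl C A P) (x : ι → Fin 8) :
    P x ↔ (In (upd a j (co (a j))) x ∨ (UC (K C k (co u)) x ∧ ¬ In (upd (upd a j ξ) k (co u)) x)) := by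
  rw [hs.2]
  have hjk := h.jk
  have ea : In a x ↔ inn (a k) (x k) ∧ inn (a j) (x j) ∧ ∀ i, i ≠ k → i ≠ j → inn (a i) (x i) := by
    rw [← In_2 hjk, upd_self2, upd_self2]
  have et : ∀ s, In (upd a j s) x ↔ inn (a k) (x k) ∧ inn s (x j) ∧ ∀ i, i ≠ k → i ≠ j → inn (a i) (x i) := by
    intro s
    have : upd a j s = upd (upd a j s) k (a k) := by
      have := upd_self2 (upd a j s) k
      rw [Function.update_of_ne (Ne.symm hjk)] at this
      exact this.symm
    rw [this, In_2 hjk]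
  have u1 : UC C x ↔ In (upd a j (co ξ)) x ∨ In (upd (upd a j ξ) k u) x ∨ UC (K C k (co u)) x := by
    constructor
    · rintro ⟨c, hc, hx⟩
      rcases h.all c hc with rfl | rfl | hk
      · exact Or.inl hx
      · exact Or.inr (Or.inl hx)
      · exact Or.inr (Or.inr ⟨c, hk, hx⟩)
    · rintro (hx | hx | ⟨c, hc, hx⟩)
      · exact ⟨_, h.e, hx⟩
      · exact ⟨_, h.c, hx⟩
      · exact ⟨c, K_sub hc, hx⟩
  have u2 : UC A x ↔ In a x ∨ In a2 x := by
    constructor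
    · rintro ⟨c, hc, hx⟩
      rcases (hA c).1 hc with rfl | rfl
      · exact Or.inl hx
      · exact Or.inr hx
    · rintro (hx | hx)
      · exact ⟨_, (hA _).2 (Or.inl rfl), hx⟩
      · exact ⟨_, (hA _).2 (Or.inr rfl), hx⟩
  have d1 : UC (K C k (co u)) x → ¬ inn u (x k) ∧ inn ξ (x j) := by
    rintro ⟨c, hc, hx⟩
    have := hx k; have h2 := hx j
    rw [(mem_K.1 hc).2, inn_co] at this
    rw [h.dj c hc] at h2
    exact ⟨this, h2⟩
  have d2 : In (upd (upd a j ξ) k (co u)) x → UC (K C k (co u)) x := h.cov x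
  rw [u1, u2, h.a2e, ea, et, et, In_2 hjk, In_2 hjk, In_2 hjk, inn_co, inn_co, inn_co, inn_co]
  rw [In_2 hjk, inn_co] at d2
  generalize (∀ i, i ≠ k → i ≠ j → inn (a i) (x i)) = B at *
  generalize UC (K C k (co u)) x = DD at *
  generalize inn (a k) (x k) = z at *
  generalize inn (a j) (x j) = ee at *
  generalize inn u (x k) = uu at *
  generalize inn ξ (x j) = xx at *
  clear u1 u2 hs hA et
  by_cases B <;> by_cases DD <;> by_cases z <;> by_cases ee <;> by_cases uu <;> by_cases xx <;> simp_all
theorem XOInP {E : Finset Wrd} (jk : j ≠ k) (u1 : u ≠ a k) (u2 : u ≠ co (a k))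
    (x1 : ξ ≠ a j) (x2 : ξ ≠ co (a j))
    (hC : Code E) (hT : TF E) (h5 : E.card = 5) (ho : Cov E (upd (upd a j ξ) k (co u))) (hn : upd (upd a j ξ) k (co u) ∉ E)
    (hk : ∀ e ∈ E, e k = co u) (hj : ∀ e ∈ E, e j = ξ)
    {g : Wrd} (hg : ∀ x, In g x → In (upd a j (co (a j))) x ∨ (UC E x ∧ ¬ In (upd (upd a j ξ) k (co u)) x)) :
    g = upd a j (co (a j)) := by
  set t := upd a j (co (a j)) with ht
  have tj : t j = co (a j) := by simp [ht]
  have tk : t k = a k := by simp [ht, Ne.symm jk]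
  have tof : ∀ i, i ≠ j → t i = a i := by intro i hi; simp [ht, hi]
  by_contra hne
  have hx0 : ∃ x, In g x ∧ ¬ In t x := by
    by_contra h
    push Not at h
    exact hne (sub_eq h)
  obtain ⟨x, hx, hxt⟩ := hx0
  have gk' : ∀ x, In g x → ¬ In t x → inn (co u) (x k) ∧ inn ξ (x j) := by
    intro x h1 h2
    rcases hg x h1 with h | ⟨⟨e, he, hex⟩, -⟩
    · exact absurd h h2
    · have a1 := hex k; have a2 := hex j
      rw [hk e he] at a1; rw [hj e he] at a2
      exact ⟨a1, a2⟩
  have gen : ∀ (k j : ι) (s r : Fin 6), k ≠ j → r ≠ t j → (∀ x, In g x → ¬ In t x → inn s (x k) ∧ inn r (x j)) → g k = s := by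
    intro k j s r kj hr hh
    by_contra hs
    obtain ⟨p, p1, p2⟩ := inn_ex2n _ _ hs
    have ag : ∀ i, i ≠ k → g i = t i := by
      intro i hi
      by_contra h
      obtain ⟨q, q1, q2⟩ := inn_ex2n _ _ h
      have i1 : In g (upd (upd x i q) k p) := by
        rw [In_updx]; refine ⟨p1, ?_⟩
        intro m hm
        by_cases e : m = i
        · subst e; simpa using q1
        · simpa [e] using hx m
      refine p2 ?_
      have := (hh _ i1 (by
        intro h
        have := h i
        simp [hi] at this
        exact q2 this)).1
      simpa using this
    -- now g agrees with t off k
    obtain ⟨q, q1, q2⟩ := inn_ex2n (t j) r (Ne.symm hr)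
    have xk : ¬ inn (t k) (x k) := by
      intro h
      apply hxt
      intro i
      by_cases e : i = k
      · subst e; exact h
      · rw [← ag i e]; exact hx i
    have i1 : In g (upd x j q) := by
      rw [In_updx]; refine ⟨by rw [ag j (Ne.symm kj)]; exact q1, fun m _ => hx m⟩
    have := (hh _ i1 (by
      intro h
      have := h k
      simp [kj] at this
      exact xk this)).2
    simp at this
    exact q2 this
  have gk : g k = co u := gen k j (co u) ξ (Ne.symm jk) (by rw [tj]; exact x2) gk'
  have gj : g j = ξ := gen j k ξ (co u) jk (by rw [tk]; exact (co_conj u1 u2).1) (fun x a b => (gk' x a b).symm)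
  -- g is disjoint from o
  have key : ∀ x, In g x → UC E x ∧ ¬ In (upd (upd a j ξ) k (co u)) x := by
    intro x hx
    obtain ⟨p, p1, p2⟩ := inn_ex2n (co u) (a k) (co_conj u1 u2).1
    have i1 : In g (upd x k p) := by rw [In_updx]; exact ⟨by rw [gk]; exact p1, fun m _ => hx m⟩
    rcases hg _ i1 with h | ⟨-, h⟩
    · have := h k
      rw [tk] at this; simp at this; exact absurd this p2
    · have no : ¬ In (upd (upd a j ξ) k (co u)) x := by
        intro h2
        apply h
        rw [In_2 jk] at h2 ⊢
        simp only [Function.update_self, Function.update_of_ne jk]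
        refine ⟨p1, h2.2.1, ?_⟩
        intro i i1 i2
        rw [Function.update_of_ne i1]; exact h2.2.2 i i1 i2
      refine ⟨?_, no⟩
      rcases hg x hx with h3 | ⟨h3, -⟩
      · exfalso; apply no
        rw [In_2 jk]
        refine ⟨by rw [← gk]; exact hx k, by rw [← gj]; exact hx j, ?_⟩
        intro i i1 i2
        rw [← tof i i2]; exact h3 i
      · exact h3
  exact NoP hC hT h5 ho hn key
structure Five (E : Finset Wrd) (o : Wrd) : Prop where
  hC : Code E
  hT : TF E
  h5 : E.card = 5
  ho : Cov E o
  hn : o ∉ E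
theorem FLG {E E' : Finset Wrd} {o o' : Wrd} (h' : Five E' o')
    (e : ∀ x, UC E x ∧ ¬ In o x ↔ UC E' x ∧ ¬ In o' x) (hf : ∀ v ∈ E, v k = κ) : (∀ v ∈ E', v k = κ) ∧ o' k = κ := by
  refine FL h'.hC h'.hT h'.h5 h'.ho h'.hn ?_
  intro x h1 h2
  obtain ⟨⟨v, hv, hvx⟩, -⟩ := (e x).2 ⟨h1, h2⟩
  rw [← hf v hv]; exact hvx k
theorem XOfive (hC : Code C) (hT : TF C) (h : XO C k a a2 j u ξ) :
    Five (K C k (co u)) (upd (upd a j ξ) k (co u)) :=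
  ⟨hC.mono K_sub, hT.mono K_sub, h.five, h.cov, XOon hT h⟩
theorem XOG {P : (ι → Fin 8) → Prop}
    (h : XO C k a a2 j u ξ) (hA : ∀ w, w ∈ A ↔ (w = a ∨ w = a2)) (hs : Spl C A P) (x : ι → Fin 8) :
    (P x ∧ ¬ In (upd a j (co (a j))) x) ↔ (UC (K C k (co u)) x ∧ ¬ In (upd (upd a j ξ) k (co u)) x) := by
  rw [XOP h hA hs]
  have : UC (K C k (co u)) x → In (upd a j (co (a j))) x → In (upd (upd a j ξ) k (co u)) x := by
    rintro ⟨e, he, hx⟩ h2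
    rw [In_2 h.jk]
    refine ⟨by rw [← (mem_K.1 he).2]; exact hx k, by rw [← h.dj e he]; exact hx j, ?_⟩
    intro i i1 i2
    have := h2 i
    simpa [i2] using this
  tauto
theorem T6 {w t : Wrd} {P : (ι → Fin 8) → Prop} (hC : Code C) (hT : TF C) (h6 : C.card = 6) (hn : w ∉ C)
    (hs : Spl C {w} P) (ht : ∀ x, In t x → P x) :
    ∃ E o, Five E o ∧ E ⊆ C ∧ (∀ x, (P x ∧ ¬ In t x) ↔ (UC E x ∧ ¬ In o x)) ∧
      ((t ∈ C ∧ o = w ∧ E = C.erase t) ∨ (∃ n u, u ≠ t n ∧ u ≠ co (t n) ∧ w = upd t n (co (t n)) ∧ o = upd t n (co u) ∧ upd t n u ∈ C ∧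
        (∀ e ∈ E, e n = co u))) := by
  have cw : Cov C w := hs.1 w (by simp)
  have UW : ∀ x, UC {w} x ↔ In w x := by intro x; simp [UC]
  have hP : ∀ x, P x ↔ (UC C x ∧ ¬ In w x) := by intro x; rw [hs.2, UW]
  have hD : D t w := by
    by_contra h
    obtain ⟨x, h1, h2⟩ := ex_of_notD h
    exact ((hP x).1 (ht x h1)).2 h2
  have ct : Cov C t := fun x hx => ((hP x).1 (ht x hx)).1
  by_cases htC : t ∈ C
  · refine ⟨C.erase t, w, ⟨hC.mono (Finset.erase_subset _ _), hT.mono (Finset.erase_subset _ _), ?_, ?_, ?_⟩, Finset.erase_subset _ _, ?_, Or.inl ⟨htC, rfl, rfl⟩⟩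
    · rw [Finset.card_erase_of_mem htC]; omega
    · intro x hx
      obtain ⟨c, hc, hcx⟩ := cw x hx
      refine ⟨c, Finset.mem_erase.2 ⟨?_, hc⟩, hcx⟩
      rintro rfl
      exact notD_of_In hcx hx hD
    · intro h; exact hn (Finset.mem_of_mem_erase h)
    · intro x
      rw [hP]
      constructor
      · rintro ⟨⟨⟨c, hc, hcx⟩, h2⟩, h3⟩
        exact ⟨⟨c, Finset.mem_erase.2 ⟨by rintro rfl; exact h3 hcx, hc⟩, hcx⟩, h2⟩
      · rintro ⟨⟨c, hc, hcx⟩, h2⟩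
        rw [Finset.mem_erase] at hc
        exact ⟨⟨⟨c, hc.2, hcx⟩, h2⟩, fun h => hc.1 (code_eq hC hc.2 htC hcx h)⟩
  · obtain ⟨n, hDn⟩ := D_symm.1 hD
    obtain ⟨u, tw⟩ := M6 hC hT h6.le ct cw htC hn hDn
    have hh : upd t n u ∉ K C n (co u) := by
      intro h; have := (mem_K.1 h).2; simp at this; exact ne_co _ this
    have hsub : insert (upd t n u) (K C n (co u)) ⊆ C := by
      intro c hc
      rcases Finset.mem_insert.1 hc with rfl | h
      · exact tw.h
      · exact K_sub h
    have hcard := Finset.card_le_card hsub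
    rw [Finset.card_insert_of_notMem hh] at hcard
    have f5 := tw.five
    have heq : insert (upd t n u) (K C n (co u)) = C := Finset.eq_of_subset_of_card_le hsub (by rw [Finset.card_insert_of_notMem hh]; omega)
    have on : upd t n (co u) ∉ K C n (co u) := by
      intro g
      have := twin_upd (c := upd t n u) (k := n) (u := u) (by simp)
      rw [Function.update_idem] at this
      exact hT _ tw.h _ (K_sub g) this
    refine ⟨K C n (co u), upd t n (co u), ⟨hC.mono K_sub, hT.mono K_sub, by omega, tw.cov, on⟩, K_sub, ?_, Or.inr ⟨n, u, tw.u1, tw.u2, tw.tw, rfl, tw.h, fun e he => (mem_K.1 he).2⟩⟩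
    intro x
    have uc : UC C x ↔ In (upd t n u) x ∨ UC (K C n (co u)) x := by
      conv_lhs => rw [← heq]
      simp [UC]
    have e1 : In t x ↔ inn (t n) (x n) ∧ ∀ i, i ≠ n → inn (t i) (x i) := by
      rw [← In_upd, upd_self2]
    have d1 : UC (K C n (co u)) x → ¬ inn u (x n) := by
      rintro ⟨c, hc, hx⟩
      have := hx n
      rwa [(mem_K.1 hc).2, inn_co] at this
    have d2 := tw.cov x
    rw [hP, uc, e1, tw.tw, In_upd, In_upd, In_upd, inn_co, inn_co]
    rw [In_upd, inn_co] at d2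
    change _ → UC (K C n (co u)) x at d2
    clear e1 uc
    tauto
theorem XOdata {P : (ι → Fin 8) → Prop} (hA : Code A) (hAT : TF A) (hC : Code C) (hT : TF C)
    (h2 : A.card = 2) (h7 : C.card ≤ 7) (hs : Spl C A P) (hn : ∀ a ∈ A, a ∉ C) :
    ∃ k j u ξ a a2, XO C k a a2 j u ξ ∧ ∀ w, w ∈ A ↔ (w = a ∨ w = a2) := by
  obtain ⟨a, b, hab, rfl⟩ := Finset.card_eq_two.1 h2
  obtain ⟨k, j, u, ξ, h⟩ := M7two hA hAT hC hT h7 hs.1 hn (a1 := a) (a2 := b) (by simp) (by simp) hab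
  rcases h with h | h
  · exact ⟨k, j, u, ξ, a, b, h, by intro w; simp⟩
  · exact ⟨k, j, u, ξ, b, a, h, by intro w; simp; tauto⟩
theorem X1w {C2 A2 C : Finset Wrd} {P : (ι → Fin 8) → Prop}
    (hC2 : Code C2) (hT2 : TF C2) (h : XO C2 k a a2 j u ξ) (hA : ∀ w, w ∈ A2 ↔ (w = a ∨ w = a2)) (hs2 : Spl C2 A2 P)
    (hC : Code C) (hT : TF C) (h6 : C.card = 6) (hn : w ∉ C) (hs : Spl C {w} P) (hD : ∀ a ∈ A2, D a w) : upd a j (co (a j)) ∈ C := by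
  obtain ⟨E, o, f, -, hG, hc⟩ := T6 hC hT h6 hn hs (t := upd a j (co (a j))) (fun x hx => (XOP h hA hs2 x).2 (Or.inl hx))
  have jk := h.jk
  rcases hc with hc | ⟨n, v, v1, v2, rfl, rfl, -, hf⟩
  · exact hc.1
  exfalso
  by_cases nj : n = j
  · subst nj
    have := hD a ((hA a).2 (Or.inl rfl))
    simp [co_co] at this
    exact D_irr _ this
  by_cases nk : n = k
  · subst nk
    obtain ⟨i, hi⟩ := hD a2 ((hA a2).2 (Or.inr rfl))
    rw [h.a2e] at hi
    by_cases e1 : i = n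
    · subst e1; simp [nj] at hi; exact ne_co _ hi
    by_cases e2 : i = j
    · subst e2; simp [e1, co_co] at hi; exact h.x1 hi
    · simp [e1, e2] at hi; exact ne_co _ hi
  have := (FLG (XOfive hC2 hT2 h) (fun x => (hG x).symm.trans (XOG h hA hs2 x)) hf).2
  simp [nj, nk] at this v1 v2
  exact v2 (by rw [this, co_co])
theorem XA {A2 C2 C3 C4 : Finset Wrd} {w3 w4 : Wrd} {P : (ι → Fin 8) → Prop} (hA : Code A2) (hAT : TF A2) (hC : Code C2) (hT : TF C2)
    (h2 : A2.card = 2) (h7 : C2.card ≤ 7) (hs : Spl C2 A2 P) (hn : ∀ a ∈ A2, a ∉ C2)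
    (hC3 : Code C3) (hT3 : TF C3) (h3 : C3.card = 6) (hn3 : w3 ∉ C3) (hs3 : Spl C3 {w3} P) (hD3 : ∀ a ∈ A2, D a w3)
    (hC4 : Code C4) (hT4 : TF C4) (h4 : C4.card = 6) (hn4 : w4 ∉ C4) (hs4 : Spl C4 {w4} P) (hD4 : ∀ a ∈ A2, D a w4)
    (hd : Disjoint C3 C4) : False := by
  obtain ⟨k, j, u, ξ, a, a2, h, hh⟩ := XOdata hA hAT hC hT h2 h7 hs hn
  exact Finset.disjoint_left.1 hd (X1w hC hT h hh hs hC3 hT3 h3 hn3 hs3 hD3) (X1w hC hT h hh hs hC4 hT4 h4 hn4 hs4 hD4)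
theorem XB {A2 C2 A3 C3 : Finset Wrd} {P : (ι → Fin 8) → Prop} (hA : Code A2) (hAT : TF A2) (hC : Code C2) (hT : TF C2)
    (h2 : A2.card = 2) (h7 : C2.card ≤ 7) (hs : Spl C2 A2 P) (hn : ∀ a ∈ A2, a ∉ C2)
    (hA3 : Code A3) (hAT3 : TF A3) (hC3 : Code C3) (hT3 : TF C3)
    (h23 : A3.card = 2) (h73 : C3.card ≤ 7) (hs3 : Spl C3 A3 P) (hn3 : ∀ a ∈ A3, a ∉ C3)
    (hD : ∀ a ∈ A2, ∀ b ∈ A3, D a b) : False := by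
  obtain ⟨k, j, u, ξ, a, a2, h, hh⟩ := XOdata hA hAT hC hT h2 h7 hs hn
  obtain ⟨k', j', u', ξ', b, b2, g, gg⟩ := XOdata hA3 hAT3 hC3 hT3 h23 h73 hs3 hn3
  have f := XOfive hC hT h
  have f' := XOfive hC3 hT3 g
  have jk := h.jk
  have jk' := g.jk
  have te : upd b j' (co (b j')) = upd a j (co (a j)) := by
    refine XOInP h.jk h.u1 h.u2 h.x1 h.x2 f.hC f.hT f.h5 f.ho f.hn (fun e he => (mem_K.1 he).2) h.dj ?_
    intro x hx
    exact (XOP h hh hs x).1 ((XOP g gg hs3 x).2 (Or.inl hx))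
  have G1 : ∀ x, UC (K C2 k (co u)) x ∧ ¬ In (upd (upd a j ξ) k (co u)) x ↔ UC (K C3 k' (co u')) x ∧ ¬ In (upd (upd b j' ξ') k' (co u')) x := by
    intro x; rw [← XOG h hh hs, ← XOG g gg hs3, te]
  have p1 := (FLG f' G1 (k := k) (κ := co u) (fun e he => (mem_K.1 he).2)).2
  have p2 := (FLG f' G1 h.dj).2
  have p3 := (FLG f (fun x => (G1 x).symm) (k := k') (κ := co u') (fun e he => (mem_K.1 he).2)).2
  have p4 := (FLG f (fun x => (G1 x).symm) g.dj).2
  have ts : ∀ i, (upd b j' (co (b j'))) i = (upd a j (co (a j))) i := fun i => congrFun te i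
  have kin : k = k' ∨ k = j' := by
    by_contra hcon
    push Not at hcon
    have := ts k
    simp [hcon.2, Ne.symm jk] at this
    simp [hcon.1, hcon.2] at p1
    exact (co_conj h.u1 h.u2).1 (p1.symm.trans this)
  have jin : j = k' ∨ j = j' := by
    by_contra hcon
    push Not at hcon
    have := ts j
    simp [hcon.2] at this
    simp [hcon.1, hcon.2] at p2
    exact h.x2 (p2.symm.trans this)
  obtain ⟨i, hi⟩ := hD a2 ((hh a2).2 (Or.inr rfl)) b2 ((gg b2).2 (Or.inr rfl))
  rw [h.a2e, g.a2e] at hi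
  rcases kin with rfl | rfl
  · have : j = j' := by
      rcases jin with e | e
      · exact absurd e jk
      · exact e
    subst this
    have tk := ts k; have tj := ts j
    simp [jk, Ne.symm jk] at p1 p2 tk tj
    by_cases e1 : i = k
    · subst e1; simp [tk, co_co] at hi
      exact ne_co _ hi.symm
    by_cases e2 : i = j
    · subst e2; simp [e1, p2] at hi; exact ne_co _ hi
    · have := ts i
      simp [e2] at this
      simp [e1, e2, this] at hi
      exact ne_co _ hi
  · have : j = k' := by
      rcases jin with e | e
      · exact e
      · exact absurd e jk
    subst this
    have tk := ts k; have tj := ts j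
    simp [jk, Ne.symm jk] at p1 p2 tk tj
    -- b k = co (a k), b j = co (a j)
    by_cases e1 : i = k
    · subst e1; simp [Ne.symm jk, p1, co_co] at hi
      exact h.u2 hi.symm
    by_cases e2 : i = j
    · subst e2; simp [e1, tj, co_co] at hi; exact h.x2 hi
    · have := ts i
      simp [e1, e2] at this
      simp [e1, e2, this] at hi
      exact ne_co _ hi
theorem exT {P : (ι → Fin 8) → Prop} (hC : Code C) (hT : TF C) (h6 : C.card = 6) (hn : w ∉ C)
    (hs : Spl C {w} P) : ∃ t : Wrd, ∀ x, In t x → P x := by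
  have hc : Cov C w := hs.1 w (by simp)
  have h5 := L1M hC hT hc hn
  have hP : ∀ x, P x ↔ UC C x ∧ ¬ In w x := by
    intro x; rw [hs.2 x]; simp [UC]
  have hle := Finset.card_le_card (show M C w ⊆ C from fun c hc => M_sub hc)
  by_cases e : (M C w).card = 5
  · have : ∃ t ∈ C, t ∉ M C w := by
      by_contra hh
      push Not at hh
      have := Finset.card_le_card (show C ⊆ M C w from hh)
      omega
    obtain ⟨t, ht, htm⟩ := this
    refine ⟨t, fun x hx => (hP x).2 ⟨⟨t, ht, hx⟩, fun hw => htm ?_⟩⟩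
    exact (mem_M).2 ⟨ht, notD_of_In hx hw⟩
  · obtain ⟨k, u, u1, u2, n1, n2, n3, n4⟩ := S6 hC hT hc (by omega)
    refine ⟨upd w k (co (w k)), fun x hx => (hP x).2 ⟨?_, ?_⟩⟩
    · by_cases hu : inn u (x k)
      · refine ⟨upd w k u, N_sub (s := u) (by rw [n1]; simp), ?_⟩
        intro i
        by_cases ik : i = k
        · subst ik; simpa using hu
        · have := hx i; simpa [ik] using this
      · obtain ⟨c, hc, hcx⟩ := n3 x (by
          intro i
          by_cases ik : i = k
          · subst ik; simpa [inn_co] using hu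
          · have := hx i; simpa [ik] using this)
        exact ⟨c, N_sub hc, hcx⟩
    · intro hw
      have h1 := hx k; have h2 := hw k
      simp [inn_co] at h1
      exact h1 h2
theorem P14a {C1 C3 C4 : Finset Wrd} {v w3 w4 : Wrd} {P : (ι → Fin 8) → Prop}
    (hC1 : Code C1) (hT1 : TF C1) (h1 : C1.card = 6) (hn1 : v ∉ C1) (hs1 : Spl C1 {v} P) (hD3 : D v w3) (hD4 : D v w4)
    (hC3 : Code C3) (hT3 : TF C3) (h3 : C3.card = 6) (hn3 : w3 ∉ C3) (hs3 : Spl C3 {w3} P)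
    (hC4 : Code C4) (hT4 : TF C4) (h4 : C4.card = 6) (hn4 : w4 ∉ C4) (hs4 : Spl C4 {w4} P)
    (hd : Disjoint C3 C4) : ∃ k κ, (∃ E ⊆ C3, E.card = 5 ∧ ∀ e ∈ E, e k = κ) ∧ (∃ E ⊆ C4, E.card = 5 ∧ ∀ e ∈ E, e k = κ) ∧ v k = κ ∧
      ∃ f, (f ∈ C3 ∨ f ∈ C4) ∧ f k ≠ κ := by
  obtain ⟨t, ht⟩ := exT hC3 hT3 h3 hn3 hs3
  obtain ⟨E1, o1, f1, s1, g1, r1⟩ := T6 hC1 hT1 h1 hn1 hs1 ht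
  obtain ⟨E3, o3, f3, s3, g3, r3⟩ := T6 hC3 hT3 h3 hn3 hs3 ht
  obtain ⟨E4, o4, f4, s4, g4, r4⟩ := T6 hC4 hT4 h4 hn4 hs4 ht
  have key : ∀ {n u o w n' u'}, u ≠ co (t n) → o n = co u → o = upd t n' (co u') → w = upd t n' (co (t n')) → n' = n ∧ u' = u ∧ w = upd t n (co (t n)) := by
    intro n u o w n' u' a1 a2 a3 a4
    by_cases e : n = n'
    · subst e; rw [a3] at a2; simp at a2; exact ⟨rfl, co_inj _ _ a2, a4⟩
    · rw [a3] at a2; simp [e] at a2; exact absurd (by rw [a2, co_co]) a1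
  have v1 : ∀ {n u w E o}, u ≠ co (t n) → w = upd t n (co (t n)) → D v w → (∀ e ∈ E, e n = co u) →
      (∀ x, (P x ∧ ¬ In t x) ↔ (UC E x ∧ ¬ In o x)) → v n = co u := by
    intro n u w E o a1 a2 a3 a4 a5
    have := (FLG f1 (fun x => (a5 x).symm.trans (g1 x)) a4).2
    rcases r1 with ⟨_, b, _⟩ | ⟨n', u', b1, b2, b3, b4, b5, b6⟩
    · rw [← b]; exact this
    · have := (key a1 this b4 b3).2.2
      rw [this, ← a2] at a3
      exact (D_irr _ a3).elim
  rcases r3 with ⟨a1, a2, a3⟩ | ⟨n, u, a1, a2, a3, a4, a5, a6⟩ <;> rcases r4 with ⟨b1, b2, b3⟩ | ⟨n', u', b1, b2, b3, b4, b5, b6⟩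
  · exact (Finset.disjoint_left.1 hd a1 b1).elim
  · refine ⟨n', co u', ⟨E3, s3, f3.h5, (FLG f3 (fun x => (g4 x).symm.trans (g3 x)) b6).1⟩, ⟨E4, s4, f4.h5, b6⟩, v1 b2 b3 hD4 b6 g4, _, Or.inr b5, ?_⟩
    simp; exact ne_co _
  · refine ⟨n, co u, ⟨E3, s3, f3.h5, a6⟩, ⟨E4, s4, f4.h5, (FLG f4 (fun x => (g3 x).symm.trans (g4 x)) a6).1⟩, v1 a2 a3 hD3 a6 g3, _, Or.inl a5, ?_⟩
    simp; exact ne_co _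
  · have := (FLG f4 (fun x => (g3 x).symm.trans (g4 x)) a6).2
    obtain ⟨e1, e2, _⟩ := key a2 this b4 b3
    subst e1 e2
    exact (Finset.disjoint_left.1 hd a5 b5).elim
theorem slrest {E : Finset Wrd} (hki : k ≠ i) (hE : E ⊆ Sl V i l s) (hk : ∀ e ∈ E, e k = κ) :
    (K (V.filter (fun v => v k ≠ κ)) i s).card + E.card ≤ (K V i s).card := by
  rw [← Sl_card V i l s, ← Sl_card _ i l s, ← Finset.card_union_of_disjoint]
  · apply Finset.card_le_card
    intro w hw
    rcases Finset.mem_union.1 hw with h | h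
    · rw [mem_Sl] at h ⊢
      exact ⟨h.1, (Finset.mem_filter.1 h.2).1⟩
    · exact hE h
  · rw [Finset.disjoint_left]
    intro w h1 h2
    have := (Finset.mem_filter.1 (mem_Sl.1 h1).2).2
    simp [hki] at this
    exact this (hk w h2)
theorem P14b (hV : Code V) (hVT : TF V) (hW : Code W) (hWT : TF W)
    (hd : Disjoint V W) (he : Eqv V W) {l b t κ : Fin 6}
    (h1 : b ≠ l) (h2 : b ≠ co l) (h3 : t ≠ l) (h4 : t ≠ co l) (h5 : t ≠ b) (h6 : t ≠ co b)
    (c1 : (K V i l).card = 1) (c2 : (K V i (co l)).card = 3) (c3 : (K V i b).card = 6) (c4 : (K V i (co b)).card = 6)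
    (c5 : (K V i t).card = 0) (c6 : (K V i (co t)).card = 0) (hki : k ≠ i) (hf : ¬ ∀ v ∈ V, v k = κ)
    (e1 : ∃ E ⊆ Sl V i l l, E.card = 1 ∧ ∀ e ∈ E, e k = κ) (e3 : ∃ E ⊆ Sl V i l b, E.card = 5 ∧ ∀ e ∈ E, e k = κ)
    (e4 : ∃ E ⊆ Sl V i l (co b), E.card = 5 ∧ ∀ e ∈ E, e k = κ) : False := by
  obtain ⟨E1, a1, a2, a3⟩ := e1
  obtain ⟨E3, b1, b2, b3⟩ := e3
  obtain ⟨E4, d1, d2, d3⟩ := e4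
  have f1 := slrest hki a1 a3
  have f3 := slrest hki b1 b3
  have f4 := slrest hki d1 d3
  have hle : ∀ s, (K (V.filter (fun v => v k ≠ κ)) i s).card ≤ (K V i s).card := by
    intro s
    apply Finset.card_le_card
    intro w hw
    rw [mem_K] at hw ⊢
    exact ⟨(Finset.mem_filter.1 hw.1).1, hw.2⟩
  have g2 := hle (co l); have g5 := hle t; have g6 := hle (co t)
  have hs := cardK (V.filter (fun v => v k ≠ κ)) i h1 h2 h3 h4 h5 h6
  have r1 : 1 ≤ (V.filter (fun v => v k ≠ κ)).card := by
    push Not at hf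
    obtain ⟨v, hv, hvk⟩ := hf
    exact Finset.card_pos.2 ⟨v, Finset.mem_filter.2 ⟨hv, hvk⟩⟩
  obtain ⟨r5, w, hw, hwk, hM⟩ := R56 hV hVT hW hWT hd he k κ r1 (by omega)
  have hN : ∀ s, (N V w i s).card = (K (V.filter (fun v => v k ≠ κ)) i s).card := by
    intro s
    congr 1
    ext c
    rw [mem_N, mem_K, ← hM, mem_M, and_assoc]
  have hcov : Cov V w := he.cov hw
  have M5c : (M V w).card = 5 := by rw [hM]; exact r5
  by_cases hω : w i = l ∨ w i = co l
  · have q := S5pat (k := i) (u := b) hV hVT hcov (by rcases hω with e | e <;> rw [e] <;> assumption)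
      (by rcases hω with e | e <;> rw [e] <;> simpa [co_co]) (Finset.card_pos.1 (by rw [hN]; omega)) M5c
    have := q.2.1
    rw [hN] at this
    omega
  · push Not at hω
    have q := S5pat (k := i) (u := co l) hV hVT hcov hω.2.symm
      (fun h => hω.1 (co_inj _ _ h).symm) (Finset.card_pos.1 (by rw [hN]; omega)) M5c
    have := q.2.1
    rw [hN] at this
    omega
theorem omL {A B C : Type} {b1 c1 u1 v1 f1 : A} {b2 c2 u2 v2 f2 : B} {b3 c3 u3 v3 f3 : C}
  (a : b1 ≠ u1 ∧ b1 ≠ v1 ∧ b1 ≠ c1 ∧ c1 ≠ u1 ∧ c1 ≠ v1 ∧ u1 ≠ v1)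
  (b : b2 ≠ u2 ∧ b2 ≠ v2 ∧ b2 ≠ c2 ∧ c2 ≠ u2 ∧ c2 ≠ v2 ∧ u2 ≠ v2)
  (c : b3 ≠ u3 ∧ b3 ≠ v3 ∧ b3 ≠ c3 ∧ c3 ≠ u3 ∧ c3 ≠ v3 ∧ u3 ≠ v3)
  (B1 : f1 = c1 ∨ f2 = u2 ∨ f3 = u3 ∨ (f2 = b2 ∧ f3 = b3))
  (B2 : f1 = v1 ∨ f2 = v2 ∨ f3 = c3 ∨ (f1 = b1 ∧ f2 = b2))
  (B3 : f1 = v1 ∨ f2 = u2 ∨ f3 = v3 ∨ (f1 = b1 ∧ f2 = b2 ∧ f3 = b3))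
  (B4 : f1 = u1 ∨ f2 = c2 ∨ f3 = v3 ∨ (f1 = b1 ∧ f3 = b3))
  (B5 : f1 = u1 ∨ f2 = v2 ∨ f3 = u3 ∨ (f1 = b1 ∧ f2 = b2 ∧ f3 = b3)) :
  (f1 = b1 ∧ f2 = b2 ∧ f3 = b3) ∨ (f1 = v1 ∧ f2 = c2 ∧ f3 = u3) ∨ (f1 = u1 ∧ f2 = u2 ∧ f3 = c3) ∨ (f1 = c1 ∧ f2 = v2 ∧ f3 = v3) := by
  grind
theorem Five_M {E : Finset Wrd} (h : Five E o) : M E o = E :=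
  Finset.eq_of_subset_of_card_le (fun c hc => M_sub hc) (by rw [h.h5]; exact L1M h.hC h.hT h.ho h.hn)
theorem Five_at {E : Finset Wrd} (h : Five E o) (hk : ∃ c ∈ E, c k ≠ o k) :
    ∃ j m u x y, S5F E o k j m u x y := by
  obtain ⟨c, hc, hck⟩ := hk
  have hm : c ∈ M E o := by rw [Five_M h]; exact hc
  have h2 : c k ≠ co (o k) := fun e => (mem_M.1 hm).2 ⟨k, e⟩
  obtain ⟨j, m, x, y, hh⟩ := S5 (k := k) (u := c k) h.hC h.hT h.ho hck h2 ⟨c, mem_N.2 ⟨hc, (mem_M.1 hm).2, rfl⟩⟩ (by rw [Five_M h, h.h5])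
  exact ⟨j, m, _, x, y, hh⟩
theorem Five_ex {E : Finset Wrd} (h : Five E o) : ∃ k j m u x y, S5F E o k j m u x y := by
  obtain ⟨c, hc, k, h1, h2⟩ := ex_diff h.ho h.hn
  exact ⟨k, Five_at h ⟨c, M_sub hc, h1⟩⟩
theorem S5F_off {k j m n : ι} {u x y : Fin 6} (h : S5F C a k j m u x y) (hF : Five C a) (hc : c ∈ C)
    (h1 : n ≠ k) (h2 : n ≠ j) (h3 : n ≠ m) : c n = a n := by
  have hm : c ∈ M C a := by rw [Five_M hF]; exact hc
  have hN : ∀ s, c k = s → c ∈ N C a k s := fun s e => mem_N.2 ⟨hc, (mem_M.1 hm).2, e⟩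
  rcases h.pat c hm with e | e | e
  · have := hN _ e; rw [h.n0] at this; simp at this; rw [this, T_o h1 h2 h3]
  · have := hN _ e; rw [h.n1] at this; simp at this; rcases this with r | r <;> rw [r, T_o h1 h2 h3]
  · have := hN _ e; rw [h.n2] at this; simp at this; rcases this with r | r <;> rw [r, T_o h1 h2 h3]
theorem bx {w f : Wrd} (kj : k ≠ j) (km : k ≠ m) (jm : j ≠ m)
    (hB : T w k j m s t r ∈ C) (hf : ∀ n, n ≠ k → n ≠ j → n ≠ m → f n = w n) (hP : ∀ x, In f x → UC C x → In w x) :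
    (f k = co s ∨ f j = co t ∨ f m = co r) ∨ ((f k = w k ∨ s = w k) ∧ (f j = w j ∨ t = w j) ∧ (f m = w m ∨ r = w m)) := by
  by_cases hD : D f (T w k j m s t r)
  · left
    obtain ⟨n, hn⟩ := hD
    by_cases e1 : n = k
    · subst e1; rw [T_k kj km] at hn; exact Or.inl hn
    by_cases e2 : n = j
    · subst e2; rw [T_j jm] at hn; exact Or.inr (Or.inl hn)
    by_cases e3 : n = m
    · subst e3; rw [T_m] at hn; exact Or.inr (Or.inr hn)
    rw [T_o e1 e2 e3, hf n e1 e2 e3] at hn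
    exact (ne_co _ hn).elim
  · right
    have key : ∀ n, f n = w n ∨ T w k j m s t r n = w n := by
      intro n
      by_contra hh
      push Not at hh
      obtain ⟨x, x1, x2⟩ := ex_of_notD hD
      obtain ⟨p, p1, p2, p3⟩ := inn_ex3 (f n) (T w k j m s t r n) (w n) (fun e => hD ⟨n, by rw [e, co_co]⟩) hh.1.symm hh.2.symm
      have y1 : In f (upd x n p) := by
        intro q; by_cases e : q = n
        · subst e; simpa using p1
        · simpa [e] using x1 q
      have y2 : In (T w k j m s t r) (upd x n p) := by
        intro q; by_cases e : q = n
        · subst e; simpa using p2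
        · simpa [e] using x2 q
      have := hP _ y1 ⟨_, hB, y2⟩ n
      simp at this
      exact p3 this
    have k1 := key k; have k2 := key j; have k3 := key m
    rw [T_k kj km] at k1; rw [T_j jm] at k2; rw [T_m] at k3
    exact ⟨k1, k2, k3⟩
theorem Om {w f : Wrd} {u x y : Fin 6} (h : S5F C w k j m u x y)
    (hf : ∀ n, n ≠ k → n ≠ j → n ≠ m → f n = w n) (hP : ∀ x, In f x → UC C x → In w x) :
    (f k = w k ∧ f j = w j ∧ f m = w m) ∨ (f k = co u ∧ f j = co (w j) ∧ f m = y) ∨ (f k = u ∧ f j = x ∧ f m = co (w m)) ∨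
    (f k = co (w k) ∧ f j = co x ∧ f m = co y) := by
  have di : ∀ b v : Fin 6, v ≠ b → v ≠ co b → b ≠ v ∧ b ≠ co v ∧ b ≠ co b ∧ co b ≠ v ∧ co b ≠ co v ∧ v ≠ co v := by decide
  have e : ∀ {s c}, c ∈ N C w k s → c ∈ C := fun hc => N_sub hc
  have b1 := bx h.kj h.km h.jm (e (s := w k) (c := T w k j m (w k) (co x) (co y)) (by rw [h.n0]; simp)) hf hP
  have b2 := bx h.kj h.km h.jm (e (s := u) (c := T w k j m u x (w m)) (by rw [h.n1]; simp)) hf hP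
  have b3 := bx h.kj h.km h.jm (e (s := u) (c := T w k j m u (co x) y) (by rw [h.n1]; simp)) hf hP
  have b4 := bx h.kj h.km h.jm (e (s := co u) (c := T w k j m (co u) (w j) y) (by rw [h.n2]; simp)) hf hP
  have b5 := bx h.kj h.km h.jm (e (s := co u) (c := T w k j m (co u) x (co y)) (by rw [h.n2]; simp)) hf hP
  have d1 := di _ _ h.u1 h.u2; have d2 := di _ _ h.x1 h.x2; have d3 := di _ _ h.y1 h.y2
  simp only [co_co] at b1 b3 b4 b5
  have cx := h.u1; have cu := h.x1; have cy := h.y1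
  clear hP hf e
  exact omL (b1 := w k) (c1 := co (w k)) (u1 := u) (v1 := co u) (b2 := w j) (c2 := co (w j)) (u2 := x) (v2 := co x)
    (b3 := w m) (c3 := co (w m)) (u3 := y) (v3 := co y) d1 d2 d3 (by clear b2 b3 b4 b5; grind) (by clear b1 b3 b4 b5; grind)
    (by clear b2 b1 b4 b5; grind) (by clear b2 b3 b1 b5; grind) (by clear b2 b3 b4 b1; grind)
theorem Om2 {w f g : Wrd} {k j m n : ι} {u x y : Fin 6} (h : S5F C w k j m u x y)
    (hf : ∀ n, n ≠ k → n ≠ j → n ≠ m → f n = w n) (hP : ∀ x, In f x → UC C x → In w x)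
    (hg : ∀ n, n ≠ k → n ≠ j → n ≠ m → g n = w n) (hP' : ∀ x, In g x → UC C x → In w x) (hn : n = k ∨ n = j ∨ n = m) (e : f n = g n) : f = g := by
  have di : ∀ b v : Fin 6, v ≠ b → v ≠ co b → b ≠ v ∧ b ≠ co v ∧ b ≠ co b ∧ co b ≠ v ∧ co b ≠ co v ∧ v ≠ co v := by decide
  have d1 := di _ _ h.u1 h.u2; have d2 := di _ _ h.x1 h.x2; have d3 := di _ _ h.y1 h.y2
  have o1 := Om h hf hP
  have o2 := Om h hg hP'
  have : f k = g k ∧ f j = g j ∧ f m = g m := by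
    clear hP hP' hf hg h
    rcases hn with r | r | r <;> subst r <;> grind
  funext q
  by_cases e1 : q = k
  · rw [e1]; exact this.1
  by_cases e2 : q = j
  · rw [e2]; exact this.2.1
  by_cases e3 : q = m
  · rw [e3]; exact this.2.2
  rw [hf q e1 e2 e3, hg q e1 e2 e3]
theorem nfl {C2 A C3 : Finset Wrd} {o w3 : Wrd} {P : (ι → Fin 8) → Prop} {q : ι}
    (hC2 : Code C2) (h2 : 2 ≤ C2.card) (hs2 : Spl C2 A P) (hn2 : Disjoint A C2) (FA : Five A o) (oC : o ∈ C2)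
    (F3 : Five C3 w3) (hP3 : ∀ x, P x ↔ UC C3 x ∧ ¬ In w3 x) (hf3 : ∀ c ∈ C3, c q = w3 q) (hfA : ∀ a ∈ A, a q = o q) (hoq : o q = co (w3 q)) : False := by
  obtain ⟨c, hc, hco⟩ := Finset.exists_mem_ne (by omega : 1 < C2.card) o
  by_cases e : c q = co (w3 q)
  · have : Cov A c := by
      intro x hx
      by_contra hh
      have := (hP3 x).1 ((hs2.2 x).2 ⟨⟨c, hc, hx⟩, hh⟩)
      obtain ⟨⟨d, hd, hdx⟩, _⟩ := this
      have h1 := hdx q; have h2 := hx q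
      rw [hf3 d hd] at h1; rw [e, inn_co] at h2
      exact h2 h1
    exact M5 FA.hC FA.hT (by rw [FA.h5]) this FA.ho (fun h => Finset.disjoint_left.1 hn2 h hc) FA.hn (hC2 c hc o oC hco)
  · obtain ⟨p, p1, p2⟩ := inn_ex2 _ _ e
    apply NoP (g := upd c q (w3 q)) F3.hC F3.hT F3.h5 F3.ho F3.hn
    intro x hx
    have xq := hx q
    simp at xq
    have y1 : In c (upd x q p) := by
      intro n; by_cases e : n = q
      · subst e; simpa using p1
      · simpa [e] using hx n
    have y2 : ¬ UC A (upd x q p) := by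
      rintro ⟨a, ha, hax⟩
      have := hax q
      rw [hfA a ha, hoq, inn_co] at this
      simp at this; exact this p2
    obtain ⟨⟨d, hd, hdx⟩, hw⟩ := (hP3 _).1 ((hs2.2 _).2 ⟨⟨c, hc, y1⟩, y2⟩)
    refine ⟨⟨d, hd, ?_⟩, fun h => hw ?_⟩
    · intro n; by_cases e : n = q
      · subst e; rw [hf3 d hd]; exact xq
      · simpa [e] using hdx n
    · intro n; by_cases e : n = q
      · subst e; simpa using p2
      · simpa [e] using h n
theorem P15c (hι : Fintype.card ι ≤ 6) {C2 A C3 : Finset Wrd} {o w3 : Wrd} {P : (ι → Fin 8) → Prop} {i k j m q0 : ι} {u x y : Fin 6}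
    (hC2 : Code C2) (h2 : 2 ≤ C2.card) (hs2 : Spl C2 A P) (hn2 : Disjoint A C2) (FA : Five A o) (oC : o ∈ C2)
    (F3 : Five C3 w3) (hP3 : ∀ x, P x ↔ UC C3 x ∧ ¬ In w3 x) (S : S5F C3 w3 k j m u x y) (ik : i ≠ k) (ij : i ≠ j) (im : i ≠ m)
    (hAi : ∀ a ∈ A, a i = w3 i) (ho : o i = w3 i) (hq : ∀ q, q ≠ k → q ≠ j → q ≠ m → q ≠ i → o q = co (w3 q))
    (q1 : q0 ≠ k) (q2 : q0 ≠ j) (q3 : q0 ≠ m) (q4 : q0 ≠ i) : False := by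
  have nf : ∀ q, q ≠ k → q ≠ j → q ≠ m → q ≠ i → ∃ c ∈ A, c q ≠ o q := by
    intro q a1 a2 a3 a4
    by_contra hh
    push Not at hh
    exact nfl hC2 h2 hs2 hn2 FA oC F3 hP3 (fun c hc => S5F_off S F3 hc a1 a2 a3) hh (hq q a1 a2 a3 a4)
  obtain ⟨j2, m2, u2, x2, y2, S2⟩ := Five_at FA (nf q0 q1 q2 q3 q4)
  have hQ : ∀ q, q ≠ k → q ≠ j → q ≠ m → q ≠ i → q = q0 ∨ q = j2 ∨ q = m2 := by
    intro q a1 a2 a3 a4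
    obtain ⟨c, hc, hcq⟩ := nf q a1 a2 a3 a4
    by_contra hh
    push Not at hh
    exact hcq (S5F_off S2 FA hc hh.1 hh.2.1 hh.2.2)
  set g1 := T o q0 j2 m2 u2 (co x2) y2 with hg1
  set g2 := T o q0 j2 m2 (co u2) x2 (co y2) with hg2
  have g1A : g1 ∈ A := N_sub (a := o) (k := q0) (s := u2) (by rw [S2.n1]; simp [hg1])
  have g2A : g2 ∈ A := N_sub (a := o) (k := q0) (s := co u2) (by rw [S2.n2]; simp [hg2])
  have gJ : ∀ n, n = q0 ∨ n = j2 ∨ n = m2 → g1 n ≠ o n ∧ g1 n ≠ co (o n) ∧ g2 n ≠ o n ∧ g2 n ≠ co (o n) ∧ g1 n ≠ g2 n := by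
    rintro n (e | e | e) <;> subst e <;> rw [hg1, hg2]
    · rw [T_k S2.kj S2.km, T_k S2.kj S2.km]
      have := co_conj S2.u1 S2.u2
      exact ⟨S2.u1, S2.u2, this.1, this.2, ne_co _⟩
    · rw [T_j S2.jm, T_j S2.jm]
      have := co_conj S2.x1 S2.x2
      exact ⟨this.1, this.2, S2.x1, S2.x2, fun h => ne_co _ h.symm⟩
    · rw [T_m, T_m]
      have := co_conj S2.y1 S2.y2
      exact ⟨S2.y1, S2.y2, this.1, this.2, ne_co _⟩
  let tl : Wrd → ι → Fin 6 := fun g n => if n = k ∨ n = j ∨ n = m then g n else w3 n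
  have t1 : ∀ g n, n ≠ k → n ≠ j → n ≠ m → tl g n = w3 n := by
    intro g n a b c; simp [tl, a, b, c]
  have t0 : ∀ g n, n = k ∨ n = j ∨ n = m → tl g n = g n := by
    intro g n a; simp only [tl, if_pos a]
  have t2 : ∀ g ∈ A, (∀ q, q ≠ k → q ≠ j → q ≠ m → q ≠ i → g q ≠ o q) → ∀ x, In (tl g) x → UC C3 x → In w3 x := by
    intro g hg hgo x hx hux
    by_contra hw
    have : ∀ n, ∃ p, inn (g n) p ∧ ((n = k ∨ n = j ∨ n = m) → p = x n) ∧ (¬ (n = k ∨ n = j ∨ n = m) → inn (w3 n) p) := by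
      intro n
      by_cases hn : n = k ∨ n = j ∨ n = m
      · refine ⟨x n, ?_, fun _ => rfl, fun h => (h hn).elim⟩
        have := hx n; rw [t0 g n hn] at this; exact this
      · have hc : g n ≠ co (w3 n) := by
          by_cases e : n = i
          · subst e; rw [hAi g hg]; exact ne_co _
          · have hn' := hn
            push Not at hn'
            rw [← hq n hn'.1 hn'.2.1 hn'.2.2 e]; exact hgo n hn'.1 hn'.2.1 hn'.2.2 e
        obtain ⟨p, p1, p2⟩ := inn_ex2 _ _ hc
        exact ⟨p, p1, fun h => (hn h).elim, fun _ => p2⟩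
    choose x' y1 y2 y3 using this
    have hnP : ¬ P x' := by
      rw [hs2.2 x']; rintro ⟨_, h⟩; exact h ⟨g, hg, y1⟩
    apply hnP
    rw [hP3]
    obtain ⟨c, hc, hcx⟩ := hux
    refine ⟨⟨c, hc, ?_⟩, fun h => hw ?_⟩
    · intro n
      by_cases hn : n = k ∨ n = j ∨ n = m
      · rw [y2 n hn]; exact hcx n
      · have := y3 n hn
        push Not at hn
        rw [S5F_off S F3 hc hn.1 hn.2.1 hn.2.2]; exact this
    · intro n
      by_cases hn : n = k ∨ n = j ∨ n = m
      · rw [← y2 n hn]; exact h n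
      · have := hx n
        push Not at hn
        rw [t1 g n hn.1 hn.2.1 hn.2.2] at this; exact this
  have hh1 := t2 g1 g1A (fun q a b c d => (gJ q (hQ q a b c d)).1)
  have hh2 := t2 g2 g2A (fun q a b c d => (gJ q (hQ q a b c d)).2.2.1)
  have i2 : i ≠ q0 ∧ i ≠ j2 ∧ i ≠ m2 := by
    have : ∀ n, n = q0 ∨ n = j2 ∨ n = m2 → i ≠ n := by
      intro n hn e
      subst e
      exact (gJ i hn).1 (by rw [hAi _ g1A, ho])
    exact ⟨this _ (by simp), this _ (by simp), this _ (by simp)⟩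
  have ex1 : ∃ n, (n = k ∨ n = j ∨ n = m) ∧ (n = q0 ∨ n = j2 ∨ n = m2) := by
    by_contra hh
    have : ({i, k, j, m, q0, j2, m2} : Finset ι).card = 7 := by
      have := S.kj; have := S.km; have := S.jm; have := S2.kj; have := S2.km; have := S2.jm
      have a1 : ¬ (k = q0 ∨ k = j2 ∨ k = m2) := fun h => hh ⟨k, by simp, h⟩
      have a2 : ¬ (j = q0 ∨ j = j2 ∨ j = m2) := fun h => hh ⟨j, by simp, h⟩
      have a3 : ¬ (m = q0 ∨ m = j2 ∨ m = m2) := fun h => hh ⟨m, by simp, h⟩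
      push Not at a1 a2 a3
      repeat rw [Finset.card_insert_of_notMem (by simp; tauto)]
      simp
    have := Finset.card_le_univ ({i, k, j, m, q0, j2, m2} : Finset ι)
    omega
  have ex2 : ∃ n, (n = k ∨ n = j ∨ n = m) ∧ ¬ (n = q0 ∨ n = j2 ∨ n = m2) := by
    by_contra hh
    have a1 : k = q0 ∨ k = j2 ∨ k = m2 := by by_contra h; exact hh ⟨k, by simp, h⟩
    have a2 : j = q0 ∨ j = j2 ∨ j = m2 := by by_contra h; exact hh ⟨j, by simp, h⟩
    have a3 : m = q0 ∨ m = j2 ∨ m = m2 := by by_contra h; exact hh ⟨m, by simp, h⟩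
    have := S.kj; have := S.km; have := S.jm
    clear hh hh1 hh2 t2 t1 t0 gJ hQ nf hq
    grind
  obtain ⟨n, n1, n2⟩ := ex1
  obtain ⟨p, p1, p2⟩ := ex2
  have := Om2 S (t1 g1) hh1 (t1 g2) hh2 p1 (by
    push Not at p2
    rw [t0 g1 p p1, t0 g2 p p1, hg1, hg2, T_o p2.1 p2.2.1 p2.2.2, T_o p2.1 p2.2.1 p2.2.2])
  have h := congrFun this n
  rw [t0 g1 n n1, t0 g2 n n1] at h
  exact (gJ n n2).2.2.2.2 h
theorem mkFive {P : (ι → Fin 8) → Prop} (hX : Code X) (hXT : TF X)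
    (hd : Disjoint X Y) (hc : (K X i s).card = 5) (hY : Sl Y i l s = {w}) (hs : Spl (Sl X i l s) (Sl Y i l s) P) :
    Five (Sl X i l s) w ∧ (∀ x, P x ↔ UC (Sl X i l s) x ∧ ¬ In w x) ∧ w i = l := by
  have hw : w ∈ Sl Y i l s := by rw [hY]; simp
  refine ⟨⟨Sl_code hX, Sl_TF hXT, by rw [Sl_card, hc], hs.1 w hw, fun h => Finset.disjoint_left.1 (Sl_disj hd) h hw⟩, fun x => ?_, (mem_Sl.1 hw).1⟩
  rw [hs.2 x, hY]; simp [UC]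
theorem P15d (i5 : 5 ≤ Fintype.card ι) (i6 : Fintype.card ι ≤ 6) (hV : Code V) (hVT : TF V) (hW : Code W) (hWT : TF W)
    (hd : Disjoint V W) (he : Eqv V W) (nf : ∀ k κ, ¬ ∀ v ∈ V, v k = κ) {l b t : Fin 6}
    (h1 : b ≠ l) (h2 : b ≠ co l) (h3 : t ≠ l) (h4 : t ≠ co l) (h5 : t ≠ b) (h6 : t ≠ co b)
    (c1 : (K V i l).card = 1) (c2 : (K V i (co l)).card ≤ 5) (c3 : (K V i b).card = 5) (c4 : (K V i (co b)).card = 5)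
    (c5 : (K V i t).card = 0) (c6 : (K V i (co t)).card = 0) (d1 : (K W i l).card = 5) (d2 : 2 ≤ (K W i (co l)).card)
    {v w3 w4 : Wrd} {P : (ι → Fin 8) → Prop}
    (e1 : Sl V i l l = {v}) (e3 : Sl W i l b = {w3}) (e4 : Sl W i l (co b) = {w4})
    (s1 : Spl (Sl W i l l) (Sl V i l l) P) (s2 : Spl (Sl W i l (co l)) (Sl V i l (co l)) P)
    (s3 : Spl (Sl V i l b) (Sl W i l b) P) (s4 : Spl (Sl V i l (co b)) (Sl W i l (co b)) P) : False := by
  obtain ⟨F1, G1, _⟩ := mkFive hW hWT hd.symm d1 e1 s1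
  obtain ⟨F3, G3, wi⟩ := mkFive hV hVT hd c3 e3 s3
  obtain ⟨F4, G4, _⟩ := mkFive hV hVT hd c4 e4 s4
  obtain ⟨k, j, m, u, x, y, S⟩ := Five_ex F3
  have m1 : T w3 k j m u x (w3 m) ∈ Sl V i l b := N_sub (a := w3) (k := k) (s := u) (by rw [S.n1]; simp)
  have m2 : T w3 k j m u (co x) y ∈ Sl V i l b := N_sub (a := w3) (k := k) (s := u) (by rw [S.n1]; simp)
  have m1i := (mem_Sl.1 m1).1; have m2i := (mem_Sl.1 m2).1
  rw [← wi] at m1i m2i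
  have ik : i ≠ k := by
    intro e; rw [e, T_k S.kj S.km] at m1i; exact S.u1 m1i
  have ij : i ≠ j := by
    intro e; rw [e, T_j S.jm] at m1i; exact S.x1 m1i
  have im : i ≠ m := by
    intro e; rw [e, T_m] at m2i; exact S.y1 m2i
  have main : ∀ q, q ≠ k → q ≠ j → q ≠ m → q ≠ i → ∃ o, o ∈ Sl W i l (co l) ∧ Five (Sl V i l (co l)) o ∧ o q = co (w3 q) := by
    intro q a1 a2 a3 a4
    have f3 : ∀ c ∈ Sl V i l b, c q = w3 q := fun c hc => S5F_off S F3 hc a1 a2 a3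
    have f4 := (FLG F4 (fun x => (G3 x).symm.trans (G4 x)) f3).1
    have f1 := (FLG F1 (fun x => (G3 x).symm.trans (G1 x)) f3).2
    have r3 := slrest a4 (Finset.Subset.refl _) f3
    have r4 := slrest a4 (Finset.Subset.refl _) f4
    have r1 := slrest (E := Sl V i l l) (κ := w3 q) a4 (Finset.Subset.refl _) (by rw [e1]; simpa using f1)
    rw [Sl_card] at r1 r3 r4
    have hsub : ∀ s, K (V.filter (fun v => v q ≠ w3 q)) i s ⊆ K V i s := by
      intro s w hw
      rw [mem_K] at hw ⊢
      exact ⟨(Finset.mem_filter.1 hw.1).1, hw.2⟩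
    have g2 := Finset.card_le_card (hsub (co l)); have g5 := Finset.card_le_card (hsub t)
    have g6 := Finset.card_le_card (hsub (co t))
    have hs := cardK (V.filter (fun v => v q ≠ w3 q)) i h1 h2 h3 h4 h5 h6
    have r0 : 1 ≤ (V.filter (fun v => v q ≠ w3 q)).card := by
      have hf := nf q (w3 q)
      push Not at hf
      obtain ⟨v, hv, hvk⟩ := hf
      exact Finset.card_pos.2 ⟨v, Finset.mem_filter.2 ⟨hv, hvk⟩⟩
    obtain ⟨r5, w, hw, hwk, hM⟩ := R56 hV hVT hW hWT hd he q (w3 q) r0 (by omega)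
    have hK2 : K (V.filter (fun v => v q ≠ w3 q)) i (co l) = K V i (co l) := Finset.eq_of_subset_of_card_le (hsub _) (by omega)
    have hK3 : K (V.filter (fun v => v q ≠ w3 q)) i (co l) = V.filter (fun v => v q ≠ w3 q) :=
      Finset.eq_of_subset_of_card_le (fun c hc => K_sub hc) (by omega)
    have hMK : M V w = K V i (co l) := by rw [hM, ← hK3, hK2]
    have hc5 : (K V i (co l)).card = 5 := by omega
    have hcov : Cov V w := he.cov hw
    have hN : N V w i (co l) = K V i (co l) := by
      rw [← hMK]; ext c
      rw [mem_N, mem_M]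
      constructor
      · intro h; exact ⟨h.1, h.2.1⟩
      · intro h; refine ⟨h.1, h.2, ?_⟩
        have : c ∈ M V w := mem_M.2 h
        rw [hMK, mem_K] at this
        exact this.2
    obtain ⟨c0, hc0⟩ := Finset.card_pos.1 (by omega : 0 < (K V i (co l)).card)
    have hc0' := hc0
    rw [← hMK, mem_M] at hc0'
    have wl : w i = co l := by
      by_contra e
      have q := S5pat (k := i) (u := co l) hV hVT hcov (Ne.symm e) (fun h => hc0'.2 ⟨i, by rw [(mem_K.1 hc0).2, h]⟩)
        (by rw [hN]; exact ⟨c0, hc0⟩) (by rw [hMK, hc5])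
      have := q.2.1
      rw [hN] at this
      omega
    have hwe : upd w i (co l) = w := by rw [← wl]; simp
    have cw : Cov (Sl V i l (co l)) (upd w i l) := by
      apply Cov_Sl
      rw [hwe, ← hMK]
      exact Cov_M hcov
    have oW : upd w i l ∈ Sl W i l (co l) := by
      rw [← wl]; exact Sl_mem hw
    refine ⟨upd w i l, oW, ⟨Sl_code hV, Sl_TF hVT, by rw [Sl_card, hc5], cw, fun h => Finset.disjoint_left.1 (Sl_disj hd) h oW⟩, ?_⟩
    simp [a4, hwk]
  have : ∃ q0, q0 ≠ k ∧ q0 ≠ j ∧ q0 ≠ m ∧ q0 ≠ i := by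
    by_contra hh
    push Not at hh
    have h := Finset.card_le_card (show (Finset.univ : Finset ι) ⊆ {k, j, m, i} from by
      intro q _
      simp only [Finset.mem_insert, Finset.mem_singleton]
      by_contra h
      push Not at h
      exact h.2.2.2 (hh q h.1 h.2.1 h.2.2.1))
    have := Finset.card_le_four (a := k) (b := j) (c := m) (d := i)
    rw [Finset.card_univ] at h
    omega
  obtain ⟨q0, q1, q2, q3, q4⟩ := this
  obtain ⟨o, oW, oF, oq⟩ := main q0 q1 q2 q3 q4
  refine P15c i6 (C2 := Sl W i l (co l)) (A := Sl V i l (co l)) (Sl_code hW) (by rw [Sl_card]; exact d2) s2 (Sl_disj hd) oF oW F3 G3 S ik ij im ?_ ?_ ?_ q1 q2 q3 q4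
  · intro a ha; rw [(mem_Sl.1 ha).1, wi]
  · rw [(mem_Sl.1 oW).1, wi]
  · intro q a1 a2 a3 a4
    obtain ⟨o', oW', oF', oq'⟩ := main q a1 a2 a3 a4
    by_cases e : o = o'
    · rw [e]; exact oq'
    · exact (M5 oF.hC oF.hT (by rw [oF.h5]) oF.ho oF'.ho oF.hn oF'.hn (Sl_code hW o oW o' oW' e)).elim
structure CA (V W : Finset Wrd) (i : ι) (l b t : Fin 6) : Prop where
  hV : Code V
  hVT : TF V
  hW : Code W
  hWT : TF W
  hd : Disjoint V W
  he : Eqv V W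
  nf : ∀ k κ, ¬ ∀ v ∈ V, v k = κ
  i5 : 5 ≤ Fintype.card ι
  i6 : Fintype.card ι ≤ 6
  h16 : V.card ≤ 16
  h1 : b ≠ l
  h2 : b ≠ co l
  h3 : t ≠ l
  h4 : t ≠ co l
  h5 : t ≠ b
  h6 : t ≠ co b
  HA : ∀ w ∈ W, w i ≠ l → w i ≠ co l → ∀ v ∈ V, (v i = l ∨ v i = co l) → D v w
  p1 : 1 ≤ (K V i l).card
  p2 : (K V i l).card ≤ (K V i (co l)).card
  p3 : ¬ ((K V i l).card = 1 ∧ (K V i (co l)).card = 1)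
theorem CA.swap {l b t : Fin 6} (h : CA V W i l b t) : CA V W i l t b :=
  { h with h1 := h.h3, h2 := h.h4, h3 := h.h1, h4 := h.h2, h5 := h.h5.symm, h6 := fun e => h.h6 (by rw [e, co_co]) }
theorem CA.cob {l b t : Fin 6} (h : CA V W i l b t) : CA V W i l (co b) t :=
  { h with h1 := (co_conj h.h1 h.h2).1, h2 := (co_conj h.h1 h.h2).2, h5 := h.h6, h6 := by rw [co_co]; exact h.h5 }
theorem CA.dich {l b t : Fin 6} (h : CA V W i l b t) (s1 : s ≠ l) (s2 : s ≠ co l)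
    (hr : r = l ∨ r = co l) (ha : a ∈ Sl V i l r) (hE : e ∈ Sl W i l s) : D a e := by
  rw [mem_Sl] at ha hE
  obtain ⟨n, hn⟩ := h.HA _ hE.2 (by simpa using s1) (by simpa using s2) _ ha.2 (by simpa using hr)
  by_cases e : n = i
  · subst e
    simp at hn
    rcases hr with r | r
    · exact (s2 (by rw [← r, hn, co_co])).elim
    · exact (s1 (co_inj _ _ (by rw [← hn, r]))).elim
  · exact ⟨n, by simpa [e] using hn⟩
theorem CA.E0 {l b t : Fin 6} (h : CA V W i l b t) (s1 : s ≠ l) (s2 : s ≠ co l)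
    (hr : r = l ∨ r = co l) (x) (hx : 1 ≤ F (Sl V i l r) x) : F (Sl W i l s) x = 0 := by
  by_contra hh
  obtain ⟨a, ha, hax⟩ := F_pos.1 hx
  obtain ⟨e, he, hex⟩ := F_pos.1 (Nat.one_le_iff_ne_zero.2 hh)
  exact notD_of_In hax hex (h.dich s1 s2 hr ha he)
theorem CA.cov {l b t : Fin 6} (h : CA V W i l b t)
    (hr : r = l ∨ r = co l) : ∀ a ∈ Sl V i l r, Cov (Sl W i l r) a := by
  intro a ha x hx
  have hx1 : 1 ≤ F (Sl V i l r) x := F_pos.2 ⟨a, ha, hx⟩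
  have e1 := h.E0 h.h1 h.h2 hr x hx1
  have e2 := h.E0 h.h3 h.h4 hr x hx1
  have f := Fsum h.hV h.hW h.he i l h.h1 h.h2 h.h3 h.h4 h.h5 h.h6 x
  have g := Fdiff h.hV h.hW h.he i l l x
  apply F_pos.1
  rcases hr with r | r <;> subst r <;> omega
theorem CA.B {l b t : Fin 6} (h : CA V W i l b t) (hr : r = l ∨ r = co l) :
    (1 ≤ (K V i r).card → 5 ≤ (K W i r).card) ∧ (2 ≤ (K V i r).card → 7 ≤ (K W i r).card) ∧ (3 ≤ (K V i r).card → 8 ≤ (K W i r).card) := by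
  have := CovB (Sl_code h.hV) (Sl_TF h.hVT) (Sl_code h.hW) (Sl_TF h.hWT) (h.cov hr) (fun a ha => Finset.disjoint_left.1 (Sl_disj h.hd) ha)
  simpa only [Sl_card] using this
theorem F_zero (h : (K X i s).card = 0) (x) : F (Sl X i l s) x = 0 := by
  rw [← Sl_card X i l s, Finset.card_eq_zero] at h
  rw [h]; exact F_empty
theorem CA.dead {l b t : Fin 6} (h : CA V W i l b t) (b1 : (K V i b).card = 0) (b2 : (K V i t).card = 0)
    (b3 : (K W i b).card = 0) (b4 : (K W i t).card = 0) : False := by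
  have : Eqv (Sl V i l l) (Sl W i l l) := by
    apply eqv_F
    intro x
    have f := Fsum h.hV h.hW h.he i l h.h1 h.h2 h.h3 h.h4 h.h5 h.h6 x
    rw [F_zero b1, F_zero b2, F_zero b3, F_zero b4] at f
    omega
  have c := cardK V i h.h1 h.h2 h.h3 h.h4 h.h5 h.h6
  have := E8 (Sl_code h.hV) (Sl_TF h.hVT) (Sl_code h.hW) (Sl_TF h.hWT) (Sl_disj h.hd) this (by
    rw [Sl_card]; have := h.p2; have := h.h16; omega)
  rw [Sl_card] at this
  have := h.p1
  omega
theorem Zp (hV : Code V) (hVT : TF V) (hW : Code W) (hWT : TF W) (hd : Disjoint V W) (he : Eqv V W)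
    (z1 : (K W i (co s)).card = 0) (z2 : (K W i s).card ≤ 3) (z3 : (K V i (co s)).card + (K W i s).card ≤ 7) :
    (K W i s).card = 0 ∧ (K V i s).card = 0 ∧ (K V i (co s)).card = 0 := by
  have kd := Kdiff hV hW he i s
  have fd : ∀ x, F (Sl V i s s) x = F (Sl V i s (co s)) x + F (Sl W i s s) x := by
    intro x; have := Fdiff hV hW he i s s x; rw [F_zero z1] at this; omega
  have cv := CovB (Sl_code hV) (Sl_TF hVT) (Sl_code hV) (Sl_TF hVT) (A := Sl V i s (co s)) (C := Sl V i s s) (by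
    intro a ha x hx
    have : 1 ≤ F (Sl V i s (co s)) x := F_pos.2 ⟨a, ha, hx⟩
    apply F_pos.1; rw [fd]; omega) (fun a ha => Finset.disjoint_right.1 (Sl_disj_co hVT) ha)
  simp only [Sl_card] at cv
  have z : (K V i (co s)).card = 0 := by omega
  have := Eq7 (Sl_code hV) (Sl_TF hVT) (Sl_code hW) (Sl_TF hWT) (Sl_disj (k := i) (l := s) (s := s) hd) (eqv_F (by
    intro x; rw [fd, F_zero z]; omega)) (by rw [Sl_card]; omega)
  simp only [Sl_card] at this
  exact ⟨this.2, this.1, z⟩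
def PP (V W : Finset Wrd) (i : ι) (l : Fin 6) (x : ι → Fin 8) : Prop := 1 ≤ F (Sl W i l l) x ∧ F (Sl V i l l) x = 0
theorem SplF {P : (ι → Fin 8) → Prop} (h1 : ∀ x, 1 ≤ F A x → 1 ≤ F C x) (h2 : ∀ x, P x ↔ (1 ≤ F C x ∧ F A x = 0)) :
    Spl C A P := by
  refine ⟨fun a ha x hx => F_pos.1 (h1 x (F_pos.2 ⟨a, ha, hx⟩)), fun x => ?_⟩
  rw [h2 x]
  have e1 : UC C x ↔ 1 ≤ F C x := F_pos.symm
  have e2 : UC A x ↔ 1 ≤ F A x := F_pos.symm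
  rw [e1, e2]
  constructor <;> rintro ⟨a, b⟩ <;> refine ⟨a, by omega⟩
theorem CA.spl {l b t : Fin 6} (h : CA V W i l b t)
    (a1 : (K V i t).card = 0) (a2 : (K W i t).card = 0) :
    Spl (Sl W i l l) (Sl V i l l) (PP V W i l) ∧ Spl (Sl W i l (co l)) (Sl V i l (co l)) (PP V W i l) ∧
    Spl (Sl V i l b) (Sl W i l b) (PP V W i l) ∧ Spl (Sl V i l (co b)) (Sl W i l (co b)) (PP V W i l) := by
  have fV : ∀ s x, F (Sl V i l s) x ≤ 1 := fun s x => F_le (Sl_code h.hV) x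
  have fW : ∀ s x, F (Sl W i l s) x ≤ 1 := fun s x => F_le (Sl_code h.hW) x
  have f : ∀ x, F (Sl V i l l) x + F (Sl V i l b) x = F (Sl W i l l) x + F (Sl W i l b) x := by
    intro x
    have f := Fsum h.hV h.hW h.he i l h.h1 h.h2 h.h3 h.h4 h.h5 h.h6 x
    rw [F_zero a1, F_zero a2] at f
    exact f
  have g1 := fun x => Fdiff h.hV h.hW h.he i l l x
  have g2 := fun x => Fdiff h.hV h.hW h.he i l b x
  have c := co_conj h.h1 h.h2
  have e1 := h.E0 h.h1 h.h2 (Or.inl rfl)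
  have e2 := h.E0 c.1 c.2 (Or.inl rfl)
  have e3 := h.E0 h.h1 h.h2 (Or.inr rfl)
  refine ⟨SplF ?_ ?_, SplF ?_ ?_, SplF ?_ ?_, SplF ?_ ?_⟩ <;> intro x <;> have k1 := f x <;> have k2 := g1 x <;> have k3 := g2 x <;> have k4 := e1 x <;>
    have k5 := e2 x <;> have k6 := e3 x <;> have q1 := fV l x <;> have q2 := fV (co l) x <;> have q3 := fV b x <;> have q4 := fV (co b) x <;>
    have r1 := fW l x <;> have r2 := fW (co l) x <;> have r3 := fW b x <;> have r4 := fW (co b) x <;> (try unfold PP) <;> clear fV fW f g1 g2 e1 e2 e3 h a1 a2 <;> omega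
theorem P30 {C1 C4 : Finset Wrd} {v : Wrd} {P : (ι → Fin 8) → Prop} (hC1 : Code C1) (hT1 : TF C1) (hC4 : Code C4) (hT4 : TF C4)
    (c1 : C1.card ≤ 6) (c4 : C4.card = 5) (hs : Spl C1 {v} P) (hs4 : Spl C4 ∅ P) (hn : v ∉ C1) : False := by
  have s4 : ∀ x, P x ↔ UC C4 x := by intro x; rw [hs4.2 x]; simp [UC]
  have s1 : ∀ x, P x ↔ UC C1 x ∧ ¬ In v x := by intro x; rw [hs.2 x]; simp [UC]
  have ev := CovB (A := {v}) (C := C1 \ C4) (by intro a ha b hb hab; simp at ha hb; exact (hab (by rw [ha, hb])).elim)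
    (by intro a ha b hb hab; simp at ha hb; subst ha; subst hb; exact D_irr _ (Tw_D hab))
    (hC1.mono Finset.sdiff_subset) (hT1.mono Finset.sdiff_subset) (by
      intro a ha x hx
      simp at ha; subst ha
      obtain ⟨c, hc, hcx⟩ := hs.1 a (by simp) x hx
      refine ⟨c, Finset.mem_sdiff.2 ⟨hc, fun h => ?_⟩, hcx⟩
      exact ((s1 x).1 ((s4 x).2 ⟨c, h, hcx⟩)).2 hx) (by
      intro a ha h; simp at ha; subst ha; exact hn (Finset.mem_sdiff.1 h).1)
  have ea := CovB (A := C4 \ C1) (C := C1 \ C4) (hC4.mono Finset.sdiff_subset) (hT4.mono Finset.sdiff_subset)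
    (hC1.mono Finset.sdiff_subset) (hT1.mono Finset.sdiff_subset) (by
      intro a ha x hx
      rw [Finset.mem_sdiff] at ha
      obtain ⟨⟨c, hc, hcx⟩, _⟩ := (s1 x).1 ((s4 x).2 ⟨a, ha.1, hx⟩)
      refine ⟨c, Finset.mem_sdiff.2 ⟨hc, fun h => ?_⟩, hcx⟩
      exact ha.2 (by rw [code_eq hC4 ha.1 h hx hcx]; exact hc)) (by
      intro a ha h; exact (Finset.mem_sdiff.1 ha).2 (Finset.mem_sdiff.1 h).1)
  have k1 := Finset.card_sdiff_add_card_inter C1 C4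
  have k4 := Finset.card_sdiff_add_card_inter C4 C1
  rw [Finset.inter_comm] at k4
  have := ev.1 (by simp)
  omega
set_option maxHeartbeats 2000000 in
theorem numB {n x1 x2 y1 y2 b1 b2 e1 e2 t1 t2 s1 : ℕ} (z1 : t1 = 0) (z2 : t2 = 0) (z3 : s1 = 0) (k0 : n = x1 + x2 + b1 + b2 + t1 + t2) (h16 : n ≤ 16)
    (k1 : x1 + b1 + t1 = y1 + e1 + s1) (k2 : x1 + y2 = x2 + y1) (k3 : b1 + e2 = b2 + e1)
    (B1 : (1 ≤ x1 → 5 ≤ y1) ∧ (2 ≤ x1 → 7 ≤ y1) ∧ (3 ≤ x1 → 8 ≤ y1)) (B2 : (1 ≤ x2 → 5 ≤ y2) ∧ (2 ≤ x2 → 7 ≤ y2) ∧ (3 ≤ x2 → 8 ≤ y2))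
    (B3 : (1 ≤ e1 → 5 ≤ b1) ∧ (2 ≤ e1 → 7 ≤ b1) ∧ (3 ≤ e1 → 8 ≤ b1)) (p1 : 1 ≤ x1) (p2 : x1 ≤ x2) (p3 : ¬ (x1 = 1 ∧ x2 = 1)) (hle : e2 ≤ e1) :
    (e2 = 0 ∧ e1 ≤ 3 ∧ (b2 + e1 ≤ 7 ∨ (x1 = 1 ∧ y1 = 6 ∧ b2 = 5))) ∨
    (e1 = 1 ∧ e2 = 1 ∧ ((y1 = 5 ∧ x1 = 1 ∧ x2 ≤ 5 ∧ b1 = 5 ∧ b2 = 5 ∧ 2 ≤ y2) ∨ (x2 = 2 ∧ y2 = 7 ∧ b1 = 6 ∧ b2 = 6) ∨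
      (x1 = 1 ∧ x2 = 3 ∧ y1 = 6 ∧ b1 = 6 ∧ b2 = 6))) ∨ (x2 = 2 ∧ y2 = 7 ∧ e1 = 2 ∧ b1 = 7) := by
  subst z1 z2 z3
  obtain ⟨B1a, B1b, B1c⟩ := B1
  obtain ⟨B2a, B2b, B2c⟩ := B2
  obtain ⟨B3a, B3b, B3c⟩ := B3
  have b1 := B1a p1
  clear B1a B2a
  have d1 : x1 = 1 ∨ x1 = 2 ∨ 3 ≤ x1 := by omega
  have d2 : x2 = 1 ∨ x2 = 2 ∨ 3 ≤ x2 := by omega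
  rcases d1 with r | r | r <;> rcases d2 with q | q | q
  all_goals first | (exfalso; clear B1b B1c B2b B2c B3a B3b B3c; omega) | skip
  all_goals have c1 := B2b (by omega)
  all_goals try have c2 := B2c q
  all_goals try have c3 := B1b (by omega)
  all_goals try have c4 := B1c r
  all_goals clear B1b B1c B2b B2c p3
  all_goals have d3 : e1 = 0 ∨ e1 = 1 ∨ e1 = 2 ∨ e1 = 3 := by (clear B3a B3b B3c; omega)
  all_goals rcases d3 with f | f | f | f <;> subst f <;> simp at B3a B3b B3c
  all_goals have d4 : e2 = 0 ∨ e2 = 1 := by omega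
  all_goals rcases d4 with f | f <;> subst f
  all_goals first
    | exact Or.inl ⟨rfl, by omega, by omega⟩
    | exact absurd hle (by omega)
    | exact Or.inr (Or.inl ⟨rfl, rfl, by omega⟩)
    | (exfalso; omega)
    | exact Or.inr (Or.inr (by omega))
theorem CA.fin {l b t : Fin 6} (h : CA V W i l b t)
    (a1 : (K V i t).card = 0) (a2 : (K W i t).card = 0) (a3 : (K V i (co t)).card = 0) (a4 : (K W i (co t)).card = 0)
    (hle : (K W i (co b)).card ≤ (K W i b).card) : False := by
  obtain ⟨s1, s2, s3, s4⟩ := h.spl a1 a2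
  have cB := co_conj h.h1 h.h2
  have k0 := cardK V i h.h1 h.h2 h.h3 h.h4 h.h5 h.h6
  have k1 := Ksum h.hV h.hW h.he i h.h1 h.h2 h.h3 h.h4 h.h5 h.h6
  have k2 := Kdiff h.hV h.hW h.he i l
  have k3 := Kdiff h.hV h.hW h.he i b
  have B1 := h.B (Or.inl rfl)
  have B2 := h.B (Or.inr rfl)
  have B3 := CovB (Sl_code h.hW) (Sl_TF h.hWT) (Sl_code h.hV) (Sl_TF h.hVT) s3.1 (fun a ha => Finset.disjoint_right.1 (Sl_disj h.hd) ha)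
  simp only [Sl_card] at B3
  have sing : ∀ {X : Finset Wrd} {s : Fin (6)}, (K X i s).card = 1 → ∃ w, Sl X i l s = {w} := fun {X s} hc =>
    Finset.card_eq_one.1 (by rw [Sl_card]; exact hc)
  have nm : ∀ {s w}, Sl W i l s = {w} → w ∉ Sl V i l s ∧ w ∈ Sl W i l s := by
    intro s w hw
    have : w ∈ Sl W i l s := by rw [hw]; simp
    exact ⟨fun hh => Finset.disjoint_left.1 (Sl_disj h.hd) hh this, this⟩
  have nm2 : ∀ s, ∀ a ∈ Sl V i l s, a ∉ Sl W i l s := fun s a ha => Finset.disjoint_left.1 (Sl_disj h.hd) ha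
  have nB := numB a1 a3 a2 k0 h.h16 k1 k2 k3 B1 B2 B3 h.p1 h.p2 h.p3 hle
  clear k0 k1 k2 k3 B1 B2 B3 hle
  rcases nB with ⟨z, z1, z2 | ⟨z2, z3, z4⟩⟩ | ⟨y, y', hc⟩ | ⟨z1, z2, z3, z4⟩
  · obtain ⟨q1, q2, q3⟩ := Zp h.hV h.hVT h.hW h.hWT h.hd h.he z z1 z2
    exact h.dead q2 a1 q1 a2
  · obtain ⟨v, hv⟩ := sing z2
    have e : Sl W i l (co b) = ∅ := by rw [← Finset.card_eq_zero, Sl_card, z]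
    rw [hv] at s1
    rw [e] at s4
    exact P30 (Sl_code h.hW) (Sl_TF h.hWT) (Sl_code h.hV) (Sl_TF h.hVT) (by rw [Sl_card, z3]) (by rw [Sl_card, z4]) s1 s4
      (nm2 l v (by rw [hv]; simp))
  · obtain ⟨w3, e3⟩ := sing y
    obtain ⟨w4, e4⟩ := sing y'
    have s3' := s3; have s4' := s4
    rw [e3] at s3'; rw [e4] at s4'
    obtain ⟨n3, n3'⟩ := nm e3; obtain ⟨n4, n4'⟩ := nm e4
    rcases hc with ⟨j1, j2, j3, j4, j5, j6⟩ | ⟨j1, j2, j3, j4⟩ | ⟨j1, j2, j3, j4, j5⟩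
    · obtain ⟨v, hv⟩ := sing j2
      exact P15d h.i5 h.i6 h.hV h.hVT h.hW h.hWT h.hd h.he h.nf h.h1 h.h2 h.h3 h.h4 h.h5 h.h6 j2 j3 j4 j5
        a1 a3 j1 j6 hv e3 e4 s1 s2 s3 s4
    · exact XA (Sl_code h.hV) (Sl_TF h.hVT) (Sl_code h.hW) (Sl_TF h.hWT) (by rw [Sl_card]; exact j1) (by rw [Sl_card, j2]) s2 (nm2 _)
        (Sl_code h.hV) (Sl_TF h.hVT) (by rw [Sl_card, j3]) n3 s3' (fun a ha => h.dich h.h1 h.h2 (Or.inr rfl) ha n3')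
        (Sl_code h.hV) (Sl_TF h.hVT) (by rw [Sl_card, j4]) n4 s4' (fun a ha => h.dich cB.1 cB.2 (Or.inr rfl) ha n4')
        (Sl_disj_co h.hVT)
    · obtain ⟨v, hv⟩ := sing j1
      have vm : v ∈ Sl V i l l := by rw [hv]; simp
      have s1' := s1
      rw [hv] at s1'
      obtain ⟨k, κ, q1, q2, q3, f, q4, q5⟩ := P14a (Sl_code h.hW) (Sl_TF h.hWT) (by rw [Sl_card, j3]) (nm2 _ v vm) s1'
        (h.dich h.h1 h.h2 (Or.inl rfl) vm n3') (h.dich cB.1 cB.2 (Or.inl rfl) vm n4')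
        (Sl_code h.hV) (Sl_TF h.hVT) (by rw [Sl_card, j4]) n3 s3' (Sl_code h.hV) (Sl_TF h.hVT) (by rw [Sl_card, j5]) n4 s4' (Sl_disj_co h.hVT)
      refine P14b h.hV h.hVT h.hW h.hWT h.hd h.he h.h1 h.h2 h.h3 h.h4 h.h5 h.h6 j1 j2 j4 j5 a1 a3 ?_ (h.nf k κ)
        ⟨{v}, by rw [hv], by simp, by simpa using q3⟩ q1 q2
      intro e
      subst e
      apply q5
      rw [← q3, (mem_Sl.1 vm).1]
      rcases q4 with r | r <;> exact (mem_Sl.1 r).1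
  · exact XB (Sl_code h.hV) (Sl_TF h.hVT) (Sl_code h.hW) (Sl_TF h.hWT) (by rw [Sl_card, z1]) (by rw [Sl_card, z2]) s2 (nm2 _)
      (Sl_code h.hW) (Sl_TF h.hWT) (Sl_code h.hV) (Sl_TF h.hVT) (by rw [Sl_card, z3]) (by rw [Sl_card, z4]) s3
      (fun a ha hh => nm2 _ a hh ha) (fun a ha b hb => h.dich h.h1 h.h2 (Or.inr rfl) ha hb)
theorem CA.fin2 {l b t : Fin 6} (h : CA V W i l b t)
    (a1 : (K V i t).card = 0) (a2 : (K W i t).card = 0) (a3 : (K V i (co t)).card = 0) (a4 : (K W i (co t)).card = 0) : False := by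
  rcases le_total (K W i (co b)).card (K W i b).card with e | e
  · exact h.fin a1 a2 a3 a4 e
  · exact h.cob.fin a1 a2 a3 a4 (by rw [co_co]; exact e)
theorem CA.fin3 {l b t : Fin 6} (h : CA V W i l b t)
    (hle : (K W i t).card + (K W i (co t)).card ≤ (K W i b).card + (K W i (co b)).card) : False := by
  have k0 := cardK V i h.h1 h.h2 h.h3 h.h4 h.h5 h.h6
  have k1 := Ksum h.hV h.hW h.he i h.h1 h.h2 h.h3 h.h4 h.h5 h.h6
  have k2 := Kdiff h.hV h.hW h.he i l
  have k3 := Kdiff h.hV h.hW h.he i b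
  have k4 := Kdiff h.hV h.hW h.he i t
  have B1 := h.B (Or.inl rfl)
  have B2 := h.B (Or.inr rfl)
  have h16 := h.h16; have p1 := h.p1; have p2 := h.p2; have p3 := h.p3
  by_cases z : (K W i (co t)).card = 0
  · obtain ⟨q1, q2, q3⟩ := Zp h.hV h.hVT h.hW h.hWT h.hd h.he z (by omega) (by omega)
    exact h.fin2 q2 q1 q3 z
  · obtain ⟨q1, q2, q3⟩ := Zp (s := co t) (i := i) h.hV h.hVT h.hW h.hWT h.hd h.he (by rw [co_co]; omega) (by omega) (by rw [co_co]; omega)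
    omega
theorem claimA (hV : Code V) (hVT : TF V) (hW : Code W) (hWT : TF W) (hd : Disjoint V W) (he : Eqv V W)
    (nf : ∀ k κ, ¬ ∀ v ∈ V, v k = κ) (i5 : 5 ≤ Fintype.card ι) (i6 : Fintype.card ι ≤ 6) (h16 : V.card ≤ 16)
    (HA : ∀ w ∈ W, w i ≠ l → w i ≠ co l → ∀ v ∈ V, (v i = l ∨ v i = co l) → D v w)
    (p1 : 1 ≤ (K V i l).card) (p2 : 1 ≤ (K V i (co l)).card) (p3 : ¬ ((K V i l).card = 1 ∧ (K V i (co l)).card = 1)) : False := by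
  have main : ∀ l, (∀ w ∈ W, w i ≠ l → w i ≠ co l → ∀ v ∈ V, (v i = l ∨ v i = co l) → D v w) → (1 ≤ (K V i l).card) →
      ((K V i l).card ≤ (K V i (co l)).card) → (¬ ((K V i l).card = 1 ∧ (K V i (co l)).card = 1)) → False := by
    intro l HA p1 p2 p3
    obtain ⟨b, t, h1, h2, h3, h4, h5, h6⟩ := ex_pair l
    have h : CA V W i l b t := ⟨hV, hVT, hW, hWT, hd, he, nf, i5, i6, h16, h1, h2, h3, h4, h5, h6, HA, p1, p2, p3⟩
    rcases le_total ((K W i t).card + (K W i (co t)).card) ((K W i b).card + (K W i (co b)).card) with e | e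
    · exact h.fin3 e
    · exact h.swap.fin3 e
  rcases le_total (K V i l).card (K V i (co l)).card with e | e
  · exact main l HA p1 e p3
  · refine main (co l) ?_ p2 (by rw [co_co]; exact e) (by rw [co_co]; tauto)
    rw [co_co]
    intro w hw a b v hv c
    exact HA w hw b a v hv c.symm
def ptS {d : ℕ} (x : Fin d → Fin 8) : Fin d → Set (Fin 6) := fun i => {s | inn s (x i)}
theorem ptS_mem {d : ℕ} (v : Fin d → Fin 6) (x : Fin d → Fin 8) : ptS x ∈ WordBox compl6 v ↔ In v x := by
  constructor
  · intro h i; exact (h i).2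
  · intro h i
    refine ⟨fun s => ?_, h i⟩
    have : inn (co s) (x i) ↔ ¬ inn s (x i) := inn_co _ _
    by_cases e : inn s (x i)
    · exact Or.inl ⟨e, fun h' => this.1 h' e⟩
    · exact Or.inr ⟨this.2 e, e⟩
theorem toEqv {d : ℕ} {V W : Finset (Fin d → Fin 6)} (h : EquivalentCodes compl6 V W) : Eqv V W := by
  have key : ∀ (V : Finset (Fin d → Fin 6)) x, ptS x ∈ CodeReal compl6 V ↔ ∃ v ∈ V, In v x := by
    intro V x
    simp only [CodeReal, Set.mem_iUnion, ptS_mem, exists_prop]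
  intro x
  rw [← key, ← key, h]
end PB
theorem distribution_constraints (d : ℕ) (hd : d = 5 ∨ d = 6)
    (V W : Finset (Fin d → Fin 6))
    (hVcode : PolyboxCode compl6 V) (hWcode : PolyboxCode compl6 W)
    (hVtp : TwinPairFree compl6 V) (hWtp : TwinPairFree compl6 W)
    (hdisj : Disjoint V W) (hequiv : EquivalentCodes compl6 V W)
    (hcard : 13 ≤ V.card ∧ V.card ≤ 16) (hflat : ¬ IsFlat compl6 V) :
    ((∀ (i : Fin d) (l : Fin 6),
        ¬ ((V.filter (fun v => v i = l)).card = 1 ∧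
            ((V.filter (fun v => v i = compl6 l)).card = 2 ∨
             (V.filter (fun v => v i = compl6 l)).card = 3 ∨
             (V.filter (fun v => v i = compl6 l)).card = 4))) ∧
      (∀ (i : Fin d) (l : Fin 6), (V.filter (fun v => v i = l)).card ≤ 11)) ∧
    (∀ (i : Fin d) (l : Fin 6),
      ((2 ≤ (V.filter (fun v => v i = l)).card ∧
          2 ≤ (V.filter (fun v => v i = compl6 l)).card) ∨
        ((V.filter (fun v => v i = l)).card = 1 ∧
          5 ≤ (V.filter (fun v => v i = compl6 l)).card)) →
      ∃ s : Fin 6, s ≠ l ∧ s ≠ compl6 l ∧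
        ∃ w ∈ W, (w i = s ∨ w i = compl6 s) ∧
          (WordBox compl6 w ∩
            ⋃ v ∈ {v : Fin d → Fin 6 | v ∈ V ∧ (v i = l ∨ v i = compl6 l)},
              WordBox compl6 v).Nonempty) := by
  have cd : ∀ {X : Finset (Fin d → Fin 6)}, PolyboxCode compl6 X → Code X := by
    intro X h u hu v hv e
    obtain ⟨j, hj⟩ := h u hu v hv e
    exact ⟨j, by rw [hj, co_co]⟩
  have hV : Code V := cd hVcode
  have hW : Code W := cd hWcode
  have hVT : TF V := hVtp
  have hWT : TF W := hWtp
  have he : Eqv V W := toEqv hequiv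
  have nf : ∀ k κ, ¬ ∀ v ∈ V, v k = κ := fun k κ h => hflat ⟨k, κ, h⟩
  have i5 : 5 ≤ Fintype.card (Fin d) := by rw [Fintype.card_fin]; omega
  have i6 : Fintype.card (Fin d) ≤ 6 := by rw [Fintype.card_fin]; omega
  have hK : ∀ i l, V.filter (fun v => v i = l) = K V i l := by
    intro i l; ext c; rw [mem_K, Finset.mem_filter]
  simp only [hK]
  refine ⟨⟨?_, fun i l => class11 hV hVT hW hWT hdisj he hcard.2 i l (nf i l)⟩, ?_⟩
  · rintro i l ⟨x1, x2⟩
    refine claimA hV hVT hW hWT hdisj he nf i5 i6 hcard.2 (i := i) (l := l) ?_ (by omega) (by omega) (by omega)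
    intro w hw w1 w2 v hv hvl
    by_contra hD
    have n1 := N_le_K (C := V) (a := w) (k := i) (s := l)
    have n2 := N_le_K (C := V) (a := w) (k := i) (s := compl6 l)
    have n3 : v ∈ N V w i (v i) := mem_N.2 ⟨hv, hD, rfl⟩
    have n4 := Finset.card_pos.2 ⟨v, n3⟩
    have := LR (k := i) (u := l) hV hVT (he.cov hw) (Ne.symm w1) (fun e => w2 (by rw [e, co_co]))
    rcases hvl with e | e <;> rw [e] at n4 <;> omega
  · intro i l hx
    by_contra hno
    refine claimA hV hVT hW hWT hdisj he nf i5 i6 hcard.2 (i := i) (l := l) ?_ (by omega) (by omega) (by omega)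
    intro w hw w1 w2 v hv hvl
    by_contra hD
    obtain ⟨x, x1, x2⟩ := ex_of_notD hD
    refine hno ⟨w i, w1, w2, w, hw, Or.inl rfl, ptS x, (ptS_mem w x).2 x2, ?_⟩
    simp only [Set.mem_iUnion]
    exact ⟨v, ⟨hv, hvl⟩, (ptS_mem v x).2 x1⟩
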